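/- arXiv:2010.02883 — 8 statements merged into one kernel-verified Lean document; each statement's English description precedes it below -/
import Mathlib

section
/- Let g be a weight on ℤ^c (satisfying (a)–(d)), and let χ : l_{1,g}(ℤ^c,ℂ) → ℂ be a character, i.e. a bounded (continuous) linear functional satisfying χ(a∗b) = χ(a)χ(b) for all a,b and χ(δ) = 1. Set u_m = χ(ε^{e_m}) for m = 1,…,c, where e_m is the m-th standard basis vector of ℤ^c. Then each u_m ≠ 0, χ(ε^n) = u^n for every n ∈ ℤ^c, and for every a ∈ l_{1,g}(ℤ^c,ℂ), χ(a) = Σ_{n∈ℤ^c} u^n a_n. -/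
open scoped Topology

/-- Convolution of complex-valued families on `ℤ^c`. -/
noncomputable def convC (c : ℕ) (a b : (Fin c → ℤ) → ℂ) : (Fin c → ℤ) → ℂ :=
  fun k => ∑' m, a m * b (k - m)

/-- The unit family `δ`. -/
noncomputable def deltaC (c : ℕ) : (Fin c → ℤ) → ℂ := fun k => if k = 0 then 1 else 0

/-- The family `ε^n`, equal to `1` at `n` and `0` elsewhere. -/
noncomputable def epsC (c : ℕ) (n : Fin c → ℤ) : (Fin c → ℤ) → ℂ :=
  fun k => if k = n then 1 else 0

/-- The monomial `u^n = u_1^{n_1} ⋯ u_c^{n_c}`. -/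
noncomputable def upow (c : ℕ) (u : Fin c → ℂ) (n : Fin c → ℤ) : ℂ :=
  ∏ i, u i ^ (n i)

/-- Every character `χ` of the weighted convolution algebra `l_{1,g}(ℤ^c, ℂ)` is given
by `χ(a) = ∑_n u^n a_n` where `u_m = χ(ε^{e_m}) ≠ 0`, and `χ(ε^n) = u^n`. -/
theorem character_representation (c : ℕ) (g : (Fin c → ℤ) → ℝ)
    (hgpos : ∀ n, 0 < g n) (hg0 : g 0 = 1)
    (hsub : ∀ m n, g (m + n) ≤ g m * g n) (hsymm : ∀ n, g (-n) = g n)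
    (hge : ∀ n, 1 ≤ g n)
    (χ : ((Fin c → ℤ) → ℂ) → ℂ)
    (hadd : ∀ a b : (Fin c → ℤ) → ℂ, Summable (fun n => g n * ‖a n‖) →
      Summable (fun n => g n * ‖b n‖) → χ (a + b) = χ a + χ b)
    (hsmul : ∀ (z : ℂ) (a : (Fin c → ℤ) → ℂ), Summable (fun n => g n * ‖a n‖) →
      χ (z • a) = z * χ a)
    (hbdd : ∃ C : ℝ, ∀ a : (Fin c → ℤ) → ℂ, Summable (fun n => g n * ‖a n‖) →
      ‖χ a‖ ≤ C * ∑' n, g n * ‖a n‖)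
    (hmul : ∀ a b : (Fin c → ℤ) → ℂ, Summable (fun n => g n * ‖a n‖) →
      Summable (fun n => g n * ‖b n‖) → χ (convC c a b) = χ a * χ b)
    (hone : χ (deltaC c) = 1)
    (u : Fin c → ℂ) (hu : ∀ i, u i = χ (epsC c (Pi.single i 1))) :
    (∀ i, u i ≠ 0) ∧
    (∀ n, χ (epsC c n) = upow c u n) ∧
    (∀ a : (Fin c → ℤ) → ℂ, Summable (fun n => g n * ‖a n‖) →
      HasSum (fun n => upow c u n * a n) (χ a)) := by
  have hS : ∀ n, Summable (fun k => g k * ‖epsC c n k‖) := by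
    intro n
    refine summable_of_ne_finset_zero (s := {n}) ?_
    intro k hk
    have hk' : k ≠ n := by simpa using hk
    simp [epsC, hk']
  have hconv : ∀ m n, convC c (epsC c m) (epsC c n) = epsC c (m + n) := by
    intro m n
    funext k
    unfold convC
    rw [tsum_eq_single m]
    · have h : k - m = n ↔ k = m + n := by rw [sub_eq_iff_eq_add, add_comm]
      simp [epsC, h]
    · intro b hb
      simp [epsC, hb]
  have hF0 : χ (epsC c 0) = 1 := hone
  have hFadd : ∀ m n, χ (epsC c (m + n)) = χ (epsC c m) * χ (epsC c n) := by
    intro m n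
    rw [← hconv, hmul _ _ (hS m) (hS n)]
  let F : Multiplicative (Fin c → ℤ) →* ℂ :=
    { toFun := fun n => χ (epsC c n.toAdd)
      map_one' := hF0
      map_mul' := fun m n => hFadd m.toAdd n.toAdd }
  let U : Multiplicative (Fin c → ℤ) →* ℂˣ := F.toHomUnits
  have hU : ∀ n : Fin c → ℤ, ((U (Multiplicative.ofAdd n) : ℂˣ) : ℂ) = χ (epsC c n) :=
    fun n => rfl
  have hpow : ∀ n, χ (epsC c n) = upow c u n := by
    intro n
    have hn : (Multiplicative.ofAdd n) =
        ∏ i, (Multiplicative.ofAdd (Pi.single i (1 : ℤ) : Fin c → ℤ)) ^ (n i) := by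
      have h : n = ∑ i, n i • (Pi.single i (1 : ℤ) : Fin c → ℤ) := by
        funext j
        simp [Finset.sum_apply, Pi.single_apply]
      conv_lhs => rw [h]
      rw [ofAdd_sum]
      rfl
    rw [← hU, hn, map_prod, Units.coe_prod]
    unfold upow
    refine Finset.prod_congr rfl fun i _ => ?_
    rw [map_zpow, Units.val_zpow_eq_zpow_val, hU, hu]
  refine ⟨?_, hpow, ?_⟩
  · intro i
    rw [hu, ← hU]
    exact Units.ne_zero _
  intro a ha
  obtain ⟨C, hC⟩ := hbdd
  have hχ0 : χ 0 = 0 := by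
    have := hsmul 0 0 (by simpa using summable_zero)
    simpa using this
  have hfin : ∀ s : Finset (Fin c → ℤ),
      Summable (fun k => g k * ‖(∑ n ∈ s, a n • epsC c n) k‖) ∧
      χ (∑ n ∈ s, a n • epsC c n) = ∑ n ∈ s, upow c u n * a n := by
    have hsm : ∀ n, Summable (fun k => g k * ‖(a n • epsC c n) k‖) := by
      intro n
      refine ((hS n).mul_left ‖a n‖).congr fun k => ?_
      simp only [Pi.smul_apply, smul_eq_mul, norm_mul]
      ring
    intro s
    induction s using Finset.induction_on with
    | empty => exact ⟨by simpa using summable_zero, by simpa using hχ0⟩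
    | insert n s hns ih =>
      simp only [Finset.sum_insert hns]
      refine ⟨?_, ?_⟩
      · refine Summable.of_nonneg_of_le (fun k => mul_nonneg (hgpos k).le (norm_nonneg _))
          (fun k => ?_) ((hsm n).add ih.1)
        rw [← mul_add]
        exact mul_le_mul_of_nonneg_left (norm_add_le _ _) (hgpos k).le
      · rw [hadd _ _ (hsm n) ih.1, ih.2, hsmul _ _ (hS n), hpow, mul_comm]
  have key : ∀ s : Finset (Fin c → ℤ),
      ‖(∑ n ∈ s, upow c u n * a n) - χ a‖ ≤ C * ∑' n : {n // n ∉ s}, g n * ‖a n‖ := by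
    intro s
    let b : (Fin c → ℤ) → ℂ := Set.indicator {n | n ∉ s} a
    have hbn : (fun n => g n * ‖b n‖) = Set.indicator {n | n ∉ s} (fun n => g n * ‖a n‖) := by
      funext n
      by_cases h : n ∈ s <;> simp [b, h]
    have hb : Summable (fun n => g n * ‖b n‖) := by
      rw [hbn]
      exact ha.indicator _
    have hab : a = (∑ n ∈ s, a n • epsC c n) + b := by
      funext k
      by_cases h : k ∈ s <;> simp [b, h, Finset.sum_apply, epsC]
    have h1 : χ a = (∑ n ∈ s, upow c u n * a n) + χ b := by
      conv_lhs => rw [hab]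
      rw [hadd _ _ (hfin s).1 hb, (hfin s).2]
    have h2 := hC b hb
    rw [hbn] at h2
    rw [h1, sub_add_cancel_left, norm_neg]
    refine h2.trans_eq ?_
    congr 1
    exact (tsum_subtype {n | n ∉ s} (fun n => g n * ‖a n‖)).symm
  have ht := (tendsto_tsum_compl_atTop_zero (fun n => g n * ‖a n‖)).const_mul C
  rw [mul_zero] at ht
  exact tendsto_iff_norm_sub_tendsto_zero.2
    (squeeze_zero (fun _ => norm_nonneg _) key ht)
end

section
/- Let g be a weight on ℤ^c (satisfying (a)–(d)) and let u = (u_1,…,u_c) ∈ (ℂ∖{0})^c. The formula χ(a) = Σ_{n∈ℤ^c} u^n a_n defines a character of the convolution algebra l_{1,g}(ℤ^c,ℂ) (in particular, the series converges absolutely for every a ∈ l_{1,g}(ℤ^c,ℂ)) if and only if |u^n| ≤ g(n) for all n ∈ ℤ^c. -/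
open scoped Topology

theorem upow_add_aux (c : ℕ) (u : Fin c → ℂ) (hu : ∀ i, u i ≠ 0) (m n : Fin c → ℤ) :
    upow c u (m + n) = upow c u m * upow c u n := by
  unfold upow
  rw [← Finset.prod_mul_distrib]
  exact Finset.prod_congr rfl fun i _ => by rw [Pi.add_apply, zpow_add₀ (hu i)]

theorem upow_zero_aux (c : ℕ) (u : Fin c → ℂ) : upow c u 0 = 1 := by
  simp [upow]

theorem upow_nsmul_aux (c : ℕ) (u : Fin c → ℂ) (hu : ∀ i, u i ≠ 0) (n : Fin c → ℤ) (k : ℕ) :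
    upow c u (k • n) = upow c u n ^ k := by
  induction k with
  | zero => simp [upow_zero_aux]
  | succ k ih => rw [succ_nsmul, upow_add_aux c u hu, ih, pow_succ]

theorem g_nsmul_aux (c : ℕ) (g : (Fin c → ℤ) → ℝ) (hgpos : ∀ n, 0 < g n) (hg0 : g 0 = 1)
    (hsub : ∀ m n, g (m + n) ≤ g m * g n) (n : Fin c → ℤ) (k : ℕ) :
    g (k • n) ≤ g n ^ k := by
  induction k with
  | zero => simp [hg0]
  | succ k ih =>
    rw [succ_nsmul, pow_succ]
    exact (hsub _ _).trans (mul_le_mul_of_nonneg_right ih (hgpos n).le)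

/-- The formula `χ(a) = ∑_n u^n a_n` defines a character of `l_{1,g}(ℤ^c, ℂ)`
(the series converging absolutely for every `a ∈ l_{1,g}`, the functional being
bounded, multiplicative and unital) if and only if `|u^n| ≤ g(n)` for all `n`. -/
theorem character_criterion (c : ℕ) (g : (Fin c → ℤ) → ℝ)
    (hgpos : ∀ n, 0 < g n) (hg0 : g 0 = 1)
    (hsub : ∀ m n, g (m + n) ≤ g m * g n) (hsymm : ∀ n, g (-n) = g n)
    (hge : ∀ n, 1 ≤ g n)
    (u : Fin c → ℂ) (hu : ∀ i, u i ≠ 0) :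
    ((∀ a : (Fin c → ℤ) → ℂ, Summable (fun n => g n * ‖a n‖) →
        Summable fun n => ‖upow c u n * a n‖) ∧
      (∃ C : ℝ, ∀ a : (Fin c → ℤ) → ℂ, Summable (fun n => g n * ‖a n‖) →
        ‖∑' n, upow c u n * a n‖ ≤ C * ∑' n, g n * ‖a n‖) ∧
      (∀ a b : (Fin c → ℤ) → ℂ, Summable (fun n => g n * ‖a n‖) →
        Summable (fun n => g n * ‖b n‖) →
        (∑' n, upow c u n * convC c a b n) =
          (∑' n, upow c u n * a n) * (∑' n, upow c u n * b n)) ∧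
      (∑' n, upow c u n * deltaC c n) = 1)
    ↔ ∀ n, ‖upow c u n‖ ≤ g n := by
  constructor
  · rintro ⟨-, ⟨C, hC⟩, -, -⟩ n
    have h1 : ∀ m, ‖upow c u m‖ ≤ C * g m := by
      intro m
      have hz : ∀ k, k ≠ m → g k * ‖(Pi.single m (1:ℂ) : (Fin c → ℤ) → ℂ) k‖ = 0 := by
        intro k hk
        simp [Pi.single_eq_of_ne hk]
      have hz2 : ∀ k, k ≠ m → upow c u k * (Pi.single m (1:ℂ) : (Fin c → ℤ) → ℂ) k = 0 := by
        intro k hk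
        simp [Pi.single_eq_of_ne hk]
      have := hC (Pi.single m 1) (hasSum_single m hz).summable
      rw [tsum_eq_single m hz, tsum_eq_single m hz2] at this
      simpa using this
    have hC0 : 0 < C := by
      have := h1 0
      rw [upow_zero_aux, hg0] at this
      simp at this
      linarith
    by_contra! hlt
    have hr : 1 < ‖upow c u n‖ / g n := (one_lt_div (hgpos n)).2 hlt
    obtain ⟨k, hk⟩ := pow_unbounded_of_one_lt C hr
    have h2 := h1 (k • n)
    rw [upow_nsmul_aux c u hu, norm_pow] at h2
    have h3 := h2.trans (mul_le_mul_of_nonneg_left (g_nsmul_aux c g hgpos hg0 hsub n k) hC0.le)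
    rw [div_pow, lt_div_iff₀ (pow_pos (hgpos n) k)] at hk
    linarith
  · intro h
    have hle : ∀ (a : (Fin c → ℤ) → ℂ) n, ‖upow c u n * a n‖ ≤ g n * ‖a n‖ := by
      intro a n
      rw [norm_mul]
      exact mul_le_mul_of_nonneg_right (h n) (norm_nonneg _)
    have hs : ∀ a : (Fin c → ℤ) → ℂ, Summable (fun n => g n * ‖a n‖) →
        Summable fun n => ‖upow c u n * a n‖ := fun a ha =>
      Summable.of_nonneg_of_le (fun _ => norm_nonneg _) (hle a) ha
    refine ⟨hs, ⟨1, fun a ha => ?_⟩, fun a b ha hb => ?_, ?_⟩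
    · rw [one_mul]
      exact (norm_tsum_le_tsum_norm (hs a ha)).trans ((hs a ha).tsum_le_tsum (hle a) ha)
    · let e : (Fin c → ℤ) × (Fin c → ℤ) ≃ (Fin c → ℤ) × (Fin c → ℤ) :=
        { toFun := fun p => (p.2, p.1 - p.2)
          invFun := fun p => (p.1 + p.2, p.1)
          left_inv := fun p => by simp
          right_inv := fun p => by simp }
      have hp := summable_mul_of_summable_norm (hs a ha) (hs b hb)
      rw [tsum_mul_tsum_of_summable_norm (hs a ha) (hs b hb), ← e.tsum_eq]
      refine Eq.trans ?_ (e.summable_iff.2 hp).tsum_prod.symm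
      refine tsum_congr fun k => ?_
      unfold convC
      rw [← tsum_mul_left]
      refine tsum_congr fun m => ?_
      have : upow c u k = upow c u m * upow c u (k - m) := by
        rw [← upow_add_aux c u hu, add_sub_cancel]
      simp only [e, Function.comp_apply, Equiv.coe_fn_mk]
      rw [this]
      ring
    · rw [tsum_eq_single 0 (fun k hk => by simp [deltaC, hk])]
      simp [deltaC, upow_zero_aux]
end

section
/- Let g be a weight on ℤ^c satisfying assumptions (a)–(e). If a ∈ l_{1,g}(ℤ^c,ℂ) and b ∈ l_1(ℤ^c,ℂ) satisfy a∗b = b∗a = δ, then b ∈ l_{1,g}(ℤ^c,ℂ). In other words, the subalgebra l_{1,g}(ℤ^c,ℂ) is full (inverse-closed) in the convolution algebra l_1(ℤ^c,ℂ). -/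
open Filter
open scoped Topology

open Classical in
lemma tail_small {A : Type*} (f : A → ENNReal) (hf : ∑' k, f k ≠ ⊤) (e : ENNReal) (he : 0 < e) :
    ∃ F : Finset A, ∑' k, (if k ∈ F then 0 else f k) < e := by
  obtain ⟨F, hF⟩ := ((ENNReal.tendsto_tsum_compl_atTop_zero hf).eventually (gt_mem_nhds he)).exists
  refine ⟨F, ?_⟩
  convert hF using 1
  have := tsum_subtype {x | x ∉ F} f
  refine Eq.trans ?_ this.symm
  congr 1
  ext k
  by_cases h : k ∈ F <;> simp [h]

lemma growth (c : ℕ) (g : (Fin c → ℤ) → ℝ)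
    (hgpos : ∀ n, 0 < g n) (hg0 : g 0 = 1)
    (hsub : ∀ m n, g (m + n) ≤ g m * g n) (hsymm : ∀ n, g (-n) = g n)
    (hGRS : ∀ t : Fin c → ℤ,
      Tendsto (fun n : ℕ => (g ((n : ℤ) • t)) ^ ((n : ℝ)⁻¹)) atTop (𝓝 1)) (l : ℝ) (hl : 1 < l) :
    ∃ C : ℝ, 0 < C ∧ ∀ n, g n ≤ C * l ^ (∑ i, (n i).natAbs) := by
  have h1 : ∀ t : Fin c → ℤ, ∃ C : ℝ, 0 < C ∧ ∀ n : ℕ, g ((n : ℤ) • t) ≤ C * l ^ n := by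
    intro t
    have h := ((hGRS t).eventually (gt_mem_nhds hl)).and (eventually_gt_atTop 0)
    obtain ⟨K, hK⟩ := eventually_atTop.1 h
    have hpos : ∀ n ∈ Finset.range K, 0 ≤ g ((n : ℤ) • t) := fun n _ => (hgpos _).le
    refine ⟨1 + ∑ n ∈ Finset.range K, g ((n : ℤ) • t), ?_, ?_⟩
    · have := Finset.sum_nonneg hpos
      linarith
    · intro n
      have hs := Finset.sum_nonneg hpos
      have hln : 1 ≤ l ^ n := one_le_pow₀ hl.le
      by_cases hn : n < K
      · have := Finset.single_le_sum hpos (Finset.mem_range.2 hn)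
        nlinarith
      · obtain ⟨h2, h3⟩ := hK n (not_lt.1 hn)
        have h4 : g ((n : ℤ) • t) = ((g ((n : ℤ) • t)) ^ ((n : ℝ)⁻¹)) ^ n :=
          (Real.rpow_inv_natCast_pow (hgpos _).le h3.ne').symm
        have h5 : g ((n : ℤ) • t) ≤ l ^ n := by
          rw [h4]
          exact pow_le_pow_left₀ (Real.rpow_nonneg (hgpos _).le _) h2.le n
        nlinarith
  have h2 : ∀ t : Fin c → ℤ, ∃ C : ℝ, 0 < C ∧ ∀ n : ℤ, g (n • t) ≤ C * l ^ n.natAbs := by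
    intro t
    obtain ⟨C, hC, h⟩ := h1 t
    refine ⟨C, hC, fun n => ?_⟩
    rcases Int.natAbs_eq n with hn | hn
    · have := h n.natAbs
      rwa [← hn] at this
    · have := h n.natAbs
      rw [← hsymm, ← neg_smul, ← hn] at this
      exact this
  choose C hC h using fun i : Fin c => h2 (Pi.single i 1)
  have h3 : ∀ (s : Finset (Fin c)) (f : Fin c → Fin c → ℤ), g (∑ i ∈ s, f i) ≤ ∏ i ∈ s, g (f i) := by
    intro s f
    induction s using Finset.induction_on with
    | empty => simp [hg0]
    | insert i s hi ih =>
      rw [Finset.sum_insert hi, Finset.prod_insert hi]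
      exact (hsub _ _).trans (mul_le_mul_of_nonneg_left ih (hgpos _).le)
  refine ⟨∏ i, C i, Finset.prod_pos fun i _ => hC i, fun n => ?_⟩
  have h4 : n = ∑ i, n i • (Pi.single i 1 : Fin c → ℤ) := by
    ext j
    simp [Finset.sum_apply, Pi.single_apply]
  calc g n = g (∑ i, n i • (Pi.single i 1 : Fin c → ℤ)) := by rw [← h4]
    _ ≤ ∏ i, g (n i • (Pi.single i 1 : Fin c → ℤ)) := h3 _ _
    _ ≤ ∏ i, (C i * l ^ (n i).natAbs) := Finset.prod_le_prod (fun i _ => (hgpos _).le) fun i _ => h i _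
    _ = _ := by rw [Finset.prod_mul_distrib, Finset.prod_pow_eq_pow_sum]

/-- Absorption: with a slowly varying weight, a contraction identity bounds the weighted norm. -/
lemma absorb {A : Type*} [AddCommGroup A] (w v : A → ENNReal) (b p r : A → ENNReal)
    (hw : ∀ m k, w (m + k) ≤ w m * v k) (hv : ∀ k, 1 ≤ v k) (hwt : ∀ k, w k ≠ ⊤)
    (hb : ∑' k, b k ≠ ⊤) (hbr : ∀ k, b k ≤ p k + ∑' m, b m * r (k - m))
    (hr : ∑' k, v k * r k ≤ 3 / 4) (hp : ∑' k, w k * p k ≠ ⊤) : ∑' k, w k * b k ≠ ⊤ := by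
  have key : ∀ M : NNReal, ∑' k, min (w k) M * b k ≤ 4 * ∑' k, w k * p k := by
    intro M
    set X := ∑' k, min (w k) M * b k with hX
    have hXt : X ≠ ⊤ := by
      refine ne_top_of_le_ne_top (ENNReal.mul_ne_top (ENNReal.coe_ne_top (r := M)) hb) ?_
      rw [hX, ← ENNReal.tsum_mul_left]
      exact ENNReal.tsum_le_tsum fun k => by gcongr; exact min_le_right _ _
    have hwM : ∀ m k, min (w (m + k)) M ≤ min (w m) M * v k := by
      intro m k
      rcases le_total (w m) M with h | h
      · rw [min_eq_left h]; exact (min_le_left _ _).trans (hw m k)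
      · rw [min_eq_right h]
        exact (min_le_right _ _).trans (le_mul_of_one_le_right (zero_le) (hv k))
    have h1 : X ≤ (∑' k, w k * p k) + X * (3 / 4) := by
      calc X ≤ ∑' k, (w k * p k + ∑' m, (min (w m) M * b m) * (v (k - m) * r (k - m))) := by
            refine ENNReal.tsum_le_tsum fun k => ?_
            calc min (w k) M * b k ≤ min (w k) M * (p k + ∑' m, b m * r (k - m)) := by
                  gcongr; exact hbr k
              _ = min (w k) M * p k + ∑' m, min (w k) M * (b m * r (k - m)) := by
                  rw [mul_add, ENNReal.tsum_mul_left]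
              _ ≤ _ := by
                  refine add_le_add (by gcongr; exact min_le_left _ _)
                    (ENNReal.tsum_le_tsum fun m => ?_)
                  have := hwM m (k - m)
                  rw [add_sub_cancel] at this
                  calc _ ≤ (min (w m) M * v (k - m)) * (b m * r (k - m)) := by gcongr
                    _ = _ := by ring
        _ = (∑' k, w k * p k) + ∑' m, ∑' k, (min (w m) M * b m) * (v (k - m) * r (k - m)) := by
            rw [ENNReal.tsum_add, ENNReal.tsum_comm]
        _ = (∑' k, w k * p k) + ∑' m, (min (w m) M * b m) * ∑' k, v k * r k := by
            congr 2
            ext m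
            rw [ENNReal.tsum_mul_left]
            congr 1
            exact (Equiv.subRight m).tsum_eq (fun k => v k * r k)
        _ ≤ _ := by
            rw [ENNReal.tsum_mul_right]
            gcongr
    clear_value X
    clear hX
    generalize (∑' k, w k * p k) = B at h1 hp ⊢
    lift X to NNReal using hXt
    lift B to NNReal using hp
    have h34' : (3 / 4 : ENNReal) = ((3 / 4 : NNReal) : ENNReal) := by
      rw [ENNReal.coe_div (by norm_num)]; simp
    rw [h34'] at h1
    have h2 : X ≤ B + X * (3 / 4) := by exact_mod_cast h1
    have h3 : X ≤ 4 * B := by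
      have h2' : (X : ℝ) ≤ B + X * (3 / 4) := by exact_mod_cast h2
      have : (X : ℝ) ≤ 4 * B := by linarith
      exact_mod_cast this
    exact_mod_cast h3
  refine ne_top_of_le_ne_top (ENNReal.mul_ne_top (a := 4) (by simp) hp) ?_
  rw [ENNReal.tsum_eq_iSup_sum]
  refine iSup_le fun T => ?_
  set M : NNReal := ∑ k ∈ T, (w k).toNNReal with hM
  refine le_trans ?_ (key M)
  refine le_trans (Finset.sum_le_sum fun k hk => ?_) (ENNReal.sum_le_tsum T)
  have : w k ≤ M := by
    rw [← ENNReal.coe_toNNReal (hwt k)]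
    exact_mod_cast Finset.single_le_sum (f := fun k => (w k).toNNReal) (fun _ _ => zero_le) hk
  rw [min_eq_left this]

/-- Inverse-closedness of `l_{1,g}(ℤ^c, ℂ)` in `l_1(ℤ^c, ℂ)`: if `a ∈ l_{1,g}` has a
convolution inverse `b ∈ l_1`, then in fact `b ∈ l_{1,g}`. -/
theorem l1g_inverse_closed (c : ℕ) (g : (Fin c → ℤ) → ℝ)
    (hgpos : ∀ n, 0 < g n) (hg0 : g 0 = 1)
    (hsub : ∀ m n, g (m + n) ≤ g m * g n) (hsymm : ∀ n, g (-n) = g n)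
    (hge : ∀ n, 1 ≤ g n)
    (hGRS : ∀ t : Fin c → ℤ,
      Tendsto (fun n : ℕ => (g ((n : ℤ) • t)) ^ ((n : ℝ)⁻¹)) atTop (𝓝 1))
    (a b : (Fin c → ℤ) → ℂ)
    (ha : Summable fun n => g n * ‖a n‖) (hb : Summable fun n => ‖b n‖)
    (hab : ∀ k, HasSum (fun m => a m * b (k - m)) (deltaC c k))
    (hba : ∀ k, HasSum (fun m => b m * a (k - m)) (deltaC c k)) :
    Summable fun n => g n * ‖b n‖ := by
  classical
  have hG1 : ∀ k, (1 : ENNReal) ≤ ENNReal.ofReal (g k) := fun k => by simpa using hge k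
  have hbE : ∑' k, ‖b k‖ₑ ≠ ⊤ := by
    have := hb.tsum_ofReal_ne_top
    simpa [ofReal_norm] using this
  have haG : ∑' k, ENNReal.ofReal (g k) * ‖a k‖ₑ ≠ ⊤ := by
    have := ha.tsum_ofReal_ne_top
    simpa [ENNReal.ofReal_mul (hgpos _).le, ofReal_norm] using this
  have haE : ∑' k, ‖a k‖ₑ ≠ ⊤ :=
    ne_top_of_le_ne_top haG (ENNReal.tsum_le_tsum fun k => le_mul_of_one_le_left zero_le (hG1 k))
  -- truncation of `b`
  obtain ⟨S, hS⟩ := tail_small (fun k => ‖b k‖ₑ) hbE ((1 / 4) / (1 + ∑' k, ‖a k‖ₑ))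
    (ENNReal.div_pos (by simp) (ENNReal.add_ne_top.2 ⟨by simp, haE⟩))
  set r : (Fin c → ℤ) → ℂ := fun k => deltaC c k - ∑ j ∈ S, b j * a (k - j) with hr
  have hr1 : ∑' k, ‖r k‖ₑ ≤ 1 / 4 := by
    have h1 : ∀ k, ‖r k‖ₑ ≤ ∑' j, (if j ∈ S then 0 else ‖b j‖ₑ) * ‖a (k - j)‖ₑ := by
      intro k
      have h2 : HasSum (fun j => if j ∈ S then b j * a (k - j) else 0)
          (∑ j ∈ S, b j * a (k - j)) := by
        have := hasSum_sum_of_ne_finset_zero (f := fun j => if j ∈ S then b j * a (k - j) else 0)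
          (s := S) (L := SummationFilter.unconditional _) (fun j hj => by simp [hj])
        convert this using 1
        exact Finset.sum_congr rfl fun j hj => by simp [hj]
      have h3 := (hba k).sub h2
      have h4 : r k = ∑' j, (b j * a (k - j) - if j ∈ S then b j * a (k - j) else 0) :=
        h3.tsum_eq.symm
      rw [h4]
      refine enorm_tsum_le_tsum_enorm.trans (ENNReal.tsum_le_tsum fun j => ?_)
      by_cases hj : j ∈ S <;> simp [hj, enorm_mul]
    calc ∑' k, ‖r k‖ₑ ≤ ∑' k, ∑' j, (if j ∈ S then 0 else ‖b j‖ₑ) * ‖a (k - j)‖ₑ :=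
          ENNReal.tsum_le_tsum h1
      _ = ∑' j, (if j ∈ S then 0 else ‖b j‖ₑ) * ∑' k, ‖a k‖ₑ := by
          rw [ENNReal.tsum_comm]
          congr 1
          ext j
          rw [ENNReal.tsum_mul_left]
          congr 1
          exact (Equiv.subRight j).tsum_eq (fun k => ‖a k‖ₑ)
      _ = (∑' j, (if j ∈ S then 0 else ‖b j‖ₑ)) * ∑' k, ‖a k‖ₑ := ENNReal.tsum_mul_right
      _ ≤ ((1 / 4) / (1 + ∑' k, ‖a k‖ₑ)) * (1 + ∑' k, ‖a k‖ₑ) := by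
          refine mul_le_mul' (le_of_eq_of_le ?_ hS.le) le_add_self
          congr!
      _ ≤ 1 / 4 := ENNReal.mul_le_of_le_div le_rfl
  have hrG : ∑' k, ENNReal.ofReal (g k) * ‖r k‖ₑ ≠ ⊤ := by
    have h1 : ∀ k, ENNReal.ofReal (g k) * ‖r k‖ₑ ≤ ENNReal.ofReal (g k) * ‖deltaC c k‖ₑ
        + ∑ j ∈ S, ENNReal.ofReal (g j) * ‖b j‖ₑ *
          (ENNReal.ofReal (g (k - j)) * ‖a (k - j)‖ₑ) := by
      intro k
      have h2 : ‖r k‖ₑ ≤ ‖deltaC c k‖ₑ + ∑ j ∈ S, ‖b j‖ₑ * ‖a (k - j)‖ₑ := by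
        refine enorm_sub_le.trans ?_
        gcongr
        refine (enorm_sum_le _ _).trans (le_of_eq ?_)
        simp [enorm_mul]
      refine (mul_le_mul_right h2 _).trans ?_
      rw [mul_add, Finset.mul_sum]
      refine add_le_add le_rfl (Finset.sum_le_sum fun j hj => ?_)
      have h3 : ENNReal.ofReal (g k) ≤ ENNReal.ofReal (g j) * ENNReal.ofReal (g (k - j)) := by
        rw [← ENNReal.ofReal_mul (hgpos _).le]
        apply ENNReal.ofReal_le_ofReal
        simpa using hsub j (k - j)
      calc _ ≤ (ENNReal.ofReal (g j) * ENNReal.ofReal (g (k - j))) * (‖b j‖ₑ * ‖a (k - j)‖ₑ) := by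
            gcongr
        _ = _ := by ring
    refine ne_top_of_le_ne_top ?_ (ENNReal.tsum_le_tsum h1)
    rw [ENNReal.tsum_add, Summable.tsum_finsetSum (fun _ _ => ENNReal.summable)]
    refine ENNReal.add_ne_top.2 ⟨?_, ?_⟩
    · rw [tsum_eq_single 0 (fun k hk => by simp [deltaC, hk])]
      simp [deltaC]
    · refine (ENNReal.sum_ne_top).2 fun j _ => ?_
      rw [ENNReal.tsum_mul_left]
      refine ENNReal.mul_ne_top (ENNReal.mul_ne_top (by simp) (by simp)) ?_
      have := (Equiv.subRight j).tsum_eq (fun k => ENNReal.ofReal (g k) * ‖a k‖ₑ)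
      simp only [Equiv.subRight_apply] at this
      rwa [this]
  have hbr : ∀ k, b k = (if k ∈ S then b k else 0) + ∑' m, b m * r (k - m) := by
    intro k
    have h1 : HasSum (fun m => b m * deltaC c (k - m)) (b k) := by
      have := hasSum_single (f := fun m => b m * deltaC c (k - m)) k (fun m hm => by
        simp [deltaC, sub_eq_zero, hm.symm])
      simpa [deltaC] using this
    have h2 : ∀ j ∈ S, HasSum (fun m => b j * (b m * a (k - j - m))) (b j * deltaC c (k - j)) :=
      fun j _ => (hba (k - j)).mul_left (b j)
    have h3 := h1.sub (hasSum_sum h2)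
    have h4 : ∑ j ∈ S, b j * deltaC c (k - j) = if k ∈ S then b k else 0 := by
      simp [deltaC, sub_eq_zero]
    have h5 : ∑' m, b m * r (k - m) = b k - if k ∈ S then b k else 0 := by
      rw [← h4, ← h3.tsum_eq]
      congr 1
      ext m
      simp only [hr, mul_sub, Finset.mul_sum]
      congr 1
      refine Finset.sum_congr rfl fun j _ => ?_
      rw [sub_right_comm]
      ring
    rw [h5]
    ring
  -- choose the finite set and the slow exponential
  obtain ⟨F, hF⟩ := tail_small _ hrG (1 / 4) (by simp)
  obtain ⟨l, hl1, hlF⟩ : ∃ l : ℝ, 1 < l ∧ ∀ k ∈ F, l ^ (∑ i, (k i).natAbs) ≤ 2 := by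
    set D : ℕ := ∑ k ∈ F, ∑ i, (k i).natAbs with hD
    refine ⟨2 ^ (((D + 1 : ℕ) : ℝ)⁻¹), Real.one_lt_rpow (by norm_num) (by positivity), ?_⟩
    intro k hk
    have h1 : ∑ i, (k i).natAbs ≤ D + 1 :=
      (Finset.single_le_sum (f := fun k : Fin c → ℤ => ∑ i, (k i).natAbs)
        (fun _ _ => Nat.zero_le _) hk).trans (Nat.le_succ _)
    have h2 : (1 : ℝ) ≤ 2 ^ (((D + 1 : ℕ) : ℝ)⁻¹) :=
      Real.one_le_rpow (by norm_num) (by positivity)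
    exact (pow_le_pow_right₀ h2 h1).trans
      (Real.rpow_inv_natCast_pow (by norm_num) (by simp)).le
  obtain ⟨C, hC, hgC⟩ := growth c g hgpos hg0 hsub hsymm hGRS l hl1
  set N : (Fin c → ℤ) → ℝ := fun k => l ^ (∑ i, (k i).natAbs) with hN
  have hl0 : 0 < l := by linarith
  have hNpos : ∀ k, 0 < N k := fun k => pow_pos hl0 _
  have hN1 : ∀ k, 1 ≤ N k := fun k => one_le_pow₀ hl1.le
  have hNsub : ∀ j k, N (j + k) ≤ N j * N k := by
    intro j k
    simp only [hN]
    rw [← pow_add, ← Finset.sum_add_distrib]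
    exact pow_le_pow_right₀ hl1.le (Finset.sum_le_sum fun i _ => Int.natAbs_add_le _ _)
  set w : (Fin c → ℤ) → ENNReal := fun m => ⨆ j, ENNReal.ofReal (g (m + j) / N j) with hw
  set v : (Fin c → ℤ) → ENNReal := fun k => ENNReal.ofReal (min (N k) (g k)) with hv
  have hgw : ∀ k, ENNReal.ofReal (g k) ≤ w k := by
    intro k
    refine le_trans ?_ (le_iSup _ (0 : Fin c → ℤ))
    simp [hN]
  have hwt : ∀ k, w k ≠ ⊤ := by
    intro k
    refine ne_top_of_le_ne_top (ENNReal.ofReal_ne_top (r := g k * C)) (iSup_le fun j => ?_)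
    apply ENNReal.ofReal_le_ofReal
    rw [div_le_iff₀ (hNpos j), mul_assoc]
    exact (hsub k j).trans (mul_le_mul_of_nonneg_left (hgC j) (hgpos k).le)
  have hwv : ∀ m k, w (m + k) ≤ w m * v k := by
    intro m k
    refine iSup_le fun j => ?_
    rcases le_total (N k) (g k) with h | h
    · simp only [hv, min_eq_left h]
      refine le_trans ?_ (mul_le_mul_left (le_iSup _ (k + j)) _)
      rw [← ENNReal.ofReal_mul (div_pos (hgpos _) (hNpos _)).le]
      apply ENNReal.ofReal_le_ofReal
      rw [add_assoc, div_mul_eq_mul_div, div_le_div_iff₀ (hNpos _) (hNpos _), mul_assoc]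
      exact mul_le_mul_of_nonneg_left (hNsub k j) (hgpos _).le
    · simp only [hv, min_eq_right h]
      refine le_trans ?_ (mul_le_mul_left (le_iSup _ j) _)
      rw [← ENNReal.ofReal_mul (div_pos (hgpos _) (hNpos _)).le]
      apply ENNReal.ofReal_le_ofReal
      rw [div_mul_eq_mul_div]
      refine div_le_div_of_nonneg_right ?_ (hNpos j).le
      have := hsub (m + j) k
      rwa [add_right_comm] at this
  have hv1 : ∀ k, 1 ≤ v k := fun k => by
    simpa [hv] using ⟨hN1 k, hge k⟩
  have hvr : ∑' k, v k * ‖r k‖ₑ ≤ 3 / 4 := by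
    calc ∑' k, v k * ‖r k‖ₑ
        ≤ ∑' k, (2 * ‖r k‖ₑ + if k ∈ F then 0 else ENNReal.ofReal (g k) * ‖r k‖ₑ) := by
          refine ENNReal.tsum_le_tsum fun k => ?_
          by_cases hk : k ∈ F
          · simp only [hk, if_true, add_zero]
            gcongr
            refine (ENNReal.ofReal_le_ofReal ((min_le_left _ _).trans (hlF k hk))).trans ?_
            simp
          · simp only [hk, if_false]
            refine le_trans ?_ le_add_self
            gcongr
            exact ENNReal.ofReal_le_ofReal (min_le_right _ _)
      _ = 2 * ∑' k, ‖r k‖ₑ + ∑' k, (if k ∈ F then 0 else ENNReal.ofReal (g k) * ‖r k‖ₑ) := by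
          rw [ENNReal.tsum_add, ENNReal.tsum_mul_left]
      _ ≤ 2 * (1 / 4) + 1 / 4 := by
          refine add_le_add (by gcongr) (le_of_eq_of_le ?_ hF.le)
          congr!
      _ = 3 / 4 := by
          simp only [ENNReal.div_eq_inv_mul]
          ring
  have hfin := absorb w v (fun k => ‖b k‖ₑ) (fun k => ‖if k ∈ S then b k else 0‖ₑ)
    (fun k => ‖r k‖ₑ) hwv hv1 hwt hbE (fun k => by
      conv_lhs => rw [hbr k]
      refine (enorm_add_le _ _).trans ?_
      gcongr
      refine enorm_tsum_le_tsum_enorm.trans (le_of_eq ?_)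
      simp [enorm_mul]) hvr (by
      rw [tsum_eq_sum (s := S) (fun k hk => by simp [hk])]
      exact (ENNReal.sum_ne_top).2 fun k _ => ENNReal.mul_ne_top (hwt k) (by simp))
  have hfin2 : ∑' k, ENNReal.ofReal (g k) * ‖b k‖ₑ ≠ ⊤ :=
    ne_top_of_le_ne_top hfin (ENNReal.tsum_le_tsum fun k => by gcongr; exact hgw k)
  have := ENNReal.summable_toReal hfin2
  simpa [ENNReal.toReal_mul, ENNReal.toReal_ofReal (hgpos _).le] using this
end

section
/- Let g be a weight on ℤ^c satisfying assumptions (a)–(e) and let B be a unital complex Banach algebra. An element a ∈ l_{1,g}(ℤ^c,B) is invertible in the convolution algebra l_{1,g}(ℤ^c,B) (i.e. there exists b ∈ l_{1,g}(ℤ^c,B) with a∗b = b∗a = δ) if and only if for every u = (u_1,…,u_c) ∈ ℂ^c with |u_1| = … = |u_c| = 1, the element Σ_{k∈ℤ^c} u^k a_k (an absolutely convergent series in B) is invertible in B. -/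
open Filter
open scoped Topology

/-- The unit family `δ` of `l_{1,g}(ℤ^c, B)`. -/
noncomputable def deltaB (c : ℕ) (B : Type*) [NormedRing B] : (Fin c → ℤ) → B :=
  fun k => if k = 0 then 1 else 0

theorem key_scalar {R : Type*} [NormedRing R] [NormedAlgebra ℂ R] [CompleteSpace R]
    (L : Ideal R) [hL : L.IsMaximal] (z : R) (hz : ∀ x, z * x = x * z) :
    ∃ l : ℂ, z - algebraMap ℂ R l ∈ L := by
  have : IsSimpleModule R (R ⧸ L) := isSimpleModule_iff_isCoatom.mpr hL.out
  have : Nontrivial (R ⧸ L) := IsSimpleModule.nontrivial R _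
  let f0 : R →ₗ[R] R :=
    { toFun := fun x => z * x
      map_add' := fun x y => mul_add _ _ _
      map_smul' := fun r x => by
        simp only [smul_eq_mul, RingHom.id_apply]
        rw [← mul_assoc, hz r, mul_assoc] }
  have hf0 : L ≤ Submodule.comap f0 L := fun x hx => L.mul_mem_left z hx
  let f : (R ⧸ L) →ₗ[R] (R ⧸ L) := L.mapQ L f0 hf0
  have hfmk : ∀ x : R, f (Submodule.Quotient.mk x) = Submodule.Quotient.mk (z * x) :=
    fun x => rfl
  have hb : ∀ x : R ⧸ L, ‖f.restrictScalars ℂ x‖ ≤ ‖z‖ * ‖x‖ := by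
    intro x
    refine le_of_forall_pos_le_add fun ε hε => ?_
    have hz1 : 0 < ‖z‖ + 1 := by positivity
    obtain ⟨m, rfl, hm⟩ := Submodule.Quotient.norm_mk_lt x (div_pos hε hz1)
    calc ‖f (Submodule.Quotient.mk m)‖ = ‖(Submodule.Quotient.mk (z * m) : R ⧸ L)‖ := rfl
      _ ≤ ‖z * m‖ := Submodule.Quotient.norm_mk_le _ _
      _ ≤ ‖z‖ * ‖m‖ := norm_mul_le _ _
      _ ≤ ‖z‖ * (‖(Submodule.Quotient.mk m : R ⧸ L)‖ + ε / (‖z‖ + 1)) := by gcongr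
      _ = ‖z‖ * ‖(Submodule.Quotient.mk m : R ⧸ L)‖ + ε * (‖z‖ / (‖z‖ + 1)) := by ring
      _ ≤ ‖z‖ * ‖(Submodule.Quotient.mk m : R ⧸ L)‖ + ε * 1 := by
          gcongr
          rw [div_le_one hz1]; linarith
      _ = _ := by ring
  let T : (R ⧸ L) →L[ℂ] (R ⧸ L) := (f.restrictScalars ℂ).mkContinuous ‖z‖ hb
  obtain ⟨l, hl⟩ := spectrum.nonempty T
  refine ⟨l, ?_⟩
  let s : (R ⧸ L) →ₗ[R] (R ⧸ L) := L.mapQ L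
    { toFun := fun x => algebraMap ℂ R l * x
      map_add' := fun x y => mul_add _ _ _
      map_smul' := fun r x => by
        simp only [smul_eq_mul, RingHom.id_apply]
        rw [← mul_assoc, Algebra.commutes, mul_assoc] } (fun x hx => L.mul_mem_left _ hx)
  have hs : ∀ x, s x = l • x := by
    intro x
    obtain ⟨m, rfl⟩ := Submodule.Quotient.mk_surjective _ x
    change Submodule.Quotient.mk (algebraMap ℂ R l * m) = _
    rw [← Algebra.smul_def]; rfl
  have hU : ∀ x, (algebraMap ℂ ((R ⧸ L) →L[ℂ] (R ⧸ L)) l - T) x = (s - f) x := by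
    intro x
    rw [LinearMap.sub_apply, hs]
    rfl
  rcases LinearMap.bijective_or_eq_zero (s - f) with h | h
  · exfalso
    apply hl
    rw [spectrum.mem_resolventSet_iff]
    set U := algebraMap ℂ ((R ⧸ L) →L[ℂ] (R ⧸ L)) l - T with hUdef
    have hfun : (U : (R ⧸ L) → (R ⧸ L)) = (s - f) := funext hU
    have hbij : Function.Bijective U := by rw [hfun]; exact h
    exact ContinuousLinearMap.isUnit_iff_bijective.mpr hbij
  · have := LinearMap.congr_fun h (Submodule.Quotient.mk 1)
    rw [LinearMap.sub_apply, hs, hfmk, mul_one, LinearMap.zero_apply] at this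
    have h2 : (Submodule.Quotient.mk (z - algebraMap ℂ R l) : R ⧸ L) = 0 := by
      rw [Submodule.Quotient.mk_sub, ← neg_sub, neg_eq_zero, ← this,
        Algebra.algebraMap_eq_smul_one]
      rfl
    exact (Submodule.Quotient.mk_eq_zero _).mp h2

theorem left_inv_abstract (c : ℕ) (g : (Fin c → ℤ) → ℝ)
    (hGRS : ∀ t : Fin c → ℤ,
      Tendsto (fun n : ℕ => (g ((n : ℤ) • t)) ^ ((n : ℝ)⁻¹)) atTop (𝓝 1))
    {B : Type*} [NormedRing B] [NormedAlgebra ℂ B]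
    {R : Type*} [NormedRing R] [NormedAlgebra ℂ R] [CompleteSpace R]
    (h1 : ‖(1 : R)‖ ≤ 1) (z : (Fin c → ℤ) → R) (hz : ∀ m x, z m * x = x * z m)
    (hz0 : z 0 = 1) (hzadd : ∀ m n, z (m + n) = z m * z n) (hzn : ∀ m, ‖z m‖ ≤ g m)
    (β : B →ₐ[ℂ] R) (hβ : Continuous β)
    (a : (Fin c → ℤ) → B)
    (hsa : ∀ u : Fin c → ℂ, (∀ i, ‖u i‖ = 1) → Summable fun k => upow c u k • a k)
    (hs : Summable fun m => β (a m) * z m)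
    (hinv : ∀ u : Fin c → ℂ, (∀ i, ‖u i‖ = 1) → IsUnit (∑' k, upow c u k • a k)) :
    ∃ t : R, t * (∑' m, β (a m) * z m) = 1 := by
  by_contra hcon
  push Not at hcon
  set A := ∑' m, β (a m) * z m with hA
  have hne : Ideal.span {A} ≠ ⊤ := by
    intro h
    have : (1 : R) ∈ Ideal.span {A} := h ▸ Submodule.mem_top
    obtain ⟨t, ht⟩ := Ideal.mem_span_singleton'.mp this
    exact hcon t ht
  obtain ⟨L, hL, hLA⟩ := Ideal.exists_le_maximal _ hne
  have hAL : A ∈ L := hLA (Ideal.mem_span_singleton_self A)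
  have h1L : (1 : R) ∉ L := fun h => hL.ne_top ((Ideal.eq_top_iff_one L).mpr h)
  have hLunit : ∀ x ∈ L, ¬ IsUnit x := fun x hx hu => by
    obtain ⟨y, hy⟩ := hu.exists_left_inv
    exact h1L (hy ▸ L.mul_mem_left y hx)
  choose l hl using fun m => key_scalar L (z m) (hz m)
  have hsc : ∀ w : ℂ, algebraMap ℂ R w ∈ L → w = 0 := by
    intro w hw
    by_contra h0
    exact hLunit _ hw ((isUnit_iff_ne_zero.mpr h0).map (algebraMap ℂ R))
  have huniq : ∀ (x : R) (v w : ℂ), x - algebraMap ℂ R v ∈ L → x - algebraMap ℂ R w ∈ L →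
      v = w := by
    intro x v w hv hw
    have := L.sub_mem hw hv
    rw [sub_sub_sub_cancel_left, ← map_sub] at this
    exact sub_eq_zero.mp (hsc _ this)
  have hl0 : l 0 = 1 := huniq _ _ _ (hl 0) (by simp [hz0])
  have hladd : ∀ m n, l (m + n) = l m * l n := by
    intro m n
    refine huniq _ _ _ (hl _) ?_
    have : z (m + n) - algebraMap ℂ R (l m * l n) =
        z m * (z n - algebraMap ℂ R (l n)) + algebraMap ℂ R (l n) * (z m - algebraMap ℂ R (l m)) := by
      rw [hzadd, map_mul, mul_sub, mul_sub, ← Algebra.commutes (l n) (z m),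
        ← Algebra.commutes (l n) (algebraMap ℂ R (l m))]
      abel
    rw [this]
    exact L.add_mem (L.mul_mem_left _ (hl n)) (L.mul_mem_left _ (hl m))
  have hlg : ∀ m, ‖l m‖ ≤ g m := by
    intro m
    by_contra h
    push Not at h
    have h2 : ‖z m‖ * ‖(1 : R)‖ < ‖l m‖ := by
      refine lt_of_le_of_lt ?_ h
      calc ‖z m‖ * ‖(1 : R)‖ ≤ ‖z m‖ * 1 := by gcongr
        _ ≤ g m := by rw [mul_one]; exact hzn m
    have h3 := spectrum.mem_resolventSet_of_norm_lt_mul h2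
    rw [spectrum.mem_resolventSet_iff] at h3
    refine hLunit _ ?_ h3
    rw [← neg_sub]
    exact L.neg_mem (hl m)
  let lam : Multiplicative (Fin c → ℤ) →* ℂ :=
    { toFun := fun m => l m.toAdd
      map_one' := hl0
      map_mul' := fun m n => hladd _ _ }
  have hlpow : ∀ (n : ℕ) t, l ((n : ℤ) • t) = l t ^ n := by
    intro n t
    have := map_pow lam (Multiplicative.ofAdd t) n
    rw [← ofAdd_nsmul] at this
    simpa [lam] using this
  have hle1 : ∀ t, ‖l t‖ ≤ 1 := by
    intro t
    refine ge_of_tendsto (hGRS t) ?_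
    filter_upwards [eventually_gt_atTop 0] with n hn
    have h := hlg ((n : ℤ) • t)
    rw [hlpow, norm_pow] at h
    calc ‖l t‖ = (‖l t‖ ^ n) ^ ((n : ℝ)⁻¹) := (Real.pow_rpow_inv_natCast (norm_nonneg _) hn.ne').symm
      _ ≤ _ := Real.rpow_le_rpow (by positivity) h (by positivity)
  have hnorm : ∀ t, ‖l t‖ = 1 := by
    intro t
    have h := hladd t (-t)
    rw [add_neg_cancel, hl0] at h
    have h' := congrArg norm h
    rw [norm_one, norm_mul] at h'
    have := hle1 t
    have := hle1 (-t)
    nlinarith [norm_nonneg (l t), norm_nonneg (l (-t))]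
  have hne0 : ∀ t, l t ≠ 0 := fun t h => by have := hnorm t; simp [h] at this
  have hlneg : ∀ t, l (-t) = (l t)⁻¹ := by
    intro t
    have h := hladd t (-t)
    rw [add_neg_cancel, hl0] at h
    exact eq_inv_of_mul_eq_one_right h.symm
  have hlz : ∀ (n : ℤ) t, l (n • t) = l t ^ n := by
    intro n t
    rcases Int.eq_nat_or_neg n with ⟨k, rfl | rfl⟩
    · rw [hlpow, zpow_natCast]
    · rw [neg_smul, hlneg, hlpow, zpow_neg, zpow_natCast]
  let u : Fin c → ℂ := fun i => l (Pi.single i 1)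
  have hu : ∀ i, ‖u i‖ = 1 := fun i => hnorm _
  have hup : ∀ m, l m = upow c u m := by
    intro m
    have hm : m = ∑ i, (m i) • (Pi.single i (1 : ℤ) : Fin c → ℤ) := by
      ext j
      simp [Finset.sum_apply, Pi.single_apply]
    have hsum : ∀ (s : Finset (Fin c)) (f : Fin c → (Fin c → ℤ)),
        l (∑ i ∈ s, f i) = ∏ i ∈ s, l (f i) := by
      intro s f
      induction s using Finset.induction_on with
      | empty => simpa using hl0
      | insert i s hi ih => rw [Finset.sum_insert hi, Finset.prod_insert hi, hladd, ih]
    conv_lhs => rw [hm]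
    rw [hsum]
    unfold upow
    exact Finset.prod_congr rfl fun i _ => hlz _ _
  have hsu := hsa u hu
  have hsβ : HasSum (fun k => β (upow c u k • a k)) (β (∑' k, upow c u k • a k)) :=
    hsu.hasSum.map β hβ
  have hdiff := hs.hasSum.sub hsβ
  have hmem : A - β (∑' k, upow c u k • a k) ∈ L := by
    have := hL
    have hcl : IsClosed (L : Set R) := Ideal.IsMaximal.isClosed
    refine hcl.mem_of_tendsto hdiff (Eventually.of_forall fun s => ?_)
    refine L.sum_mem fun k _ => ?_
    have : β (a k) * z k - β (upow c u k • a k) = β (a k) * (z k - algebraMap ℂ R (l k)) := by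
      rw [map_smul, mul_sub, hup, Algebra.smul_def, Algebra.commutes]
    rw [this]
    exact L.mul_mem_left _ (hl k)
  have hmem2 : β (∑' k, upow c u k • a k) ∈ L := by
    have := L.sub_mem hAL hmem
    rwa [sub_sub_cancel] at this
  exact hLunit _ hmem2 ((hinv u hu).map β)

theorem hasSum_single_eq {ι M : Type*} [AddCommMonoid M] [TopologicalSpace M] {f : ι → M} {s : M}
    (k : ι) (h : f k = s) (h0 : ∀ m, m ≠ k → f m = 0) : HasSum f s :=
  h ▸ hasSum_single k h0

theorem centralizer_closed {E : Type*} [NormedRing E] [NormedAlgebra ℂ E] (S : Set E) :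
    IsClosed (Subalgebra.centralizer ℂ S : Set E) :=
  Set.isClosed_centralizer S

theorem summable_generic {ι E : Type*} [NormedRing E] [CompleteSpace E] {f z : ι → E}
    {p q : ι → ℝ} (hf : ∀ m, ‖f m‖ ≤ p m) (hz : ∀ m, ‖z m‖ ≤ q m)
    (h : Summable fun m => q m * p m) : Summable fun m => f m * z m :=
  Summable.of_norm_bounded h fun m => by
    calc _ ≤ ‖f m‖ * ‖z m‖ := norm_mul_le _ _
      _ ≤ p m * q m := mul_le_mul (hf m) (hz m) (norm_nonneg _) ((norm_nonneg _).trans (hf m))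
      _ = _ := mul_comm _ _

theorem hasSum_coe_generic {ι E : Type*} [NormedRing E] [NormedAlgebra ℂ E] (S : Subalgebra ℂ E)
    (f : ι → S) (s : S) (h : HasSum f s) : HasSum (fun i => (f i : E)) (s : E) :=
  h.mapL S.toSubmodule.subtypeL

section ops
variable {c : ℕ} {B : Type*} [NormedRing B] [NormedAlgebra ℂ B]

/-- The underlying Banach space. -/
def XX (c : ℕ) (B : Type*) [NormedRing B] : Type _ :=
  lp (fun _ : Fin c → ℤ => B) 1

noncomputable instance : NormedAddCommGroup (XX c B) :=
  inferInstanceAs (NormedAddCommGroup (lp (fun _ : Fin c → ℤ => B) 1))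

noncomputable instance : NormedSpace ℂ (XX c B) :=
  inferInstanceAs (NormedSpace ℂ (lp (fun _ : Fin c → ℤ => B) 1))

instance [CompleteSpace B] : CompleteSpace (XX c B) :=
  inferInstanceAs (CompleteSpace (lp (fun _ : Fin c → ℤ => B) 1))

/-- Evaluation. -/
noncomputable def ev (k : Fin c → ℤ) : XX c B →L[ℂ] B :=
  lp.evalCLM ℂ (fun _ : Fin c → ℤ => B) 1 k

theorem summable_of_XX (x : XX c B) : Summable fun k => ‖ev k x‖ := by
  have := lp.memℓp (E := fun _ : Fin c → ℤ => B) (p := 1) x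
  rw [memℓp_gen_iff (by simp)] at this
  simp only [ENNReal.toReal_one, Real.rpow_one] at this
  exact this

theorem mem_XX {f : (Fin c → ℤ) → B} (h : Summable fun k => ‖f k‖) :
    Memℓp f 1 := by
  rw [memℓp_gen_iff (by simp)]
  simpa using h

/-- Constructor. -/
def mkX (f : (Fin c → ℤ) → B) (h : Summable fun k => ‖f k‖) : XX c B :=
  (⟨f, mem_XX h⟩ : lp (fun _ : Fin c → ℤ => B) 1)

@[simp] theorem ev_mkX (f : (Fin c → ℤ) → B) (h : Summable fun k => ‖f k‖) (k) :
    ev k (mkX f h) = f k := rfl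

@[ext] theorem XX_ext {x y : XX c B} (h : ∀ k, ev k x = ev k y) : x = y :=
  lp.ext (E := fun _ : Fin c → ℤ => B) (p := 1) (funext h)

theorem norm_XX (x : XX c B) : ‖x‖ = ∑' k, ‖ev k x‖ := by
  have := lp.norm_eq_tsum_rpow (E := fun _ : Fin c → ℤ => B) (p := 1) (by simp) x
  simp only [ENNReal.toReal_one, Real.rpow_one, div_one] at this
  exact this

/-- Point masses. -/
def sg (k : Fin c → ℤ) (b : B) : XX c B := lp.single (E := fun _ : Fin c → ℤ => B) 1 k b

theorem ev_sg_self (k : Fin c → ℤ) (b : B) : ev k (sg k b) = b :=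
  lp.single_apply_self (E := fun _ : Fin c → ℤ => B) 1 k b

theorem ev_sg_ne (k j : Fin c → ℤ) (h : j ≠ k) (b : B) : ev j (sg k b) = 0 :=
  lp.single_apply_ne (E := fun _ : Fin c → ℤ => B) 1 k b h

theorem hasSum_sg (x : XX c B) : HasSum (fun k => sg k (ev k x)) x :=
  lp.hasSum_single (E := fun _ : Fin c → ℤ => B) (p := 1) (by simp) x

theorem opMk_bound (m : Fin c → ℤ) (φ : (Fin c → ℤ) → B →L[ℂ] B) (C : ℝ)
    (h : ∀ k, ‖φ k‖ ≤ C) (x : XX c B) (k : Fin c → ℤ) :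
    ‖φ k (ev (k - m) x)‖ ≤ C * ‖ev (k - m) x‖ :=
  (φ k).le_of_opNorm_le (h k) _

theorem summable_shift (m : Fin c → ℤ) (x : XX c B) (C : ℝ) :
    Summable fun k => C * ‖ev (k - m) x‖ :=
  (((Equiv.subRight m).summable_iff (f := fun k => ‖ev k x‖)).mpr (summable_of_XX x)).mul_left C

/-- Shift by `m` followed by a fibrewise operator. -/
noncomputable def opMk (m : Fin c → ℤ) (φ : (Fin c → ℤ) → B →L[ℂ] B) (C : ℝ)
    (h : ∀ k, ‖φ k‖ ≤ C) : XX c B →L[ℂ] XX c B :=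
  LinearMap.mkContinuous
    { toFun := fun x => mkX (fun k => φ k (ev (k - m) x)) ((summable_shift m x C).of_nonneg_of_le (fun _ => norm_nonneg _)
          (opMk_bound m φ C h x))
      map_add' := fun x y => by ext k; simp
      map_smul' := fun r x => by ext k; simp } C (fun x => by
        rw [norm_XX, norm_XX, ← (Equiv.subRight m).tsum_eq (fun k => ‖ev k x‖), ← tsum_mul_left]
        refine Summable.tsum_le_tsum (opMk_bound m φ C h x) ?_ (summable_shift m x C)
        exact (summable_shift m x C).of_nonneg_of_le (fun _ => norm_nonneg _)
          (opMk_bound m φ C h x))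

@[simp] theorem opMk_apply (m : Fin c → ℤ) (φ : (Fin c → ℤ) → B →L[ℂ] B) (C : ℝ)
    (h : ∀ k, ‖φ k‖ ≤ C) (x : XX c B) (k) : ev k (opMk m φ C h x) = φ k (ev (k - m) x) := rfl

theorem opMk_norm (m : Fin c → ℤ) (φ : (Fin c → ℤ) → B →L[ℂ] B) (C : ℝ)
    (h : ∀ k, ‖φ k‖ ≤ C) : ‖opMk m φ C h‖ ≤ C :=
  LinearMap.mkContinuous_norm_le _ ((norm_nonneg _).trans (h 0)) _

/-- Left multiplication. -/
noncomputable def opL (c : ℕ) (b : B) : XX c B →L[ℂ] XX c B :=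
  opMk 0 (fun _ => ContinuousLinearMap.mul ℂ B b) ‖b‖
    (fun _ => ContinuousLinearMap.opNorm_mul_apply_le ℂ B b)

/-- Right multiplication. -/
noncomputable def opR (c : ℕ) (b : B) : XX c B →L[ℂ] XX c B :=
  opMk 0 (fun _ => (ContinuousLinearMap.mul ℂ B).flip b) ‖(ContinuousLinearMap.mul ℂ B).flip b‖
    (fun _ => le_rfl)

/-- Weighted shift. -/
noncomputable def opW (B : Type*) [NormedRing B] [NormedAlgebra ℂ B] (g : (Fin c → ℤ) → ℝ)
    (hgpos : ∀ n, 0 < g n) (hsub : ∀ m n, g (m + n) ≤ g m * g n) (m : Fin c → ℤ) :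
    XX c B →L[ℂ] XX c B :=
  opMk m (fun k => ((g k / g (k - m) : ℝ) : ℂ) • ContinuousLinearMap.id ℂ B) (g m) (fun k => by
    have h1 : g k ≤ g m * g (k - m) := by
      have := hsub m (k - m); rwa [add_sub_cancel] at this
    have h2 : g k / g (k - m) ≤ g m := (div_le_iff₀ (hgpos _)).mpr h1
    have h0 : 0 ≤ g k / g (k - m) := (div_pos (hgpos _) (hgpos _)).le
    refine ContinuousLinearMap.opNorm_le_bound _ (hgpos m).le fun x => ?_
    simp only [smul_apply, ContinuousLinearMap.id_apply]
    rw [norm_smul, Complex.norm_real, Real.norm_of_nonneg h0]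
    gcongr)

@[simp] theorem opL_apply (b : B) (x : XX c B) (k) : ev k (opL c b x) = b * ev k x := by
  simp [opL]

@[simp] theorem opR_apply (b : B) (x : XX c B) (k) : ev k (opR c b x) = ev k x * b := by
  simp [opR]

variable (g : (Fin c → ℤ) → ℝ)
    (hgpos : ∀ n, 0 < g n) (hsub : ∀ m n, g (m + n) ≤ g m * g n)

@[simp] theorem opW_apply (m) (x : XX c B) (k) :
    ev k (opW B g hgpos hsub m x) = ((g k / g (k - m) : ℝ) : ℂ) • ev (k - m) x := rfl

theorem opL_norm (b : B) : ‖opL c b‖ ≤ ‖b‖ := opMk_norm _ _ _ _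

theorem opW_norm (m) : ‖opW B g hgpos hsub m‖ ≤ g m := opMk_norm _ _ _ _

theorem opW_zero : opW B g hgpos hsub 0 = 1 := by
  ext x k
  simp [(hgpos k).ne']

theorem opW_add (m n) : opW B g hgpos hsub (m + n) =
    opW B g hgpos hsub m * opW B g hgpos hsub n := by
  ext x k
  simp only [opW_apply, mul_apply_eq_comp, smul_smul, sub_add_eq_sub_sub]
  congr 1
  rw [← Complex.ofReal_mul, div_mul_div_cancel₀ (hgpos _).ne']

theorem opW_opR (m) (b : B) : opW B g hgpos hsub m * opR c b = opR c b * opW B g hgpos hsub m := by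
  ext x k
  simp

theorem opW_opL (m) (b : B) : opW B g hgpos hsub m * opL c b = opL c b * opW B g hgpos hsub m := by
  ext x k
  simp

theorem opL_opR (a b : B) : opL c a * opR c b = opR c b * opL c a := by
  ext x k
  simp [mul_assoc]

/-- The convolution algebra, as a commutant. -/
noncomputable def AA : Subalgebra ℂ (XX c B →L[ℂ] XX c B) :=
  Subalgebra.centralizer ℂ
    (Set.range (opW B g hgpos hsub) ∪ Set.range (opR (B := B) c))

theorem mem_AA (T : XX c B →L[ℂ] XX c B) : T ∈ AA (B := B) g hgpos hsub ↔
    (∀ m, opW B g hgpos hsub m * T = T * opW B g hgpos hsub m) ∧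
    (∀ b, opR c b * T = T * opR c b) := by
  simp only [AA, Subalgebra.mem_centralizer_iff, Set.mem_union, Set.mem_range]
  constructor
  · intro h
    exact ⟨fun m => h _ (Or.inl ⟨m, rfl⟩), fun m => h _ (Or.inr ⟨m, rfl⟩)⟩
  · rintro ⟨h1, h2⟩ _ (⟨m, rfl⟩ | ⟨m, rfl⟩)
    · exact h1 m
    · exact h2 m

theorem AA_closed : IsClosed (AA (B := B) g hgpos hsub : Set (XX c B →L[ℂ] XX c B)) :=
  centralizer_closed _

theorem opW_mem (m) : opW B g hgpos hsub m ∈ AA (B := B) g hgpos hsub := by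
  rw [mem_AA]
  refine ⟨fun n => ?_, fun b => (opW_opR g hgpos hsub m b).symm⟩
  rw [← opW_add, ← opW_add, add_comm]

theorem opL_mem (b : B) : opL c b ∈ AA (B := B) g hgpos hsub := by
  rw [mem_AA]
  exact ⟨fun n => opW_opL g hgpos hsub n b, fun b' => (opL_opR b b').symm⟩

/-- Left multiplication as an algebra map. -/
noncomputable def opLhom : B →ₐ[ℂ] AA (B := B) g hgpos hsub :=
  AlgHom.ofLinearMap
    { toFun := fun b => ⟨opL c b, opL_mem g hgpos hsub b⟩
      map_add' := fun a b => by ext x k; simp [add_mul]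
      map_smul' := fun a b => by ext x k; simp }
    (by ext x k; simp) (fun a b => by ext x k; simp [mul_assoc])

theorem opLhom_cont : Continuous (opLhom (B := B) g hgpos hsub) :=
  AddMonoidHomClass.continuous_of_bound (opLhom (B := B) g hgpos hsub) 1
    (fun b => by rw [one_mul]; exact opL_norm b)

/-- Shifts in the algebra. -/
noncomputable def zz (m : Fin c → ℤ) : AA (B := B) g hgpos hsub :=
  ⟨opW B g hgpos hsub m, opW_mem g hgpos hsub m⟩

variable [CompleteSpace B]

theorem AA_complete : CompleteSpace (AA (B := B) g hgpos hsub) :=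
  (AA_closed g hgpos hsub).completeSpace_coe

theorem summable_term' (a : (Fin c → ℤ) → B) (ha : Summable fun m => g m * ‖a m‖) :
    Summable fun m => opLhom g hgpos hsub (a m) * zz (B := B) g hgpos hsub m := by
  have := AA_complete (B := B) g hgpos hsub
  exact summable_generic (p := fun m => ‖a m‖) (q := g) (fun m => opL_norm (a m))
    (fun m => opW_norm g hgpos hsub m) ha

/-- Convolution operator. -/
noncomputable def conv (a : (Fin c → ℤ) → B) : AA (B := B) g hgpos hsub :=
  ∑' m, opLhom g hgpos hsub (a m) * zz (B := B) g hgpos hsub m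

theorem conv_apply (a : (Fin c → ℤ) → B) (ha : Summable fun m => g m * ‖a m‖) (x : XX c B) (k) :
    HasSum (fun m => a m * (((g k / g (k - m) : ℝ) : ℂ) • ev (k - m) x))
      (ev k ((conv g hgpos hsub a).1 x)) := by
  have h := (summable_term' g hgpos hsub a ha).hasSum
  have h1 := hasSum_coe_generic _ _ _ h
  have h2 := h1.mapL (ContinuousLinearMap.apply ℂ (XX c B) x)
  have h3 := h2.mapL (ev k)
  convert! h3 using 2 with m
  change _ = ev k (opL c (a m) (opW B g hgpos hsub m x))
  rw [opL_apply, opW_apply]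

/-- The family represented by an operator. -/
noncomputable def coef (T : AA (B := B) g hgpos hsub) (k : Fin c → ℤ) : B :=
  (((g k)⁻¹ : ℝ) : ℂ) • ev k (T.1 (sg 0 1))

theorem coef_summable (T : AA (B := B) g hgpos hsub) :
    Summable fun m => g m * ‖coef g hgpos hsub T m‖ := by
  refine (summable_of_XX (T.1 (sg 0 1))).congr fun m => ?_
  rw [coef, norm_smul, Complex.norm_real, Real.norm_of_nonneg (inv_pos.mpr (hgpos m)).le,
    mul_inv_cancel_left₀ (hgpos m).ne']

theorem AA_ext (hg0 : g 0 = 1) (T T' : AA (B := B) g hgpos hsub)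
    (h : T.1 (sg 0 1) = T'.1 (sg 0 1)) : T = T' := by
  apply Subtype.ext
  apply ContinuousLinearMap.ext
  intro x
  have hs : ∀ (k : Fin c → ℤ) (b : B), sg k b =
      ((((g k)⁻¹ : ℝ) : ℂ)) • opW B g hgpos hsub k (opR c b (sg 0 1)) := by
    intro k b
    ext j
    by_cases hj : j = k
    · subst hj
      rw [map_smul, opW_apply, opR_apply, smul_smul, sub_self, hg0, ev_sg_self, ev_sg_self, one_mul,
        div_one, ← Complex.ofReal_mul, inv_mul_cancel₀ (hgpos j).ne', Complex.ofReal_one, one_smul]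
    · have hj' : j - k ≠ 0 := fun h => hj (sub_eq_zero.mp h)
      simp [ev_sg_ne k j hj, ev_sg_ne 0 _ hj']
  have key : ∀ (k : Fin c → ℤ) (b : B) (S : AA (B := B) g hgpos hsub),
      S.1 (sg k b) = ((((g k)⁻¹ : ℝ) : ℂ)) •
        opW B g hgpos hsub k (opR c b (S.1 (sg 0 1))) := by
    intro k b S
    obtain ⟨h1, h2⟩ := (mem_AA g hgpos hsub S.1).mp S.2
    have h1' := fun y => DFunLike.congr_fun (h1 k) y
    have h2' := fun y => DFunLike.congr_fun (h2 b) y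
    simp only [mul_apply_eq_comp] at h1' h2'
    rw [hs, map_smul, ← h1', ← h2']
  have hx := hasSum_sg x
  refine (hx.mapL T.1).unique ?_
  convert! hx.mapL T'.1 using 2 with k
  rw [key _ _ T, key _ _ T', h]

theorem conv_coef (hg0 : g 0 = 1) (T : AA (B := B) g hgpos hsub) :
    conv g hgpos hsub (coef g hgpos hsub T) = T := by
  apply AA_ext g hgpos hsub hg0
  ext k
  refine (conv_apply g hgpos hsub _ (coef_summable g hgpos hsub T) _ k).unique ?_
  refine hasSum_single_eq k ?_ ?_
  · rw [sub_self, hg0, coef, div_one, ev_sg_self, smul_mul_smul_comm, mul_one, ← Complex.ofReal_mul,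
      inv_mul_cancel₀ (hgpos k).ne', Complex.ofReal_one, one_smul]
  · intro m hm
    have : k - m ≠ 0 := fun h => hm (sub_eq_zero.mp h).symm
    simp [ev_sg_ne 0 _ this]

theorem coef_mul (hg0 : g 0 = 1) (S T : AA (B := B) g hgpos hsub) (k) :
    HasSum (fun m => coef g hgpos hsub S m * coef g hgpos hsub T (k - m))
      (coef g hgpos hsub (S * T) k) := by
  have h := conv_apply g hgpos hsub _ (coef_summable g hgpos hsub S) (T.1 (sg 0 1)) k
  rw [conv_coef g hgpos hsub hg0] at h
  have h2 := h.const_smul (((g k)⁻¹ : ℝ) : ℂ)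
  convert! h2 using 2 with m
  rw [← mul_smul_comm, smul_smul, ← Complex.ofReal_mul]
  rw [coef, ← mul_div_assoc, inv_mul_cancel₀ (hgpos k).ne', one_div]
  rfl

theorem coef_one (hg0 : g 0 = 1) (k) :
    coef g hgpos hsub (1 : AA (B := B) g hgpos hsub) k = deltaB c B k := by
  by_cases hk : k = 0
  · subst hk; simp [coef, deltaB, hg0, ev_sg_self]
  · simp [coef, deltaB, hk, ev_sg_ne 0 k hk]

theorem coef_conv (hg0 : g 0 = 1) (a : (Fin c → ℤ) → B) (ha : Summable fun m => g m * ‖a m‖) :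
    coef g hgpos hsub (conv g hgpos hsub a) = a := by
  ext k
  have h := (conv_apply g hgpos hsub _ ha (sg 0 1) k).const_smul (((g k)⁻¹ : ℝ) : ℂ)
  refine h.unique ?_
  refine hasSum_single_eq k ?_ ?_
  · rw [sub_self, hg0, div_one, ev_sg_self, mul_smul_comm, mul_one, smul_smul, ← Complex.ofReal_mul,
      inv_mul_cancel₀ (hgpos k).ne', Complex.ofReal_one, one_smul]
  · intro m hm
    have : k - m ≠ 0 := fun h => hm (sub_eq_zero.mp h).symm
    simp [ev_sg_ne 0 _ this]

theorem left_inv_AA (hg0 : g 0 = 1)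
    (hsa : ∀ (a : (Fin c → ℤ) → B), (Summable fun m => g m * ‖a m‖) →
      ∀ u : Fin c → ℂ, (∀ i, ‖u i‖ = 1) → Summable fun k => upow c u k • a k)
    (hGRS : ∀ t : Fin c → ℤ,
      Tendsto (fun n : ℕ => (g ((n : ℤ) • t)) ^ ((n : ℝ)⁻¹)) atTop (𝓝 1))
    (T : AA (B := B) g hgpos hsub)
    (hinv : ∀ u : Fin c → ℂ, (∀ i, ‖u i‖ = 1) →
      IsUnit (∑' k, upow c u k • coef g hgpos hsub T k)) :
    ∃ S, S * T = 1 := by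
  have := AA_complete (B := B) g hgpos hsub
  have h := left_inv_abstract c g hGRS (R := AA (B := B) g hgpos hsub)
    ContinuousLinearMap.norm_id_le (zz g hgpos hsub)
    (fun m x => Subtype.ext (((mem_AA g hgpos hsub x.1).mp x.2).1 m))
    (Subtype.ext (opW_zero (B := B) g hgpos hsub))
    (fun m n => Subtype.ext (opW_add (B := B) g hgpos hsub m n))
    (fun m => opW_norm g hgpos hsub m) (opLhom g hgpos hsub) (opLhom_cont g hgpos hsub)
    (coef g hgpos hsub T) (hsa _ (coef_summable g hgpos hsub T))
    (summable_term' g hgpos hsub _ (coef_summable g hgpos hsub T)) hinv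
  have h2 := conv_coef g hgpos hsub hg0 T
  rw [conv] at h2
  rwa [h2] at h

end ops

theorem upow_add (c : ℕ) (u : Fin c → ℂ) (hu : ∀ i, ‖u i‖ = 1) (m n : Fin c → ℤ) :
    upow c u (m + n) = upow c u m * upow c u n := by
  unfold upow
  rw [← Finset.prod_mul_distrib]
  refine Finset.prod_congr rfl fun i _ => zpow_add₀ (fun h => ?_) _ _
  have := hu i
  simp [h] at this

theorem upow_norm (c : ℕ) (u : Fin c → ℂ) (hu : ∀ i, ‖u i‖ = 1) (m : Fin c → ℤ) :
    ‖upow c u m‖ = 1 := by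
  simp [upow, hu]

theorem eval_mul (c : ℕ) {B : Type*} [NormedRing B] [NormedAlgebra ℂ B] [CompleteSpace B]
    (a b : (Fin c → ℤ) → B) (ha : Summable fun m => ‖a m‖) (hb : Summable fun m => ‖b m‖)
    (h : ∀ k, HasSum (fun m => a m * b (k - m)) (deltaB c B k))
    (u : Fin c → ℂ) (hu : ∀ i, ‖u i‖ = 1) :
    (∑' k, upow c u k • a k) * (∑' k, upow c u k • b k) = 1 := by
  have ha' : Summable fun m => ‖upow c u m • a m‖ := by simpa [norm_smul, upow_norm c u hu] using ha
  have hb' : Summable fun m => ‖upow c u m • b m‖ := by simpa [norm_smul, upow_norm c u hu] using hb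
  rw [tsum_mul_tsum_of_summable_norm ha' hb']
  have hs := summable_mul_of_summable_norm ha' hb'
  let e : ((Fin c → ℤ) × (Fin c → ℤ)) ≃ ((Fin c → ℤ) × (Fin c → ℤ)) :=
    { toFun := fun p => (p.2, p.1 - p.2)
      invFun := fun p => (p.1 + p.2, p.1)
      left_inv := fun p => by simp
      right_inv := fun p => by simp }
  rw [← e.tsum_eq]
  have hs2 := e.summable_iff.mpr hs
  refine HasSum.tsum_eq ?_
  have hd : HasSum (fun k => upow c u k • deltaB c B k) (1 : B) := by
    refine hasSum_single_eq (0 : Fin c → ℤ) ?_ ?_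
    · simp [deltaB, upow]
    · intro k hk; simp [deltaB, hk]
  have hfib : ∀ k, HasSum (fun m => (fun p : (Fin c → ℤ) × (Fin c → ℤ) =>
      upow c u p.1 • a p.1 * upow c u p.2 • b p.2) (e (k, m))) (upow c u k • deltaB c B k) := by
    intro k
    convert! (h k).const_smul (upow c u k) using 2 with m
    change upow c u m • a m * upow c u (k - m) • b (k - m) = _
    rw [smul_mul_smul_comm, ← upow_add c u hu, add_sub_cancel]
  have := hs2.hasSum.prod_fiberwise hfib
  rw [← this.unique hd]
  exact hs2.hasSum

/-- Bochner–Phillips-type invertibility criterion: for a weight with the GRS condition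
and a unital complex Banach algebra `B`, an element `a ∈ l_{1,g}(ℤ^c, B)` is invertible
in the convolution algebra `l_{1,g}(ℤ^c, B)` iff for every `u` on the torus the element
`∑_k u^k • a_k` is invertible in `B`. -/
theorem l1g_invertibility_criterion (c : ℕ) (g : (Fin c → ℤ) → ℝ)
    (hgpos : ∀ n, 0 < g n) (hg0 : g 0 = 1)
    (hsub : ∀ m n, g (m + n) ≤ g m * g n) (hsymm : ∀ n, g (-n) = g n)
    (hge : ∀ n, 1 ≤ g n)
    (hGRS : ∀ t : Fin c → ℤ,
      Tendsto (fun n : ℕ => (g ((n : ℤ) • t)) ^ ((n : ℝ)⁻¹)) atTop (𝓝 1))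
    {B : Type*} [NormedRing B] [NormedAlgebra ℂ B] [CompleteSpace B]
    (a : (Fin c → ℤ) → B) (ha : Summable fun m => g m * ‖a m‖) :
    (∃ b : (Fin c → ℤ) → B, (Summable fun m => g m * ‖b m‖) ∧
      (∀ k, HasSum (fun m => a m * b (k - m)) (deltaB c B k)) ∧
      (∀ k, HasSum (fun m => b m * a (k - m)) (deltaB c B k)))
    ↔ ∀ u : Fin c → ℂ, (∀ i, ‖u i‖ = 1) → IsUnit (∑' k, upow c u k • a k) := by
  have hle : ∀ b : (Fin c → ℤ) → B, (Summable fun m => g m * ‖b m‖) → Summable fun m => ‖b m‖ :=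
    fun b hb => hb.of_nonneg_of_le (fun _ => norm_nonneg _)
      (fun m => le_mul_of_one_le_left (norm_nonneg _) (hge m))
  have hsa : ∀ (a : (Fin c → ℤ) → B), (Summable fun m => g m * ‖a m‖) →
      ∀ u : Fin c → ℂ, (∀ i, ‖u i‖ = 1) → Summable fun k => upow c u k • a k := by
    intro a ha u hu
    refine Summable.of_norm ?_
    simpa [norm_smul, upow_norm c u hu] using hle a ha
  constructor
  · rintro ⟨b, hb, h1, h2⟩ u hu
    exact ⟨⟨_, _, eval_mul c a b (hle a ha) (hle b hb) h1 u hu,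
      eval_mul c b a (hle b hb) (hle a ha) h2 u hu⟩, rfl⟩
  · intro hinv
    have hca := coef_conv g hgpos hsub hg0 a ha
    set A := conv g hgpos hsub a with hA
    obtain ⟨S, hS⟩ := left_inv_AA g hgpos hsub hg0 hsa hGRS A (by rw [hca]; exact hinv)
    have hSA : ∀ k, HasSum (fun m => coef g hgpos hsub S m * a (k - m)) (deltaB c B k) := by
      intro k
      have := coef_mul g hgpos hsub hg0 S A k
      rwa [hS, hca, coef_one g hgpos hsub hg0] at this
    have hSs := coef_summable g hgpos hsub S
    obtain ⟨S', hS'⟩ := left_inv_AA g hgpos hsub hg0 hsa hGRS S (by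
      intro u hu
      have h := eval_mul c _ a (hle _ hSs) (hle a ha) hSA u hu
      obtain ⟨w, hw⟩ := hinv u hu
      rw [← hw] at h
      have h' := Units.mul_eq_one_iff_eq_inv.mp h
      rw [h']
      exact Units.isUnit _)
    have hAS : A * S = 1 := by
      have : S' = A := left_inv_eq_right_inv hS' hS
      rw [← this]; exact hS'
    refine ⟨coef g hgpos hsub S, hSs, fun k => ?_, hSA⟩
    have := coef_mul g hgpos hsub hg0 A S k
    rwa [hAS, hca, coef_one g hgpos hsub hg0] at this
end

section
/- Let g be a weight on ℤ^c satisfying assumptions (a)–(e) and let B be a unital complex Banach algebra. If a ∈ l_{1,g}(ℤ^c,B) and b ∈ l_1(ℤ^c,B) satisfy a∗b = b∗a = δ, then b ∈ l_{1,g}(ℤ^c,B); that is, the subalgebra l_{1,g}(ℤ^c,B) is full (inverse-closed) in the convolution algebra l_1(ℤ^c,B). -/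
open Filter
open scoped Topology

open scoped ENNReal

namespace L1GB

lemma enorm_mul_le' {B : Type*} [NormedRing B] (x y : B) : ‖x * y‖ₑ ≤ ‖x‖ₑ * ‖y‖ₑ := by
  rw [← ofReal_norm, ← ofReal_norm, ← ofReal_norm, ← ENNReal.ofReal_mul (norm_nonneg _)]
  exact ENNReal.ofReal_le_ofReal (norm_mul_le x y)

lemma tail {E : Type*} [DecidableEq E] (f : E → ℝ≥0∞) (hf : ∑' x, f x ≠ ⊤) (ε : ℝ≥0∞)
    (hε : 0 < ε) : ∃ F : Finset E, ∑' m, (if m ∈ F then 0 else f m) < ε := by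
  obtain ⟨F, hF⟩ := ((ENNReal.tendsto_tsum_compl_atTop_zero hf).eventually_lt_const hε).exists
  refine ⟨F, ?_⟩
  have h := tsum_subtype {x | x ∉ F} f
  have h2 : ∑' m, (if m ∈ F then 0 else f m) = ∑' x, Set.indicator {x | x ∉ F} f x := by
    refine tsum_congr fun x => ?_
    by_cases hx : x ∈ F <;> simp [hx]
  rw [h2, ← h]
  exact hF

lemma core {E : Type*} [AddCommGroup E] [DecidableEq E] (β σ γ w : E → ℝ≥0∞) (C : ℝ≥0∞) (F0 : Finset E)
    (hw1 : ∀ x, 1 ≤ w x) (hwt : ∀ x, w x ≠ ⊤) (hCt : C ≠ ⊤)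
    (hC : ∀ l : List E, γ l.sum ≤ C * (l.map w).prod)
    (hγ : ∀ x y, γ (x + y) ≤ γ x * γ y) (hγt : ∀ x, γ x ≠ ⊤)
    (hβ : ∀ m, β m ≤ (if m ∈ F0 then β m else 0) + ∑' x, β x * σ (m - x))
    (hβs : ∑' m, β m ≠ ⊤) (hσ : ∑' x, w x * σ x < 1) :
    ∑' m, γ m * β m ≠ ⊤ := by
  have hw0 : ∀ x, w x ≠ 0 := fun x h => by simpa [h] using hw1 x
  set G : E → ℝ≥0∞ := fun m => ⨆ l : List E, γ (m + l.sum) * (l.map fun x => (w x)⁻¹).prod with hG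
  have hprod : ∀ l : List E, (l.map w).prod * (l.map fun x => (w x)⁻¹).prod = 1 := by
    intro l
    induction l with
    | nil => simp
    | cons x l ih =>
      simp only [List.map_cons, List.prod_cons]
      rw [mul_mul_mul_comm, ih, ENNReal.mul_inv_cancel (hw0 x) (hwt x), one_mul]
  have hγG : ∀ m, γ m ≤ G m := by
    intro m
    refine le_iSup_of_le [] ?_
    simp
  have hGw : ∀ m x, G (m + x) ≤ w x * G m := by
    intro m x
    refine iSup_le fun l => ?_
    calc γ (m + x + l.sum) * (l.map fun x => (w x)⁻¹).prod
        = w x * (γ (m + (x :: l).sum) * ((x :: l).map fun x => (w x)⁻¹).prod) := by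
          simp only [List.map_cons, List.prod_cons, List.sum_cons, add_assoc]
          rw [mul_left_comm, ← mul_assoc (w x), ENNReal.mul_inv_cancel (hw0 x) (hwt x), one_mul]
      _ ≤ w x * G m := by
          gcongr
          exact le_iSup (fun l : List E => γ (m + l.sum) * (l.map fun x => (w x)⁻¹).prod) (x :: l)
  have hGt : ∀ m, G m ≠ ⊤ := by
    intro m
    refine ne_top_of_le_ne_top (ENNReal.mul_ne_top (hγt m) hCt) (iSup_le fun l => ?_)
    calc γ (m + l.sum) * (l.map fun x => (w x)⁻¹).prod
        ≤ γ m * (C * (l.map w).prod) * (l.map fun x => (w x)⁻¹).prod := by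
          gcongr
          exact (hγ _ _).trans (by gcongr; exact hC l)
      _ = γ m * C * ((l.map w).prod * (l.map fun x => (w x)⁻¹).prod) := by ring
      _ = γ m * C := by rw [hprod, mul_one]
  set q := ∑' x, w x * σ x with hq
  set K := ∑ m ∈ F0, G m * β m with hK
  have hβt : ∀ m, β m ≠ ⊤ := ENNReal.ne_top_of_tsum_ne_top hβs
  have hKt : K ≠ ⊤ := by
    rw [hK]
    exact ENNReal.sum_ne_top.2 fun m _ => ENNReal.mul_ne_top (hGt m) (hβt m)
  have main : ∀ N : ℝ≥0∞, N ≠ ⊤ → ∑' m, min (G m) N * β m ≤ K / (1 - q) := by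
    intro N hN
    set T := ∑' m, min (G m) N * β m with hT
    have hTt : T ≠ ⊤ := by
      refine ne_top_of_le_ne_top (ENNReal.mul_ne_top hN hβs) ?_
      rw [← ENNReal.tsum_mul_left]
      exact ENNReal.tsum_le_tsum fun m => by gcongr; exact min_le_right _ _
    have hmin : ∀ m x, min (G (m + x)) N ≤ w x * min (G m) N := by
      intro m x
      rcases le_total (G m) N with h | h
      · rw [min_eq_left h]; exact (min_le_left _ _).trans (hGw m x)
      · rw [min_eq_right h]
        exact (min_le_right _ _).trans (le_mul_of_one_le_left (zero_le) (hw1 x))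
    have h1 : T ≤ K + T * q := by
      calc T ≤ ∑' m, (min (G m) N * (if m ∈ F0 then β m else 0)
              + ∑' x, min (G m) N * (β x * σ (m - x))) := by
            refine ENNReal.tsum_le_tsum fun m => ?_
            rw [ENNReal.tsum_mul_left, ← mul_add]
            gcongr
            exact hβ m
        _ = ∑' m, (min (G m) N * (if m ∈ F0 then β m else 0))
              + ∑' m, ∑' x, min (G m) N * (β x * σ (m - x)) := ENNReal.tsum_add
        _ ≤ K + T * q := by
            gcongr
            · rw [tsum_eq_sum (s := F0) (by intro m hm; simp [hm])]
              refine Finset.sum_le_sum fun m hm => ?_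
              rw [if_pos hm]
              gcongr
              exact min_le_left _ _
            · rw [ENNReal.tsum_comm, hT, ← ENNReal.tsum_mul_right]
              refine ENNReal.tsum_le_tsum fun x => ?_
              rw [← (Equiv.addLeft x).tsum_eq (fun m => min (G m) N * (β x * σ (m - x))),
                hq, ← ENNReal.tsum_mul_left]
              refine ENNReal.tsum_le_tsum fun y => ?_
              simp only [Equiv.coe_addLeft, add_sub_cancel_left]
              calc min (G (x + y)) N * (β x * σ y) ≤ (w y * min (G x) N) * (β x * σ y) := by
                    gcongr; exact hmin x y
                _ = _ := by ring
    have hq0 : 1 - q ≠ 0 := (tsub_pos_of_lt hσ).ne'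
    rw [ENNReal.le_div_iff_mul_le (Or.inl hq0) (Or.inl (by simp)),
      ENNReal.mul_sub (fun _ _ => hTt), mul_one]
    exact tsub_le_iff_right.2 h1
  refine ne_top_of_le_ne_top
    (ENNReal.div_ne_top hKt (tsub_pos_of_lt hσ).ne') ?_
  rw [ENNReal.tsum_eq_iSup_sum]
  refine iSup_le fun S => ?_
  have hN : ∑ m ∈ S, γ m ≠ ⊤ := ENNReal.sum_ne_top.2 fun m _ => hγt m
  refine le_trans ?_ (main _ hN)
  refine le_trans ?_ (ENNReal.sum_le_tsum S)
  refine Finset.sum_le_sum fun m hm => ?_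
  gcongr
  exact le_min (hγG m) (Finset.single_le_sum (f := γ) (fun _ _ => zero_le) hm)

lemma weight {E : Type*} [AddCommGroup E] [DecidableEq E] (γ : E → ℝ≥0∞) (lam : ℝ≥0∞)
    (h0 : γ 0 ≤ 1) (hγ : ∀ x y, γ (x + y) ≤ γ x * γ y)
    (hgrs : ∀ t, ∃ C : ℝ≥0∞, C ≠ ⊤ ∧ ∀ n : ℕ, γ (n • t) ≤ C * lam ^ n) (F : Finset E) :
    ∃ C : ℝ≥0∞, C ≠ ⊤ ∧ ∀ l : List E,
      γ l.sum ≤ C * (l.map fun x => if x ∈ F then lam else γ x).prod := by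
  induction F using Finset.induction_on with
  | empty =>
    refine ⟨1, by simp, fun l => ?_⟩
    induction l with
    | nil => simpa using h0
    | cons x l ih =>
      simp only [List.sum_cons, List.map_cons, List.prod_cons, one_mul, Finset.notMem_empty,
        if_false] at ih ⊢
      exact (hγ _ _).trans (by gcongr)
  | insert t F ht ih =>
    obtain ⟨C, hC, h⟩ := ih
    obtain ⟨D, hD, h'⟩ := hgrs t
    refine ⟨D * C, ENNReal.mul_ne_top hD hC, fun l => ?_⟩
    have key : ∀ l : List E, ∃ (k : ℕ) (l2 : List E), l.sum = k • t + l2.sum ∧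
        (l.map fun x => if x ∈ insert t F then lam else γ x).prod =
          lam ^ k * (l2.map fun x => if x ∈ F then lam else γ x).prod := by
      intro l
      induction l with
      | nil => exact ⟨0, [], by simp, by simp⟩
      | cons x l ih =>
        obtain ⟨k, l2, e1, e2⟩ := ih
        by_cases hx : x = t
        · refine ⟨k + 1, l2, ?_, ?_⟩
          · rw [List.sum_cons, e1, hx, succ_nsmul]; abel
          · rw [List.map_cons, List.prod_cons, e2, hx]
            simp only [Finset.mem_insert_self, if_true]
            ring
        · refine ⟨k, x :: l2, ?_, ?_⟩
          · rw [List.sum_cons, List.sum_cons, e1]; abel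
          · rw [List.map_cons, List.prod_cons, e2, List.map_cons, List.prod_cons]
            simp only [Finset.mem_insert, hx, false_or]
            ring
    obtain ⟨k, l2, e1, e2⟩ := key l
    rw [e1, e2]
    calc _ ≤ γ (k • t) * γ l2.sum := hγ _ _
      _ ≤ (D * lam ^ k) * (C * (l2.map fun x => if x ∈ F then lam else γ x).prod) := by
        gcongr
        · exact h' k
        · exact h l2
      _ = _ := by ring

lemma grs_bound (u : ℕ → ℝ) (hu : ∀ n, 1 ≤ u n)
    (h : Tendsto (fun n : ℕ => (u n) ^ ((n : ℝ)⁻¹)) atTop (𝓝 1)) (lam : ℝ) (hl : 1 < lam) :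
    ∃ C : ℝ≥0∞, C ≠ ⊤ ∧ ∀ n : ℕ, ENNReal.ofReal (u n) ≤ C * ENNReal.ofReal lam ^ n := by
  obtain ⟨M, hM⟩ := eventually_atTop.1 ((h.eventually_lt_const hl).and (eventually_ge_atTop 1))
  refine ⟨ENNReal.ofReal (1 + ∑ n ∈ Finset.range M, u n), by simp, fun n => ?_⟩
  have hS : 0 ≤ ∑ n ∈ Finset.range M, u n := Finset.sum_nonneg fun i _ => by linarith [hu i]
  rw [← ENNReal.ofReal_pow (by linarith), ← ENNReal.ofReal_mul (by linarith)]
  refine ENNReal.ofReal_le_ofReal ?_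
  have hp : 1 ≤ lam ^ n := one_le_pow₀ hl.le
  by_cases hn : n < M
  · have : u n ≤ ∑ n ∈ Finset.range M, u n :=
      Finset.single_le_sum (f := u) (fun i _ => by linarith [hu i]) (Finset.mem_range.2 hn)
    nlinarith
  · obtain ⟨h1, h2⟩ := hM n (not_lt.1 hn)
    have h3 : u n = ((u n) ^ ((n : ℝ)⁻¹)) ^ n :=
      (Real.rpow_inv_natCast_pow (by linarith [hu n]) (by lia)).symm
    have h4 : u n ≤ lam ^ n := by
      rw [h3]
      exact pow_le_pow_left₀ (Real.rpow_nonneg (by linarith [hu n]) _) h1.le n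
    nlinarith

lemma conv_sum {E : Type*} [AddCommGroup E] (f h : E → ℝ≥0∞) :
    ∑' k, ∑' m, f m * h (k - m) = (∑' m, f m) * ∑' m, h m := by
  rw [ENNReal.tsum_comm, ← ENNReal.tsum_mul_right]
  refine tsum_congr fun m => ?_
  rw [ENNReal.tsum_mul_left]
  congr 1
  exact (Equiv.subRight m).tsum_eq h

end L1GB

/-- Inverse-closedness of `l_{1,g}(ℤ^c, B)` in `l_1(ℤ^c, B)` for a unital complex
Banach algebra `B` and a weight satisfying the GRS condition: if `a ∈ l_{1,g}` has a
convolution inverse `b ∈ l_1`, then `b ∈ l_{1,g}`. -/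
theorem l1gB_inverse_closed (c : ℕ) (g : (Fin c → ℤ) → ℝ)
    (hgpos : ∀ n, 0 < g n) (hg0 : g 0 = 1)
    (hsub : ∀ m n, g (m + n) ≤ g m * g n) (hsymm : ∀ n, g (-n) = g n)
    (hge : ∀ n, 1 ≤ g n)
    (hGRS : ∀ t : Fin c → ℤ,
      Tendsto (fun n : ℕ => (g ((n : ℤ) • t)) ^ ((n : ℝ)⁻¹)) atTop (𝓝 1))
    {B : Type*} [NormedRing B] [NormedAlgebra ℂ B] [CompleteSpace B]
    (a b : (Fin c → ℤ) → B)
    (ha : Summable fun m => g m * ‖a m‖) (hb : Summable fun m => ‖b m‖)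
    (hab : ∀ k, HasSum (fun m => a m * b (k - m)) (deltaB c B k))
    (hba : ∀ k, HasSum (fun m => b m * a (k - m)) (deltaB c B k)) :
    Summable fun m => g m * ‖b m‖ := by
  classical
  set γ : (Fin c → ℤ) → ℝ≥0∞ := fun m => ENNReal.ofReal (g m) with hγdef
  have hconv : ∀ (x : (Fin c → ℤ) → B) m, ENNReal.ofReal (g m * ‖x m‖) = γ m * ‖x m‖ₑ := by
    intro x m
    rw [ENNReal.ofReal_mul (hgpos m).le, ofReal_norm]
  have hγ1 : ∀ m, 1 ≤ γ m := fun m => by simpa [hγdef] using hge m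
  have hγt : ∀ m, γ m ≠ ⊤ := fun m => ENNReal.ofReal_ne_top
  have hγs : ∀ x y, γ (x + y) ≤ γ x * γ y := by
    intro x y
    simp only [hγdef]
    rw [← ENNReal.ofReal_mul (hgpos x).le]
    exact ENNReal.ofReal_le_ofReal (hsub x y)
  have hγa : ∑' m, γ m * ‖a m‖ₑ ≠ ⊤ := by
    simpa only [hconv] using ha.tsum_ofReal_ne_top
  have hbt : ∑' m, ‖b m‖ₑ ≠ ⊤ := by
    simpa only [ofReal_norm] using hb.tsum_ofReal_ne_top
  have hat : ∑' m, ‖a m‖ₑ ≠ ⊤ :=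
    ne_top_of_le_ne_top hγa (ENNReal.tsum_le_tsum fun m => le_mul_of_one_le_left zero_le (hγ1 m))
  suffices h : ∑' m, γ m * ‖b m‖ₑ ≠ ⊤ by
    have := ENNReal.summable_toReal h
    refine this.congr fun m => ?_
    rw [← hconv, ENNReal.toReal_ofReal (mul_nonneg (hgpos m).le (norm_nonneg _))]
  -- choose F0
  obtain ⟨F0, hF0⟩ : ∃ F0 : Finset (Fin c → ℤ),
      (∑' m, ‖a m‖ₑ) * ∑' m, (if m ∈ F0 then 0 else ‖b m‖ₑ) < 1 := by
    obtain ⟨d, hd, h⟩ := ENNReal.exists_pos_mul_lt hat one_ne_zero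
    obtain ⟨F0, h0⟩ := L1GB.tail _ hbt d (by simpa using hd)
    refine ⟨F0, lt_of_le_of_lt ?_ h⟩
    rw [mul_comm]
    gcongr
  set s : (Fin c → ℤ) → B := fun k => deltaB c B k - ∑ m ∈ F0, a (k - m) * b m with hs
  have hs1 : ∑' k, ‖s k‖ₑ < 1 := by
    refine lt_of_le_of_lt ?_ hF0
    rw [← L1GB.conv_sum (fun m => ‖a m‖ₑ) (fun m => if m ∈ F0 then 0 else ‖b m‖ₑ)]
    refine ENNReal.tsum_le_tsum fun k => ?_
    have h1 : HasSum (fun m => a m * (if k - m ∈ F0 then b (k - m) else 0))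
        (∑ m ∈ F0, a (k - m) * b m) := by
      rw [← (Equiv.subLeft k).hasSum_iff]
      have : (fun m => a m * (if k - m ∈ F0 then b (k - m) else 0)) ∘ (Equiv.subLeft k)
          = fun m => if m ∈ F0 then a (k - m) * b m else 0 := by
        funext m
        simp [Equiv.subLeft_apply]
      rw [this]
      have h2 := hasSum_sum_of_ne_finset_zero (s := F0) (L := SummationFilter.unconditional _)
        (f := fun m => if m ∈ F0 then a (k - m) * b m else 0) (by intro m hm; simp [hm])
      rwa [Finset.sum_congr rfl (g := fun m => a (k - m) * b m)
        (by intro m hm; simp [hm])] at h2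
    have h3 := ((hab k).sub h1).tsum_eq
    simp only [hs]
    rw [← h3]
    refine enorm_tsum_le_tsum_enorm.trans (ENNReal.tsum_le_tsum fun m => ?_)
    by_cases hm : k - m ∈ F0
    · simp [hm]
    · simp only [hm, if_false, mul_zero, sub_zero]
      exact L1GB.enorm_mul_le' _ _
  have hsg : ∑' k, γ k * ‖s k‖ₑ ≠ ⊤ := by
    have : ∀ k, γ k * ‖s k‖ₑ ≤ γ k * ‖deltaB c B k‖ₑ
        + ∑ m ∈ F0, γ m * ‖b m‖ₑ * (γ (k - m) * ‖a (k - m)‖ₑ) := by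
      intro k
      have h1 : ‖s k‖ₑ ≤ ‖deltaB c B k‖ₑ + ∑ m ∈ F0, ‖a (k - m)‖ₑ * ‖b m‖ₑ := by
        refine (enorm_sub_le).trans ?_
        gcongr
        refine (enorm_sum_le _ _).trans (Finset.sum_le_sum fun m _ => L1GB.enorm_mul_le' _ _)
      calc _ ≤ γ k * (‖deltaB c B k‖ₑ + ∑ m ∈ F0, ‖a (k - m)‖ₑ * ‖b m‖ₑ) := by gcongr
        _ ≤ _ := by
          rw [mul_add, Finset.mul_sum]
          refine add_le_add le_rfl (Finset.sum_le_sum fun m hm => ?_)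
          have : γ k ≤ γ m * γ (k - m) := by simpa using hγs m (k - m)
          calc _ ≤ (γ m * γ (k - m)) * (‖a (k - m)‖ₑ * ‖b m‖ₑ) := by gcongr
            _ = _ := by ring
    refine ne_top_of_le_ne_top ?_ (ENNReal.tsum_le_tsum this)
    rw [ENNReal.tsum_add, Summable.tsum_finsetSum (fun _ _ => ENNReal.summable)]
    refine ENNReal.add_ne_top.2 ⟨?_, ENNReal.sum_ne_top.2 fun m _ => ?_⟩
    · rw [tsum_eq_single 0 (by intro k hk; simp [deltaB, hk])]
      exact ENNReal.mul_ne_top (hγt _) (by simp)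
    · have e := (Equiv.subRight m).tsum_eq (fun k => γ k * ‖a k‖ₑ)
      simp only [Equiv.subRight_apply] at e
      rw [ENNReal.tsum_mul_left, e]
      exact ENNReal.mul_ne_top (ENNReal.mul_ne_top (hγt _) (by simp)) hγa
  -- choose lam and F
  obtain ⟨lam, F, hlam, hF⟩ : ∃ (lam : ℝ) (F : Finset (Fin c → ℤ)), 1 < lam ∧
      ∑' k, (if k ∈ F then ENNReal.ofReal lam else γ k) * ‖s k‖ₑ < 1 := by
    set q := ∑' k, ‖s k‖ₑ with hq
    have hq' : q.toReal < 1 := by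
      simpa using (ENNReal.toReal_lt_toReal hs1.ne_top ENNReal.one_ne_top).2 hs1
    have hq0 : 0 ≤ q.toReal := ENNReal.toReal_nonneg
    have hl : 1 < 2 / (1 + q.toReal) := by
      rw [lt_div_iff₀ (by linarith)]; linarith
    have hlq : ENNReal.ofReal (2 / (1 + q.toReal)) * q < 1 := by
      conv_lhs => rw [← ENNReal.ofReal_toReal hs1.ne_top]
      rw [ENNReal.toReal_ofReal hq0, ← ENNReal.ofReal_mul (by linarith), ENNReal.ofReal_lt_one,
        div_mul_eq_mul_div, div_lt_one (by linarith)]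
      linarith
    obtain ⟨F, hF⟩ := L1GB.tail _ hsg _ (tsub_pos_of_lt hlq)
    refine ⟨2 / (1 + q.toReal), F, hl, ?_⟩
    refine lt_of_le_of_lt ?_ (lt_tsub_iff_left.1 hF)
    rw [hq, ← ENNReal.tsum_mul_left, ← ENNReal.tsum_add]
    refine ENNReal.tsum_le_tsum fun k => ?_
    by_cases hk : k ∈ F <;> simp [hk]
  obtain ⟨C, hC, hCl⟩ := L1GB.weight γ (ENNReal.ofReal lam) (by simp [hγdef, hg0]) hγs
    (fun t => by
      have := L1GB.grs_bound (fun n => g ((n : ℤ) • t)) (fun n => hge _) (hGRS t) lam hlam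
      simpa only [natCast_zsmul] using this) F
  refine L1GB.core (fun m => ‖b m‖ₑ) (fun m => ‖s m‖ₑ) γ _ C F0 ?_ ?_ hC hCl hγs hγt
    ?_ hbt hF
  · intro x
    split_ifs
    · simpa using hlam.le
    · exact hγ1 x
  · intro x
    split_ifs
    · simp
    · exact hγt x
  · intro k
    have h1 : HasSum (fun x => b x * deltaB c B (k - x)) (b k) := by
      have := hasSum_single (f := fun x => b x * deltaB c B (k - x)) k (by
        intro x hx
        have : k - x ≠ 0 := sub_ne_zero.2 hx.symm
        simp [deltaB, this])
      simpa [deltaB] using this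
    have h2 : HasSum (fun x => ∑ m ∈ F0, (b x * a (k - m - x)) * b m)
        (∑ m ∈ F0, deltaB c B (k - m) * b m) :=
      hasSum_sum fun m _ => (hba (k - m)).mul_right (b m)
    have h3 : ∑ m ∈ F0, deltaB c B (k - m) * b m = if k ∈ F0 then b k else 0 := by
      simp [deltaB, sub_eq_zero]
    have h4 := (h1.sub h2).tsum_eq
    have h5 : ∀ x, b x * deltaB c B (k - x) - ∑ m ∈ F0, (b x * a (k - m - x)) * b m
        = b x * s (k - x) := by
      intro x
      simp only [hs, mul_sub, Finset.mul_sum, mul_assoc, sub_right_comm]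
    simp only [h5, h3] at h4
    have h6 : b k = (if k ∈ F0 then b k else 0) + ∑' x, b x * s (k - x) := by
      rw [h4]; abel
    calc ‖b k‖ₑ = ‖(if k ∈ F0 then b k else 0) + ∑' x, b x * s (k - x)‖ₑ := by rw [← h6]
      _ ≤ ‖(if k ∈ F0 then b k else 0)‖ₑ + ‖∑' x, b x * s (k - x)‖ₑ := enorm_add_le _ _
      _ ≤ _ := by
        gcongr
        · split_ifs <;> simp
        · exact enorm_tsum_le_tsum_enorm.trans (ENNReal.tsum_le_tsum fun x => L1GB.enorm_mul_le' _ _)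
end

section
/- Let X be a complex Banach space, let g be a weight on ℤ^c satisfying assumptions (a)–(e), and let 1 ≤ p ≤ ∞. Suppose T is a bounded operator on l_p(ℤ^c,X) of the form (Tx)_k = Σ_{m∈ℤ^c} b_{km} x_{k−m} with b_{km} ∈ B(X) and ‖b_{km}‖ ≤ β_m for some β ∈ l_{1,g}(ℤ^c,ℂ) with β_m ≥ 0, and suppose T is invertible in B(l_p(ℤ^c,X)). Then T⁻¹ is also of this form: (T⁻¹x)_k = Σ_{m∈ℤ^c} a_{km} x_{k−m} with a_{km} ∈ B(X) and ‖a_{km}‖ ≤ α_m for some α ∈ l_{1,g}(ℤ^c,ℂ). That is, the subalgebra s_{1,g}(ℤ^c,B(X)) is full in B(l_p(ℤ^c,X)). -/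
open Filter
open scoped ENNReal Topology

/-- The operator `T` on `l_p(ℤ^c, X)` belongs to the class `s_{1,g}(ℤ^c, B(X))`:
`(Tx)_k = ∑_m b_{km} x_{k-m}` with `‖b_{km}‖ ≤ β_m` for some `β ∈ l_{1,g}(ℤ^c, ℂ)`. -/
def MemS1g (c : ℕ) (p : ℝ≥0∞) [Fact (1 ≤ p)] {X : Type*} [NormedAddCommGroup X]
    [NormedSpace ℂ X] (g : (Fin c → ℤ) → ℝ)
    (T : lp (fun _ : Fin c → ℤ => X) p →L[ℂ] lp (fun _ : Fin c → ℤ => X) p) : Prop :=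
  ∃ (b : (Fin c → ℤ) → (Fin c → ℤ) → (X →L[ℂ] X)) (β : (Fin c → ℤ) → ℝ),
    (∀ m, 0 ≤ β m) ∧ (Summable fun m => g m * β m) ∧
    (∀ k m, ‖b k m‖ ≤ β m) ∧
    (∀ x k, HasSum (fun m => b k m (x (k - m))) (T x k))


theorem exists_sub_mem_maximal {A : Type*} [NormedRing A] [NormedAlgebra ℂ A] [CompleteSpace A]
    (L : Ideal A) (hL : L.IsMaximal) (z : A) (hz : ∀ a, a * z = z * a) :
    ∃ l : ℂ, z - algebraMap ℂ A l ∈ L := by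
  by_contra! hcon
  have hcl : IsClosed (L : Set A) := Ideal.IsMaximal.isClosed
  let L' : Submodule ℂ A := L.restrictScalars ℂ
  have hcl' : IsClosed (L' : Set A) := hcl
  have hmem : ∀ a, a ∈ L' ↔ a ∈ L := fun a => Iff.rfl
  let Zl : (A ⧸ L') →ₗ[ℂ] (A ⧸ L') := L'.mapQ L' (LinearMap.mulLeft ℂ z) (by
    intro a ha
    exact L.mul_mem_left z ha)
  have hZl : ∀ a : A, Zl (Submodule.Quotient.mk a) = Submodule.Quotient.mk (z * a) := fun a => rfl
  let Z : (A ⧸ L') →L[ℂ] (A ⧸ L') := Zl.mkContinuous ‖z‖ (by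
    intro q
    refine le_of_forall_pos_le_add fun ε hε => ?_
    obtain ⟨a, rfl, ha⟩ := Submodule.Quotient.norm_mk_lt q (ε := ε / (‖z‖ + 1)) (by positivity)
    rw [hZl]
    refine (Submodule.Quotient.norm_mk_le _ _).trans ((norm_mul_le _ _).trans ?_)
    have h1 : ‖z‖ * ‖a‖ ≤ ‖z‖ * (‖(Submodule.Quotient.mk a : A ⧸ L')‖ + ε / (‖z‖ + 1)) := by gcongr
    have h2 : ‖z‖ * (ε / (‖z‖ + 1)) ≤ ε := by
      rw [← mul_div_assoc, div_le_iff₀ (by positivity)]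
      nlinarith [norm_nonneg z]
    linarith)
  have hZ : ∀ a : A, Z (Submodule.Quotient.mk a) = Submodule.Quotient.mk (z * a) := fun a => rfl
  have hone : (1 : A) ∉ L := fun h => hL.ne_top ((Ideal.eq_top_iff_one L).2 h)
  have : Nontrivial (A ⧸ L') := by
    refine ⟨⟨Submodule.Quotient.mk 1, 0, fun h => hone ?_⟩⟩
    exact (Submodule.Quotient.mk_eq_zero L').1 h
  obtain ⟨l, hl⟩ := spectrum.nonempty Z
  refine hl ?_
  rw [spectrum.mem_resolventSet_iff, ContinuousLinearMap.isUnit_iff_bijective]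
  let w := algebraMap ℂ A l - z
  have hw : ∀ a, a * w = w * a := fun a => by
    simp only [w, mul_sub, sub_mul, hz, Algebra.commutes]
  have hwL : w ∉ L := fun h => hcon l (by simpa [w] using L.neg_mem h)
  have happ : ∀ a : A, (algebraMap ℂ _ l - Z) (Submodule.Quotient.mk a : A ⧸ L') =
      Submodule.Quotient.mk (w * a) := fun a => by
    have : w * a = l • a - z * a := by simp [w, sub_mul, Algebra.smul_def]
    rw [this, Submodule.Quotient.mk_sub, Submodule.Quotient.mk_smul, ← hZ]
    rfl
  constructor
  · rw [injective_iff_map_eq_zero]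
    intro q
    obtain ⟨a, rfl⟩ := Submodule.Quotient.mk_surjective L' q
    rw [happ, Submodule.Quotient.mk_eq_zero, Submodule.Quotient.mk_eq_zero, hmem, hmem]
    intro ha
    let J : Ideal A :=
      { carrier := {a | a * w ∈ L}
        add_mem' := fun {a b} ha hb => by
          simp only [Set.mem_ofPred_eq] at *; rw [add_mul]; exact L.add_mem ha hb
        zero_mem' := by simp
        smul_mem' := fun c x hx => by
          simp only [Set.mem_ofPred_eq, smul_eq_mul] at *; rw [mul_assoc]; exact L.mul_mem_left c hx }
    have hJ : L = J := hL.eq_of_le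
      (fun h => hwL (by have := (Ideal.eq_top_iff_one J).1 h; simpa [J] using this))
      (fun x hx => by change x * w ∈ L; rw [hw]; exact L.mul_mem_left w hx)
    rw [hJ]
    change a * w ∈ L
    rwa [hw]
  · intro q
    obtain ⟨y, rfl⟩ := Submodule.Quotient.mk_surjective L' q
    obtain ⟨a, i, hi, hai⟩ := hL.exists_inv hwL
    refine ⟨Submodule.Quotient.mk (y * a), ?_⟩
    rw [happ, Submodule.Quotient.eq, hmem]
    have : w * (y * a) - y = - (y * i) := by
      have h := congrArg (y * ·) hai
      simp only [mul_add, mul_one] at h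
      rw [← hw, mul_assoc, sub_eq_iff_eq_add, neg_add_eq_sub]
      exact eq_sub_of_add_eq h
    rw [this]
    exact L.neg_mem (L.mul_mem_left y hi)

theorem abstract_wiener {M A : Type*} [AddCommGroup M] [NormedRing A] [NormedAlgebra ℂ A]
    [CompleteSpace A] (g : M → ℝ)
    (hGRS : ∀ t : M, Tendsto (fun n : ℕ => (g ((n : ℤ) • t)) ^ ((n : ℝ)⁻¹)) atTop (𝓝 1))
    (z b : M → A) (hz0 : z 0 = 1) (hzadd : ∀ m n, z (m + n) = z m * z n)
    (hzc : ∀ m a, a * z m = z m * a) (hzn : ∀ m, ‖z m‖ ≤ g m)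
    (F : A) (hF : HasSum (fun m => b m * z m) F)
    (hG : ∀ χ : M → ℂ, (∀ m, ‖χ m‖ = 1) → χ 0 = 1 → (∀ m n, χ (m + n) = χ m * χ n) →
      ∃ G S : A, HasSum (fun m => χ m • b m) G ∧ S * G = 1) :
    ∃ S : A, S * F = 1 := by
  by_contra! hcon
  have hne : Ideal.span {F} ≠ ⊤ := by
    intro h
    rw [Ideal.eq_top_iff_one, Ideal.mem_span_singleton'] at h
    obtain ⟨a, ha⟩ := h
    exact hcon a ha
  obtain ⟨L, hL, hFL⟩ := Ideal.exists_le_maximal _ hne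
  have hcl : IsClosed (L : Set A) := Ideal.IsMaximal.isClosed
  have hone : (1 : A) ∉ L := fun h => hL.ne_top ((Ideal.eq_top_iff_one L).2 h)
  have hFm : F ∈ L := hFL (Ideal.mem_span_singleton_self F)
  choose χ hχ using fun m => exists_sub_mem_maximal L hL (z m) (hzc m)
  have huniq : ∀ (a : A) (l l' : ℂ), a - algebraMap ℂ A l ∈ L → a - algebraMap ℂ A l' ∈ L →
      l = l' := by
    intro a l l' h h'
    by_contra hll
    have h3 : algebraMap ℂ A (l - l') ∈ L := by
      have := L.sub_mem h' h
      rw [map_sub]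
      convert this using 1; abel
    have := L.mul_mem_left (algebraMap ℂ A (l - l')⁻¹) h3
    rw [← map_mul, inv_mul_cancel₀ (sub_ne_zero.2 hll), map_one] at this
    exact hone this
  have hχ0 : χ 0 = 1 := huniq (z 0) _ _ (hχ 0) (by simp [hz0])
  have hχadd : ∀ m n, χ (m + n) = χ m * χ n := fun m n => by
    refine huniq (z (m + n)) _ _ (hχ _) ?_
    have h1 := L.mul_mem_left (z m) (hχ n)
    have h2 := L.mul_mem_left (algebraMap ℂ A (χ n)) (hχ m)
    convert L.add_mem h1 h2 using 1
    rw [hzadd, mul_sub, mul_sub, ← Algebra.commutes (χ n) (z m), ← map_mul, mul_comm (χ n)]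
    abel
  have hχle : ∀ m, ‖χ m‖ ≤ g m * ‖(1 : A)‖ := fun m => by
    have : χ m ∈ spectrum ℂ (z m) := by
      intro hu
      have h1 : algebraMap ℂ A (χ m) - z m ∈ L := by simpa using L.neg_mem (hχ m)
      exact hL.ne_top (Ideal.eq_top_of_isUnit_mem L h1 hu)
    refine (spectrum.norm_le_norm_mul_of_mem this).trans ?_
    gcongr
    exact hzn m
  have hχpow : ∀ (m : M) (n : ℕ), χ ((n : ℤ) • m) = χ m ^ n := fun m n => by
    induction n with
    | zero => simp [hχ0]
    | succ n ih => rw [Nat.cast_succ, add_smul, one_smul, hχadd, ih, pow_succ]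
  have hgnn : ∀ m, 0 ≤ g m := fun m => (norm_nonneg _).trans (hzn m)
  have hχ1 : ∀ m, ‖χ m‖ ≤ 1 := fun m => by
    have : Nontrivial A := ⟨⟨1, 0, fun h => hone (h ▸ L.zero_mem)⟩⟩
    have h1 : Tendsto (fun n : ℕ => ‖(1 : A)‖ ^ ((n : ℝ)⁻¹)) atTop (𝓝 1) := by
      have := (Real.continuousAt_const_rpow (a := ‖(1 : A)‖) (b := 0)
        (norm_pos_iff.2 one_ne_zero).ne').tendsto.comp
          (tendsto_inv_atTop_nhds_zero_nat (𝕜 := ℝ))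
      simpa [Function.comp_def] using this
    have h2 := (hGRS m).mul h1
    rw [one_mul] at h2
    refine ge_of_tendsto h2 ?_
    filter_upwards [eventually_gt_atTop 0] with n hn
    rw [← Real.mul_rpow (hgnn _) (norm_nonneg _)]
    calc ‖χ m‖ = (‖χ m‖ ^ n) ^ ((n : ℝ)⁻¹) := (Real.pow_rpow_inv_natCast (norm_nonneg _) hn.ne').symm
      _ ≤ _ := by
        apply Real.rpow_le_rpow (by positivity) _ (by positivity)
        rw [← norm_pow, ← hχpow]
        exact hχle _
  have hχn : ∀ m, ‖χ m‖ = 1 := fun m => by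
    refine le_antisymm (hχ1 m) ?_
    have h := hχadd m (-m)
    rw [add_neg_cancel, hχ0] at h
    have h' := congrArg norm h
    rw [norm_one, norm_mul] at h'
    nlinarith [hχ1 m, hχ1 (-m), norm_nonneg (χ m)]
  obtain ⟨G, S, hGs, hSG⟩ := hG χ hχn hχ0 hχadd
  have hsub := hF.sub hGs
  have hmem : F - G ∈ L := by
    refine hcl.mem_of_tendsto hsub (Eventually.of_forall fun s => ?_)
    refine L.sum_mem fun m _ => ?_
    have := L.mul_mem_left (b m) (hχ m)
    convert this using 1
    rw [mul_sub, Algebra.smul_def, Algebra.commutes]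
  have hGL : G ∈ L := by
    have := L.sub_mem hFm hmem
    simpa using this
  exact hone (hSG ▸ L.mul_mem_left S hGL)

theorem abstract_wiener_right {M A : Type*} [AddCommGroup M] [NormedRing A] [NormedAlgebra ℂ A]
    [CompleteSpace A] (g : M → ℝ)
    (hGRS : ∀ t : M, Tendsto (fun n : ℕ => (g ((n : ℤ) • t)) ^ ((n : ℝ)⁻¹)) atTop (𝓝 1))
    (z b : M → A) (hz0 : z 0 = 1) (hzadd : ∀ m n, z (m + n) = z m * z n)
    (hzc : ∀ m a, a * z m = z m * a) (hzn : ∀ m, ‖z m‖ ≤ g m)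
    (F : A) (hF : HasSum (fun m => b m * z m) F)
    (hG : ∀ χ : M → ℂ, (∀ m, ‖χ m‖ = 1) → χ 0 = 1 → (∀ m n, χ (m + n) = χ m * χ n) →
      ∃ G S : A, HasSum (fun m => χ m • b m) G ∧ G * S = 1) :
    ∃ S : A, F * S = 1 := by
  obtain ⟨S, hS⟩ := abstract_wiener (A := Aᵐᵒᵖ) g hGRS (fun m => MulOpposite.op (z m))
    (fun m => MulOpposite.op (b m)) (by simp [hz0])
    (fun m n => by rw [hzadd, ← hzc, MulOpposite.op_mul])
    (fun m a => by
      apply MulOpposite.unop_injective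
      simp [hzc]) (fun m => hzn m) (MulOpposite.op F)
    (by
      have := hF.op
      simpa only [hzc, MulOpposite.op_mul] using this)
    (fun χ h1 h2 h3 => by
      obtain ⟨G, S, hG1, hG2⟩ := hG χ h1 h2 h3
      refine ⟨MulOpposite.op G, MulOpposite.op S, ?_, ?_⟩
      · simpa using hG1.op
      · rw [← MulOpposite.op_mul, hG2, MulOpposite.op_one])
  exact ⟨S.unop, by simpa using congrArg MulOpposite.unop hS⟩

theorem abstract_wiener_comm {M R : Type*} [AddCommGroup M] [NormedRing R] [NormedAlgebra ℂ R]
    [CompleteSpace R] (g : M → ℝ)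
    (hGRS : ∀ t : M, Tendsto (fun n : ℕ => (g ((n : ℤ) • t)) ^ ((n : ℝ)⁻¹)) atTop (𝓝 1))
    (z b : M → R) (hz0 : z 0 = 1) (hzadd : ∀ m n, z (m + n) = z m * z n)
    (hzb : ∀ m n, z m * b n = b n * z m) (hzn : ∀ m, ‖z m‖ ≤ g m)
    (hb : Summable fun m => g m * ‖b m‖)
    (hG : ∀ χ : M → ℂ, (∀ m, ‖χ m‖ = 1) → χ 0 = 1 → (∀ m n, χ (m + n) = χ m * χ n) →
      ∃ G S : R, (∀ m, z m * S = S * z m) ∧ HasSum (fun m => χ m • b m) G ∧ G * S = 1) :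
    ∃ F S : R, HasSum (fun m => b m * z m) F ∧ F * S = 1 := by
  have hsum : Summable fun m => b m * z m := by
    refine Summable.of_norm_bounded hb fun m => ?_
    refine (norm_mul_le _ _).trans ?_
    rw [mul_comm]
    exact mul_le_mul_of_nonneg_right (hzn m) (norm_nonneg _)
  obtain ⟨F, hF⟩ := hsum
  let 𝒜 := Subalgebra.centralizer ℂ (Set.range z)
  have hmem : ∀ a, (∀ m, z m * a = a * z m) → a ∈ 𝒜 := fun a h => by
    rw [Subalgebra.mem_centralizer_iff]
    rintro _ ⟨k, rfl⟩
    exact h k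
  have hcl : IsClosed (𝒜 : Set R) := Set.isClosed_centralizer _
  have : CompleteSpace 𝒜 := hcl.completeSpace_coe
  have hzmem : ∀ m, z m ∈ 𝒜 := fun m => hmem _ fun k => by rw [← hzadd, ← hzadd, add_comm]
  have hbmem : ∀ m, b m ∈ 𝒜 := fun m => hmem _ fun k => hzb k m
  have hlim : ∀ (u : M → R) (s : R), (∀ m, u m ∈ 𝒜) → HasSum u s → s ∈ 𝒜 := fun u s hu hs =>
    hcl.mem_of_tendsto hs (Eventually.of_forall fun t => 𝒜.sum_mem fun i _ => hu i)
  have hemb : Topology.IsInducing (𝒜.val : 𝒜 → R) := Topology.IsInducing.subtypeVal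
  have hFmem := hlim _ _ (fun m => 𝒜.mul_mem (hbmem m) (hzmem m)) hF
  obtain ⟨S, hS⟩ := abstract_wiener_right (A := 𝒜) g hGRS (fun m => ⟨z m, hzmem m⟩)
    (fun m => ⟨b m, hbmem m⟩)
    (Subtype.ext hz0) (fun m n => Subtype.ext (hzadd m n))
    (fun m a => Subtype.ext (by
      have := a.2
      rw [Subalgebra.mem_centralizer_iff] at this
      exact (this _ ⟨m, rfl⟩).symm))
    (fun m => hzn m) ⟨F, hFmem⟩ ((hemb.hasSum_iff _ _).1 hF)
    (fun χ h1 h2 h3 => by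
      obtain ⟨G, S, hS, hG1, hG2⟩ := hG χ h1 h2 h3
      have hGmem := hlim _ _ (fun m => 𝒜.smul_mem (hbmem m) (χ m)) hG1
      exact ⟨⟨G, hGmem⟩, ⟨S, hmem S hS⟩, (hemb.hasSum_iff _ _).1 hG1, Subtype.ext hG2⟩)
  exact ⟨F, S, hF, congrArg Subtype.val hS⟩

theorem abstract_wiener_op {M B V : Type*} [AddCommGroup M] [NormedRing B] [NormedAlgebra ℂ B]
    [NormedAddCommGroup V] [NormedSpace ℂ V] [CompleteSpace V] (g : M → ℝ)
    (hgpos : ∀ n, 0 < g n)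
    (hGRS : ∀ t : M, Tendsto (fun n : ℕ => (g ((n : ℤ) • t)) ^ ((n : ℝ)⁻¹)) atTop (𝓝 1))
    (f : M → B) (hf : Summable fun m => g m * ‖f m‖)
    (hG : ∀ χ : M → ℂ, (∀ m, ‖χ m‖ = 1) → χ 0 = 1 → (∀ m n, χ (m + n) = χ m * χ n) →
      ∃ G S : B, HasSum (fun m => χ m • f m) G ∧ G * S = 1)
    (U : M → (V →L[ℂ] V)) (hUn : ∀ m, ‖U m‖ ≤ g m)
    (hU0 : ∀ v, U 0 v = v) (hUadd : ∀ m n v, U (m + n) v = U m (U n v))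
    (Lm : B → (V →L[ℂ] V)) (hLn : ∀ a, ‖Lm a‖ ≤ ‖a‖)
    (hL1 : ∀ v, Lm 1 v = v) (hLmul : ∀ a b v, Lm (a * b) v = Lm a (Lm b v))
    (hLadd : ∀ a b v, Lm (a + b) v = Lm a v + Lm b v)
    (hLsmul : ∀ (c : ℂ) a v, Lm (c • a) v = c • Lm a v)
    (hcomm : ∀ k a v, U k (Lm a v) = Lm a (U k v)) :
    ∃ F S : V →L[ℂ] V, (∀ v, HasSum (fun m => Lm (f m) (U m v)) (F v)) ∧ ∀ v, F (S v) = v := by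
  let Λ : B →L[ℂ] (V →L[ℂ] V) := LinearMap.mkContinuous
    { toFun := fun a => Lm a
      map_add' := fun a a' => by ext v; exact hLadd a a' v
      map_smul' := fun c a => by ext v; exact hLsmul c a v } 1
    (fun a => by rw [one_mul]; exact hLn a)
  have hΛ : ∀ a, Λ a = Lm a := fun a => rfl
  have hsum : Summable fun m => g m * ‖Lm (f m)‖ :=
    Summable.of_nonneg_of_le (fun m => mul_nonneg (hgpos m).le (norm_nonneg _))
      (fun m => mul_le_mul_of_nonneg_left (hLn _) (hgpos m).le) hf
  obtain ⟨F, S, hF, hS⟩ := abstract_wiener_comm g hGRS U (fun m => Lm (f m))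
    (by ext v; exact hU0 v) (fun m n => by ext v; exact hUadd m n v)
    (fun m n => by ext v; exact hcomm m _ v) hUn hsum
    (fun χ h1 h2 h3 => by
      obtain ⟨G, S, hG1, hG2⟩ := hG χ h1 h2 h3
      refine ⟨Lm G, Lm S, fun m => by ext v; exact hcomm m _ v, ?_, ?_⟩
      · have := hG1.mapL Λ
        have hsm : ∀ (c : ℂ) a, Lm (c • a) = c • Lm a := fun c a => by ext v; exact hLsmul c a v
        simpa only [hΛ, hsm] using this
      · ext v
        change Lm G (Lm S v) = v
        rw [← hLmul, hG2, hL1])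
  refine ⟨F, S, fun v => ?_, fun v => ?_⟩
  · exact hF.mapL (ContinuousLinearMap.apply ℂ V v)
  · exact congrArg (fun a : V →L[ℂ] V => a v) hS

theorem lp_shift_bound {M Y : Type*} [AddCommGroup M] [NormedAddCommGroup Y]
    {p : ℝ≥0∞} [Fact (1 ≤ p)] (m : M) (C : ℝ) (hC : 0 ≤ C)
    (x : lp (fun _ : M => Y) p) (y : M → Y) (hy : ∀ k, ‖y k‖ ≤ C * ‖x (k - m)‖) :
    ∃ h : Memℓp y p, ‖(⟨y, h⟩ : lp (fun _ : M => Y) p)‖ ≤ C * ‖x‖ := by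
  have hp0 : p ≠ 0 := (zero_lt_one.trans_le Fact.out).ne'
  rcases eq_or_ne p ∞ with rfl | hp
  · have hb : ∀ k, ‖y k‖ ≤ C * ‖x‖ := fun k => (hy k).trans (by
      gcongr; exact lp.norm_apply_le_norm hp0 x _)
    refine ⟨memℓp_infty ⟨C * ‖x‖, ?_⟩, lp.norm_le_of_forall_le (by positivity) hb⟩
    rintro _ ⟨k, rfl⟩
    exact hb k
  · have hpp : 0 < p.toReal := ENNReal.toReal_pos hp0 hp
    have hs : HasSum (fun k => (C * ‖x (k - m)‖) ^ p.toReal) ((C * ‖x‖) ^ p.toReal) := by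
      have h := ((Equiv.subRight m).hasSum_iff.2 (lp.hasSum_norm hpp x)).mul_left (C ^ p.toReal)
      rw [← Real.mul_rpow hC (norm_nonneg _)] at h
      have he : (fun k => (C * ‖x (k - m)‖) ^ p.toReal) = fun k => C ^ p.toReal *
          ((fun i => ‖x i‖ ^ p.toReal) ∘ (Equiv.subRight m)) k := by
        funext k
        rw [Real.mul_rpow hC (norm_nonneg _)]
        rfl
      rw [he]
      exact h
    have hle : ∀ k, ‖y k‖ ^ p.toReal ≤ (C * ‖x (k - m)‖) ^ p.toReal := fun k =>
      Real.rpow_le_rpow (norm_nonneg _) (hy k) hpp.le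
    have hsy : Summable fun k => ‖y k‖ ^ p.toReal :=
      Summable.of_nonneg_of_le (fun k => by positivity) hle hs.summable
    refine ⟨memℓp_gen hsy, lp.norm_le_of_tsum_le hpp (by positivity) ?_⟩
    rw [← hs.tsum_eq]
    exact hsy.tsum_le_tsum hle hs.summable

theorem exists_diag {M Y : Type*} [AddCommGroup M] [NormedAddCommGroup Y] [NormedSpace ℂ Y]
    (p : ℝ≥0∞) [Fact (1 ≤ p)] (m : M) (b : M → (Y →L[ℂ] Y)) (C : ℝ) (hC : 0 ≤ C)
    (hb : ∀ k, ‖b k‖ ≤ C) :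
    ∃ D : lp (fun _ : M => Y) p →L[ℂ] lp (fun _ : M => Y) p,
      ‖D‖ ≤ C ∧ ∀ x k, D x k = b k (x (k - m)) := by
  have key := fun x : lp (fun _ : M => Y) p => lp_shift_bound m C hC x (fun k => b k (x (k - m)))
    (fun k => (b k).le_of_opNorm_le (hb k) _)
  let Dl : lp (fun _ : M => Y) p →ₗ[ℂ] lp (fun _ : M => Y) p :=
    { toFun := fun x => ⟨fun k => b k (x (k - m)), (key x).1⟩
      map_add' := fun x y => by
        ext k
        change b k ((x + y : lp (fun _ : M => Y) p) (k - m)) = b k (x (k - m)) + b k (y (k - m))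
        simp
      map_smul' := fun c x => by
        ext k
        change b k ((c • x : lp (fun _ : M => Y) p) (k - m)) = c • b k (x (k - m))
        simp }
  refine ⟨Dl.mkContinuous C fun x => (key x).2, Dl.mkContinuous_norm_le hC _, fun x k => rfl⟩

theorem weighted_inverse {M B : Type*} [AddCommGroup M] [DecidableEq M] [NormedRing B]
    [NormedAlgebra ℂ B] [CompleteSpace B] (g : M → ℝ)
    (hgpos : ∀ n, 0 < g n) (hg0 : g 0 = 1)
    (hsub : ∀ m n, g (m + n) ≤ g m * g n)
    (hGRS : ∀ t : M, Tendsto (fun n : ℕ => (g ((n : ℤ) • t)) ^ ((n : ℝ)⁻¹)) atTop (𝓝 1))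
    (f : M → B) (hf : Summable fun m => g m * ‖f m‖)
    (hG : ∀ χ : M → ℂ, (∀ m, ‖χ m‖ = 1) → χ 0 = 1 → (∀ m n, χ (m + n) = χ m * χ n) →
      ∃ G S : B, HasSum (fun m => χ m • f m) G ∧ G * S = 1) :
    ∃ h : M → B, (Summable fun n => g n * ‖h n‖) ∧
      ∀ n, HasSum (fun m => f m * h (n - m)) (if n = 0 then 1 else 0) := by
  have hUb : ∀ m n : M, ‖((g n / g (n - m) : ℝ) : ℂ) • ContinuousLinearMap.id ℂ B‖ ≤ g m := by
    intro m n
    have h1 : ‖((g n / g (n - m) : ℝ) : ℂ)‖ ≤ g m := by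
      rw [Complex.norm_real, Real.norm_eq_abs, abs_of_nonneg (div_nonneg (hgpos _).le (hgpos _).le),
        div_le_iff₀ (hgpos _)]
      simpa using hsub m (n - m)
    rw [norm_smul]
    calc _ ≤ g m * 1 := mul_le_mul h1 ContinuousLinearMap.norm_id_le (norm_nonneg _) (hgpos m).le
      _ = g m := mul_one _
  have hU := fun m : M => exists_diag (Y := B) 1 m
    (fun n : M => ((g n / g (n - m) : ℝ) : ℂ) • ContinuousLinearMap.id ℂ B) (g m) (hgpos m).le
    (hUb m)
  choose U hUn hUa using hU
  have hLd := fun a : B => exists_diag (M := M) 1 (0 : M)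
    (fun _ => ContinuousLinearMap.mul ℂ B a) ‖a‖ (norm_nonneg a)
    (fun _ => ContinuousLinearMap.opNorm_mul_apply_le ℂ B a)
  choose Lm hLn hLa using hLd
  simp only [smul_apply, ContinuousLinearMap.id_apply] at hUa
  simp only [ContinuousLinearMap.mul_apply', sub_zero] at hLa
  obtain ⟨F, S, hF, hS⟩ := abstract_wiener_op g hgpos hGRS f hf hG U hUn
    (fun v => by
      ext n
      rw [hUa, sub_zero, div_self (hgpos n).ne']
      simp)
    (fun m k v => by
      ext n
      rw [hUa, hUa, hUa, smul_smul, ← Complex.ofReal_mul,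
        div_mul_div_cancel₀ (hgpos _).ne', sub_sub])
    Lm hLn
    (fun v => by ext n; rw [hLa, one_mul])
    (fun a b v => by ext n; rw [hLa, hLa, hLa, mul_assoc])
    (fun a b v => by
      ext n
      change _ = Lm a v n + Lm b v n
      rw [hLa, hLa, hLa, add_mul])
    (fun c a v => by
      ext n
      change _ = c • Lm a v n
      rw [hLa, hLa, smul_mul_assoc])
    (fun k a v => by
      ext n
      rw [hUa, hLa, hLa, hUa, mul_smul_comm])
  let v0 : lp (fun _ : M => B) 1 := lp.single 1 0 (1 : B)
  let w : lp (fun _ : M => B) 1 := S v0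
  have hw : F w = v0 := hS v0
  have hF' : ∀ n, HasSum (fun m => f m * (((g n / g (n - m) : ℝ) : ℂ) • w (n - m))) (v0 n) := by
    intro n
    have h2 := (hF w).mapL (lp.evalCLM ℂ (fun _ : M => B) 1 n)
    rw [← hw]
    have he : (fun m => f m * (((g n / g (n - m) : ℝ) : ℂ) • w (n - m))) =
        fun m => (Lm (f m) (U m w)) n := by
      funext m
      rw [hLa, hUa]
    rw [he]
    exact h2
  refine ⟨fun n => ((g n)⁻¹ : ℂ) • w n, ?_, fun n => ?_⟩
  · have := (lp.memℓp w).summable (by simp)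
    simp only [ENNReal.toReal_one, Real.rpow_one] at this
    refine this.congr fun n => ?_
    rw [norm_smul, ← Complex.ofReal_inv, Complex.norm_real, Real.norm_eq_abs,
      abs_of_pos (inv_pos.2 (hgpos n)), mul_inv_cancel_left₀ (hgpos n).ne']
  · have h := (hF' n).const_smul ((g n)⁻¹ : ℂ)
    convert h using 1
    · funext m
      rw [mul_smul_comm, mul_smul_comm, smul_smul]
      congr 1
      have h3 : (g n : ℂ) ≠ 0 := Complex.ofReal_ne_zero.2 (hgpos n).ne'
      have h4 : (g (n - m) : ℂ) ≠ 0 := Complex.ofReal_ne_zero.2 (hgpos (n - m)).ne'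
      push_cast
      field_simp
    · by_cases hn : n = 0
      · subst hn; simp [v0, hg0]
      · simp [v0, hn]

theorem weighted_inverse_op {M E : Type*} [AddCommGroup M] [DecidableEq M] [NormedAddCommGroup E]
    [NormedSpace ℂ E] [CompleteSpace E] (g : M → ℝ)
    (hgpos : ∀ n, 0 < g n) (hg0 : g 0 = 1) (hge : ∀ n, 1 ≤ g n)
    (hsub : ∀ m n, g (m + n) ≤ g m * g n)
    (hGRS : ∀ t : M, Tendsto (fun n : ℕ => (g ((n : ℤ) • t)) ^ ((n : ℝ)⁻¹)) atTop (𝓝 1))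
    (f : M → (E →L[ℂ] E)) (hf : Summable fun m => g m * ‖f m‖)
    (hG : ∀ χ : M → ℂ, (∀ m, ‖χ m‖ = 1) → χ 0 = 1 → (∀ m n, χ (m + n) = χ m * χ n) →
      ∃ S : E →L[ℂ] E, ∀ x, HasSum (fun m => χ m • f m (S x)) x) :
    ∃ h : M → (E →L[ℂ] E), (Summable fun n => g n * ‖h n‖) ∧
      ∀ n x, HasSum (fun m => f m (h (n - m) x)) (if n = 0 then x else 0) := by
  obtain ⟨h, h1, h2⟩ := weighted_inverse g hgpos hg0 hsub hGRS f hf (fun χ c1 c2 c3 => by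
    obtain ⟨S, hS⟩ := hG χ c1 c2 c3
    have hs : Summable fun m => χ m • f m := by
      refine Summable.of_norm_bounded hf fun m => ?_
      rw [norm_smul, c1, one_mul]
      exact le_mul_of_one_le_left (norm_nonneg _) (hge m)
    obtain ⟨G, hGs⟩ := hs
    refine ⟨G, S, hGs, ?_⟩
    ext x
    exact (hGs.mapL (ContinuousLinearMap.apply ℂ E (S x))).unique (hS x))
  refine ⟨h, h1, fun n x => ?_⟩
  have h3 := (h2 n).mapL (ContinuousLinearMap.apply ℂ E x)
  have he : (if n = 0 then x else 0) =
      ContinuousLinearMap.apply ℂ E x (if n = 0 then 1 else 0 : E →L[ℂ] E) := by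
    by_cases hn : n = 0 <;> simp [hn]
  rw [he]
  exact h3

theorem conv_inverse_sum {M E : Type*} [AddCommGroup M] [DecidableEq M] [NormedAddCommGroup E]
    [NormedSpace ℂ E] [CompleteSpace E] (f h : M → (E →L[ℂ] E))
    (hf : Summable fun m => ‖f m‖) (hh : Summable fun m => ‖h m‖)
    (hfh : ∀ n x y, HasSum (fun m => f m (h (n - m) x)) y → y = if n = 0 then x else 0)
    (T Tinv : E →L[ℂ] E) (hT : ∀ x, HasSum (fun m => f m x) (T x))
    (hinv : ∀ x, Tinv (T x) = x) (x : E) : HasSum (fun n => h n x) (Tinv x) := by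
  have hhx : Summable fun n => ‖h n‖ * ‖x‖ := hh.mul_right _
  have hs : Summable fun n => h n x :=
    Summable.of_norm_bounded hhx fun n => (h n).le_opNorm x
  obtain ⟨y, hy⟩ := hs
  have hs2 : Summable fun q : M × M => f q.1 (h q.2 x) := by
    refine Summable.of_norm_bounded (hf.mul_of_nonneg hhx (fun _ => norm_nonneg _)
      (fun _ => by positivity)) fun q => ?_
    exact ((f q.1).le_opNorm _).trans
      (mul_le_mul_of_nonneg_left ((h q.2).le_opNorm x) (norm_nonneg _))
  obtain ⟨s, hs2⟩ := hs2
  have e1 : HasSum (fun m => f m y) s := hs2.prod_fiberwise fun m => hy.mapL (f m)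
  have e2 : s = T y := e1.unique (hT y)
  let e : M × M ≃ M × M :=
    { toFun := fun q => (q.2, q.1 - q.2)
      invFun := fun q => (q.1 + q.2, q.1)
      left_inv := fun q => by simp
      right_inv := fun q => by simp }
  have hs3 : HasSum (fun q : M × M => f q.2 (h (q.1 - q.2) x)) s := e.hasSum_iff.2 hs2
  have e3 : HasSum (fun n : M => if n = 0 then x else 0) s := by
    refine hs3.prod_fiberwise fun n => ?_
    have h5 : Summable fun m => f m (h (n - m) x) := hs3.summable.prod_factor n
    obtain ⟨y', hy'⟩ := h5
    rw [← hfh n x y' hy']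
    exact hy'
  have e4 : s = x := e3.unique (hasSum_ite_eq 0 x)
  have e5 : Tinv x = y := by rw [← hinv y, ← e2, e4]
  rw [e5]
  exact hy

theorem s1g_aux {M X : Type*} [AddCommGroup M] [DecidableEq M] (p : ℝ≥0∞) [Fact (1 ≤ p)]
    [NormedAddCommGroup X] [NormedSpace ℂ X] [CompleteSpace X] (g : M → ℝ)
    (hgpos : ∀ n, 0 < g n) (hg0 : g 0 = 1)
    (hsub : ∀ m n, g (m + n) ≤ g m * g n) (hge : ∀ n, 1 ≤ g n)
    (hGRS : ∀ t : M, Tendsto (fun n : ℕ => (g ((n : ℤ) • t)) ^ ((n : ℝ)⁻¹)) atTop (𝓝 1))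
    (T Tinv : lp (fun _ : M => X) p →L[ℂ] lp (fun _ : M => X) p)
    (b : M → M → (X →L[ℂ] X)) (β : M → ℝ) (hβ : ∀ m, 0 ≤ β m) (hβs : Summable fun m => g m * β m)
    (hb : ∀ k m, ‖b k m‖ ≤ β m)
    (hT : ∀ x k, HasSum (fun m => b k m (x (k - m))) (T x k))
    (h1 : ∀ x, T (Tinv x) = x) (h2 : ∀ x, Tinv (T x) = x) :
    ∃ (a : M → M → (X →L[ℂ] X)) (α : M → ℝ),
    (∀ m, 0 ≤ α m) ∧ (Summable fun m => g m * α m) ∧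
    (∀ k m, ‖a k m‖ ≤ α m) ∧
    (∀ x k, HasSum (fun m => a k m (x (k - m))) (Tinv x k)) := by
  choose f hfn hfa using fun m => exists_diag p m (fun k => b k m) (β m) (hβ m) (fun k => hb k m)
  have hfs : Summable fun m => g m * ‖f m‖ :=
    Summable.of_nonneg_of_le (fun m => mul_nonneg (hgpos m).le (ContinuousLinearMap.opNorm_nonneg _))
      (fun m => mul_le_mul_of_nonneg_left (hfn m) (hgpos m).le) hβs
  have hfs1 : Summable fun m => ‖f m‖ :=
    Summable.of_nonneg_of_le (fun m => ContinuousLinearMap.opNorm_nonneg _)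
      (fun m => le_mul_of_one_le_left (ContinuousLinearMap.opNorm_nonneg _) (hge m)) hfs
  have hcoord : ∀ (u : M → lp (fun _ : M => X) p) (s : lp (fun _ : M => X) p) (k : M),
      HasSum u s → HasSum (fun m => u m k) (s k) := fun u s k hu =>
    hu.mapL (lp.evalCLM ℂ (fun _ : M => X) p k)
  have hTs : ∀ x, HasSum (fun m => f m x) (T x) := fun x => by
    have hs : Summable fun m => f m x :=
      Summable.of_norm_bounded (hfs1.mul_right ‖x‖) fun n => (f n).le_opNorm x
    obtain ⟨s, hs⟩ := hs
    have : s = T x := by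
      ext k
      refine (hcoord _ _ k hs).unique ?_
      simpa only [hfa] using hT x k
    rwa [this] at hs
  obtain ⟨h, hhs, hfh⟩ := weighted_inverse_op g hgpos hg0 hge hsub hGRS f hfs (fun χ c1 c2 c3 => by
    have hχ0 : ∀ m, χ m ≠ 0 := fun m hm => by simpa [hm] using c1 m
    have hn : ∀ c : ℂ, ‖c‖ = 1 → ‖c • ContinuousLinearMap.id ℂ X‖ ≤ 1 := fun c hc => by
      rw [norm_smul, hc, one_mul]
      exact ContinuousLinearMap.norm_id_le
    obtain ⟨D, -, hD⟩ := exists_diag p (0 : M) (fun k => χ k • ContinuousLinearMap.id ℂ X) 1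
      zero_le_one (fun k => hn _ (c1 k))
    obtain ⟨D', -, hD'⟩ := exists_diag p (0 : M) (fun k => (χ k)⁻¹ • ContinuousLinearMap.id ℂ X) 1
      zero_le_one (fun k => hn _ (by rw [norm_inv, c1, inv_one]))
    simp only [smul_apply, ContinuousLinearMap.id_apply, sub_zero] at hD hD'
    refine ⟨D.comp (Tinv.comp D'), fun x => ?_⟩
    have h3 := (hTs (Tinv (D' x))).mapL D
    rw [h1] at h3
    have h4 : D (D' x) = x := by
      ext k
      rw [hD, hD', smul_inv_smul₀ (hχ0 k)]
    rw [h4] at h3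
    have he : (fun m => χ m • f m ((D.comp (Tinv.comp D')) x)) =
        fun m => D (f m (Tinv (D' x))) := by
      funext m
      ext k
      change χ m • f m (D (Tinv (D' x))) k = _
      rw [hD, hfa, hfa, hD, map_smul, smul_smul, ← c3, add_sub_cancel]
    rw [he]
    exact h3)
  let a : M → M → (X →L[ℂ] X) := fun k n =>
    (lp.evalCLM ℂ (fun _ : M => X) p k).comp
      ((h n).comp (lp.singleContinuousLinearMap ℂ (fun _ : M => X) p (k - n)))
  have haa : ∀ k n x, a k n x = h n (lp.single p (k - n) x) k := fun k n x => rfl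
  have hp0 : 0 < p := zero_lt_one.trans_le Fact.out
  have han : ∀ k n, ‖a k n‖ ≤ ‖h n‖ := fun k n => by
    refine ContinuousLinearMap.opNorm_le_bound _ (ContinuousLinearMap.opNorm_nonneg _) fun x => ?_
    rw [haa]
    refine (lp.norm_apply_le_norm hp0.ne' _ _).trans (((h n).le_opNorm _).trans ?_)
    rw [lp.norm_single hp0]
  choose h' hhn' hha' using fun n => exists_diag p n (fun k => a k n) ‖h n‖
    (ContinuousLinearMap.opNorm_nonneg _) (fun k => han k n)
  have hhs1 : Summable fun n => ‖h' n‖ :=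
    Summable.of_nonneg_of_le (fun m => ContinuousLinearMap.opNorm_nonneg _)
      (fun m => (hhn' m).trans
        (le_mul_of_one_le_left (ContinuousLinearMap.opNorm_nonneg _) (hge m))) hhs
  have hfin := conv_inverse_sum f h' hfs1 hhs1 (fun n x y hy => by
    ext k
    refine (hcoord _ _ k hy).unique ?_
    have h5 := hcoord _ _ k (hfh n (lp.single p (k - n) (x (k - n))))
    have he : (fun m => f m (h' (n - m) x) k) =
        fun m => f m (h (n - m) (lp.single p (k - n) (x (k - n)))) k := by
      funext m
      rw [hfa, hfa, hha', haa, sub_sub_sub_cancel_right]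
    rw [he]
    convert h5 using 1
    by_cases hn : n = 0
    · subst hn
      simp
    · simp [hn]) T Tinv hTs h2
  refine ⟨a, fun n => ‖h n‖, fun n => ContinuousLinearMap.opNorm_nonneg _, hhs, han, fun x k => ?_⟩
  have h6 := hcoord _ _ k (hfin x)
  simpa only [hha'] using h6

theorem s1g_inverse_closed (c : ℕ) (p : ℝ≥0∞) [Fact (1 ≤ p)]
    {X : Type*} [NormedAddCommGroup X] [NormedSpace ℂ X] [CompleteSpace X]
    (g : (Fin c → ℤ) → ℝ)
    (hgpos : ∀ n, 0 < g n) (hg0 : g 0 = 1)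
    (hsub : ∀ m n, g (m + n) ≤ g m * g n) (hsymm : ∀ n, g (-n) = g n)
    (hge : ∀ n, 1 ≤ g n)
    (hGRS : ∀ t : Fin c → ℤ,
      Tendsto (fun n : ℕ => (g ((n : ℤ) • t)) ^ ((n : ℝ)⁻¹)) atTop (𝓝 1))
    (T Tinv : lp (fun _ : Fin c → ℤ => X) p →L[ℂ] lp (fun _ : Fin c → ℤ => X) p)
    (hT : MemS1g c p g T)
    (h1 : T * Tinv = 1) (h2 : Tinv * T = 1) :
    MemS1g c p g Tinv := by
  classical
  obtain ⟨b, β, hβ, hβs, hb, hTs⟩ := hT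
  exact s1g_aux p g hgpos hg0 hsub hge hGRS T Tinv b β hβ hβs hb hTs
    (fun x => congrArg (fun S : lp (fun _ : Fin c → ℤ => X) p →L[ℂ] lp (fun _ : Fin c → ℤ => X) p =>
      S x) h1)
    (fun x => congrArg (fun S : lp (fun _ : Fin c → ℤ => X) p →L[ℂ] lp (fun _ : Fin c → ℤ => X) p =>
      S x) h2)
end

section
/- Let X be a complex Banach space, g a weight on ℤ^c satisfying (a)–(e), and 1 ≤ p ≤ ∞. Let K and T be bounded operators on l_p(ℤ^c,X) given by (Kx)_k = Σ_m a_{km} x_{k−m} and (Tx)_k = Σ_m b_{km} x_{k−m}, where each a_{km} is nuclear with ‖a_{km}‖_{𝔖₁} ≤ α_m, each b_{km} ∈ B(X) with ‖b_{km}‖ ≤ β_m, and α, β ∈ l_{1,g}(ℤ^c,ℂ). Then the composition KT has the representation (KTx)_k = Σ_{r∈ℤ^c} c_{kr} x_{k−r}, where for each k,r the series c_{kr} = Σ_{m∈ℤ^c} a_{km} b_{k−m,r−m} converges absolutely in the nuclear norm, each c_{kr} is nuclear, and ‖c_{kr}‖_{𝔖₁} ≤ (α∗β)_r, with α∗β ∈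 l_{1,g}(ℤ^c,ℂ). The analogous statement holds for TK. Hence the locally nuclear operators s_{1,g}(ℤ^c,𝔖₁(X)) form a two-sided ideal in the algebra s_{1,g}(ℤ^c,B(X)). -/
open scoped ENNReal Topology

/-- `A` has a nuclear representation `Ax = ∑ i, a i x • y i` with
`∑ i, ‖a i‖ * ‖y i‖ < ∞`. -/
def NuclearRep {X : Type*} [NormedAddCommGroup X] [NormedSpace ℂ X]
    (A : X →L[ℂ] X) (a : ℕ → (X →L[ℂ] ℂ)) (y : ℕ → X) : Prop :=
  Summable (fun i => ‖a i‖ * ‖y i‖) ∧ ∀ x : X, HasSum (fun i => a i x • y i) (A x)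

/-- A bounded linear operator is nuclear if it admits a nuclear representation. -/
def IsNuclear {X : Type*} [NormedAddCommGroup X] [NormedSpace ℂ X]
    (A : X →L[ℂ] X) : Prop :=
  ∃ a y, NuclearRep A a y

/-- The nuclear norm `‖A‖_{𝔖₁}`: the infimum of `∑ i, ‖a i‖ * ‖y i‖` over all nuclear
representations of `A`. -/
noncomputable def nuclearNorm {X : Type*} [NormedAddCommGroup X] [NormedSpace ℂ X]
    (A : X →L[ℂ] X) : ℝ :=
  sInf {r | ∃ a y, NuclearRep A a y ∧ r = ∑' i, ‖a i‖ * ‖y i‖}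

lemma nuc_bdd {X : Type*} [NormedAddCommGroup X] [NormedSpace ℂ X] (A : X →L[ℂ] X) :
    BddBelow {r : ℝ | ∃ a y, NuclearRep A a y ∧ r = ∑' i, ‖a i‖ * ‖y i‖} := by
  refine ⟨0, ?_⟩
  rintro r ⟨a, y, -, rfl⟩
  exact tsum_nonneg fun i => by positivity

lemma nuc_nonneg {X : Type*} [NormedAddCommGroup X] [NormedSpace ℂ X] (A : X →L[ℂ] X) :
    0 ≤ nuclearNorm A := by
  apply Real.sInf_nonneg
  rintro r ⟨a, y, -, rfl⟩
  exact tsum_nonneg fun i => by positivity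

lemma nuc_le {X : Type*} [NormedAddCommGroup X] [NormedSpace ℂ X] {A : X →L[ℂ] X}
    {a : ℕ → (X →L[ℂ] ℂ)} {y : ℕ → X} (h : NuclearRep A a y) :
    nuclearNorm A ≤ ∑' i, ‖a i‖ * ‖y i‖ :=
  csInf_le (nuc_bdd A) ⟨a, y, h, rfl⟩

lemma nuc_exists {X : Type*} [NormedAddCommGroup X] [NormedSpace ℂ X] {A : X →L[ℂ] X}
    (h : IsNuclear A) {ε : ℝ} (hε : 0 < ε) :
    ∃ a y, NuclearRep A a y ∧ ∑' i, ‖a i‖ * ‖y i‖ < nuclearNorm A + ε := by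
  obtain ⟨a₀, y₀, h₀⟩ := h
  obtain ⟨r, ⟨a, y, hr, rfl⟩, hlt⟩ := exists_lt_of_csInf_lt
    (s := {r : ℝ | ∃ a y, NuclearRep A a y ∧ r = ∑' i, ‖a i‖ * ‖y i‖})
    ⟨_, a₀, y₀, h₀, rfl⟩ (lt_add_of_pos_right (nuclearNorm A) hε)
  exact ⟨a, y, hr, hlt⟩

lemma norm_le_nuc {X : Type*} [NormedAddCommGroup X] [NormedSpace ℂ X] {A : X →L[ℂ] X}
    (h : IsNuclear A) : ‖A‖ ≤ nuclearNorm A := by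
  refine le_of_forall_pos_le_add fun ε hε => ?_
  obtain ⟨a, y, ⟨hs, hr⟩, hlt⟩ := nuc_exists h hε
  refine le_trans ?_ hlt.le
  refine A.opNorm_le_bound (tsum_nonneg fun i => by positivity) fun x => ?_
  rw [← (hr x).tsum_eq, ← tsum_mul_right]
  refine tsum_of_norm_bounded (hs.mul_right ‖x‖).hasSum fun i => ?_
  rw [norm_smul]
  calc ‖a i x‖ * ‖y i‖ ≤ (‖a i‖ * ‖x‖) * ‖y i‖ := by gcongr; exact (a i).le_opNorm x
    _ = _ := by ring

lemma nuc_comp_right {X : Type*} [NormedAddCommGroup X] [NormedSpace ℂ X] {A : X →L[ℂ] X}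
    (h : IsNuclear A) (B : X →L[ℂ] X) :
    IsNuclear (A.comp B) ∧ nuclearNorm (A.comp B) ≤ nuclearNorm A * ‖B‖ := by
  have key : ∀ a y, NuclearRep A a y → NuclearRep (A.comp B) (fun i => (a i).comp B) y ∧
      ∑' i, ‖(a i).comp B‖ * ‖y i‖ ≤ (∑' i, ‖a i‖ * ‖y i‖) * ‖B‖ := by
    rintro a y ⟨hs, hr⟩
    have hb : ∀ i, ‖(a i).comp B‖ * ‖y i‖ ≤ (‖a i‖ * ‖y i‖) * ‖B‖ := fun i => by
      calc _ ≤ (‖a i‖ * ‖B‖) * ‖y i‖ := by gcongr; exact (a i).opNorm_comp_le B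
        _ = _ := by ring
    have hs' : Summable fun i => ‖(a i).comp B‖ * ‖y i‖ :=
      Summable.of_nonneg_of_le (fun i => by positivity) hb (hs.mul_right ‖B‖)
    refine ⟨⟨hs', fun x => by simpa using hr (B x)⟩, ?_⟩
    rw [← tsum_mul_right]
    exact hs'.tsum_le_tsum hb (hs.mul_right ‖B‖)
  constructor
  · obtain ⟨a, y, h⟩ := h
    exact ⟨_, _, (key a y h).1⟩
  · refine le_of_forall_pos_le_add fun ε hε => ?_
    obtain ⟨a, y, hr, hlt⟩ := nuc_exists h (show 0 < ε / (‖B‖ + 1) by positivity)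
    obtain ⟨h1, h2⟩ := key a y hr
    calc _ ≤ _ := nuc_le h1
      _ ≤ _ := h2
      _ ≤ (nuclearNorm A + ε / (‖B‖ + 1)) * ‖B‖ := by gcongr
      _ = nuclearNorm A * ‖B‖ + ε * (‖B‖ / (‖B‖ + 1)) := by ring
      _ ≤ nuclearNorm A * ‖B‖ + ε * 1 := by
        gcongr
        exact div_le_one_of_le₀ (by linarith) (by positivity)
      _ = _ := by ring

lemma nuc_comp_left {X : Type*} [NormedAddCommGroup X] [NormedSpace ℂ X] {A : X →L[ℂ] X}
    (h : IsNuclear A) (B : X →L[ℂ] X) :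
    IsNuclear (B.comp A) ∧ nuclearNorm (B.comp A) ≤ ‖B‖ * nuclearNorm A := by
  have key : ∀ a y, NuclearRep A a y → NuclearRep (B.comp A) a (fun i => B (y i)) ∧
      ∑' i, ‖a i‖ * ‖B (y i)‖ ≤ ‖B‖ * (∑' i, ‖a i‖ * ‖y i‖) := by
    rintro a y ⟨hs, hr⟩
    have hb : ∀ i, ‖a i‖ * ‖B (y i)‖ ≤ ‖B‖ * (‖a i‖ * ‖y i‖) := fun i => by
      calc _ ≤ ‖a i‖ * (‖B‖ * ‖y i‖) := by gcongr; exact B.le_opNorm _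
        _ = _ := by ring
    have hs' : Summable fun i => ‖a i‖ * ‖B (y i)‖ :=
      Summable.of_nonneg_of_le (fun i => by positivity) hb (hs.mul_left ‖B‖)
    refine ⟨⟨hs', fun x => by simpa using B.hasSum (hr x)⟩, ?_⟩
    rw [← tsum_mul_left]
    exact hs'.tsum_le_tsum hb (hs.mul_left ‖B‖)
  constructor
  · obtain ⟨a, y, h⟩ := h
    exact ⟨_, _, (key a y h).1⟩
  · refine le_of_forall_pos_le_add fun ε hε => ?_
    obtain ⟨a, y, hr, hlt⟩ := nuc_exists h (show 0 < ε / (‖B‖ + 1) by positivity)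
    obtain ⟨h1, h2⟩ := key a y hr
    calc _ ≤ _ := nuc_le h1
      _ ≤ _ := h2
      _ ≤ ‖B‖ * (nuclearNorm A + ε / (‖B‖ + 1)) := by gcongr
      _ = ‖B‖ * nuclearNorm A + ε * (‖B‖ / (‖B‖ + 1)) := by ring
      _ ≤ ‖B‖ * nuclearNorm A + ε * 1 := by
        gcongr
        exact div_le_one_of_le₀ (by linarith) (by positivity)
      _ = _ := by ring

lemma nuc_series {ι : Type*} [Countable ι] [Nonempty ι]
    {X : Type*} [NormedAddCommGroup X] [NormedSpace ℂ X] [CompleteSpace X]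
    {A : ι → X →L[ℂ] X} {S : X →L[ℂ] X} {γ : ι → ℝ} (hN : ∀ i, IsNuclear (A i))
    (hγ : ∀ i, nuclearNorm (A i) ≤ γ i) (hs : Summable γ) (hS : HasSum A S) :
    IsNuclear S ∧ nuclearNorm S ≤ ∑' i, γ i := by
  have key : ∀ ε > 0, ∃ a y, NuclearRep S a y ∧ ∑' i, ‖a i‖ * ‖y i‖ ≤ (∑' i, γ i) + ε := by
    intro ε hε
    haveI := Encodable.ofCountable ι
    obtain ⟨δ, hδ, d, hd, hdε⟩ := posSumOfEncodable hε ι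
    choose a y hr hlt using fun i => nuc_exists (hN i) (hδ i)
    obtain ⟨_⟩ := nonempty_denumerable (ι × ℕ)
    let e : ℕ ≃ ι × ℕ := (Denumerable.eqv (ι × ℕ)).symm
    have hle : ∀ i, ∑' j, ‖a i j‖ * ‖y i j‖ ≤ γ i + δ i := fun i =>
      (hlt i).le.trans (by linarith [hγ i])
    have hsi : Summable fun i => ∑' j, ‖a i j‖ * ‖y i j‖ :=
      Summable.of_nonneg_of_le (fun i => tsum_nonneg fun j => by positivity) hle
        (hs.add hd.summable)
    have hsp : Summable fun q : ι × ℕ => ‖a q.1 q.2‖ * ‖y q.1 q.2‖ := by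
      rw [summable_prod_of_nonneg (fun q => by positivity)]
      exact ⟨fun i => (hr i).1, hsi⟩
    have hsum : ∑' q : ι × ℕ, ‖a q.1 q.2‖ * ‖y q.1 q.2‖ ≤ (∑' i, γ i) + ε := by
      rw [hsp.tsum_prod]
      calc _ ≤ ∑' i, (γ i + δ i) := hsi.tsum_le_tsum hle (hs.add hd.summable)
        _ = (∑' i, γ i) + d := by rw [hs.tsum_add hd.summable, hd.tsum_eq]
        _ ≤ _ := by gcongr
    refine ⟨fun n => a (e n).1 (e n).2, fun n => y (e n).1 (e n).2, ⟨?_, fun x => ?_⟩, ?_⟩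
    · exact e.summable_iff.2 hsp
    · have h1 : Summable fun q : ι × ℕ => a q.1 q.2 x • y q.1 q.2 := by
        refine Summable.of_norm_bounded (hsp.mul_right ‖x‖) fun q => ?_
        rw [norm_smul]
        calc _ ≤ (‖a q.1 q.2‖ * ‖x‖) * ‖y q.1 q.2‖ := by
              gcongr; exact (a q.1 q.2).le_opNorm x
          _ = _ := by ring
      have h2 : HasSum (fun i => A i x) (∑' q : ι × ℕ, a q.1 q.2 x • y q.1 q.2) :=
        h1.hasSum.prod_fiberwise fun i => (hr i).2 x
      have h3 : HasSum (fun i => A i x) (S x) :=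
        (ContinuousLinearMap.apply ℂ X x).hasSum hS
      rw [h3.unique h2]
      exact e.hasSum_iff.2 h1.hasSum
    · exact (e.tsum_eq (fun q : ι × ℕ => ‖a q.1 q.2‖ * ‖y q.1 q.2‖)).trans_le hsum
  constructor
  · obtain ⟨a, y, h, -⟩ := key 1 one_pos
    exact ⟨a, y, h⟩
  · refine le_of_forall_pos_le_add fun ε hε => ?_
    obtain ⟨a, y, h, h'⟩ := key ε hε
    exact (nuc_le h).trans h'

/-- The shear `(r, m) ↦ (m, r - m)`. -/
def shearEquiv (G : Type*) [AddCommGroup G] : G × G ≃ G × G where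
  toFun q := (q.2, q.1 - q.2)
  invFun q := (q.1 + q.2, q.1)
  left_inv q := by simp
  right_inv q := by simp

lemma conv_shear {G : Type*} [AddCommGroup G] {α β : G → ℝ}
    (hα : Summable α) (hβ : Summable β) (hα0 : ∀ m, 0 ≤ α m) (hβ0 : ∀ m, 0 ≤ β m) :
    Summable fun q : G × G => α q.2 * β (q.1 - q.2) :=
  (shearEquiv G).summable_iff.2 (hα.mul_of_nonneg hβ hα0 hβ0)

lemma half {c : ℕ} {p : ℝ≥0∞} [Fact (1 ≤ p)]
    {X : Type*} [NormedAddCommGroup X] [NormedSpace ℂ X] [CompleteSpace X]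
    (K T : lp (fun _ : Fin c → ℤ => X) p →L[ℂ] lp (fun _ : Fin c → ℤ => X) p)
    (a b : (Fin c → ℤ) → (Fin c → ℤ) → (X →L[ℂ] X)) (α β : (Fin c → ℤ) → ℝ)
    (hα0 : ∀ m, 0 ≤ α m) (hβ0 : ∀ m, 0 ≤ β m)
    (hα : Summable α) (hβ : Summable β)
    (haB : ∀ k m, ‖a k m‖ ≤ α m) (hbB : ∀ k m, ‖b k m‖ ≤ β m)
    (hN : ∀ k m j n, IsNuclear ((a k m).comp (b j n)))
    (hB : ∀ k m j n, nuclearNorm ((a k m).comp (b j n)) ≤ α m * β n)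
    (hK : ∀ x k, HasSum (fun m => a k m (x (k - m))) (K x k))
    (hT : ∀ x k, HasSum (fun m => b k m (x (k - m))) (T x k)) :
    (∃ cc : (Fin c → ℤ) → (Fin c → ℤ) → (X →L[ℂ] X),
      (∀ k r, Summable fun m => nuclearNorm ((a k m).comp (b (k - m) (r - m)))) ∧
      (∀ k r, HasSum (fun m => (a k m).comp (b (k - m) (r - m))) (cc k r)) ∧
      (∀ k r, IsNuclear (cc k r)) ∧
      (∀ k r, nuclearNorm (cc k r) ≤ ∑' m, α m * β (r - m)) ∧
      (∀ x k, HasSum (fun r => cc k r (x (k - r))) ((K * T) x k))) := by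
  have hsh := conv_shear hα hβ hα0 hβ0
  have hs : ∀ r, Summable fun m => α m * β (r - m) := fun r => hsh.prod_factor r
  have hnb : ∀ k m j n, ‖(a k m).comp (b j n)‖ ≤ α m * β n := fun k m j n =>
    (norm_le_nuc (hN k m j n)).trans (hB k m j n)
  have hsum : ∀ k r, HasSum (fun m => (a k m).comp (b (k - m) (r - m)))
      (∑' m, (a k m).comp (b (k - m) (r - m))) := fun k r =>
    (Summable.of_norm_bounded (hs r) fun m => hnb _ _ _ _).hasSum
  refine ⟨fun k r => ∑' m, (a k m).comp (b (k - m) (r - m)), fun k r => ?_, hsum,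
    fun k r => ?_, fun k r => ?_, fun x k => ?_⟩
  · exact Summable.of_nonneg_of_le (fun m => nuc_nonneg _) (fun m => hB _ _ _ _) (hs r)
  · exact (nuc_series (fun m => hN _ _ _ _) (fun m => hB _ _ _ _) (hs r) (hsum k r)).1
  · exact (nuc_series (fun m => hN _ _ _ _) (fun m => hB _ _ _ _) (hs r) (hsum k r)).2
  · have hp : p ≠ 0 := (zero_lt_one.trans_le (Fact.out : 1 ≤ p)).ne'
    let F : (Fin c → ℤ) × (Fin c → ℤ) → X := fun q =>
      a k q.1 (b (k - q.1) q.2 (x (k - q.1 - q.2)))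
    have hF : Summable F := by
      refine Summable.of_norm_bounded ((hα.mul_of_nonneg hβ hα0 hβ0).mul_right ‖x‖) fun q => ?_
      calc ‖F q‖ ≤ ‖(a k q.1).comp (b (k - q.1) q.2)‖ * ‖x (k - q.1 - q.2)‖ :=
            ((a k q.1).comp (b (k - q.1) q.2)).le_opNorm _
        _ ≤ (α q.1 * β q.2) * ‖x‖ := by
            gcongr
            · exact mul_nonneg (hα0 _) (hβ0 _)
            · exact hnb _ _ _ _
            · exact lp.norm_apply_le_norm hp x _
    have h1 : HasSum (fun m => a k m (T x (k - m))) (∑' q, F q) :=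
      hF.hasSum.prod_fiberwise fun m => (a k m).hasSum (hT x (k - m))
    have h2 : (K * T) x k = ∑' q, F q := (hK (T x) k).unique h1
    rw [h2]
    have h3 : HasSum (F ∘ shearEquiv (Fin c → ℤ)) (∑' q, F q) :=
      (shearEquiv (Fin c → ℤ)).hasSum_iff.2 hF.hasSum
    refine h3.prod_fiberwise fun r => ?_
    have h4 := (ContinuousLinearMap.apply ℂ X (x (k - r))).hasSum (hsum k r)
    convert h4 using 2 with m
    · simp [F, shearEquiv]
    · rfl

/-- Locally nuclear operators form a two-sided ideal in `s_{1,g}(ℤ^c, B(X))`: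
compositions `KT` and `TK` of a locally nuclear `K` (coefficients `a_{km}` nuclear,
`‖a_{km}‖_{𝔖₁} ≤ α_m`) with `T ∈ s_{1,g}` (coefficients `b_{km}`, `‖b_{km}‖ ≤ β_m`)
have matrix coefficients given by absolutely (in nuclear norm) convergent series,
which are nuclear with nuclear norms dominated by the convolution `α ∗ β ∈ l_{1,g}`. -/
theorem locally_nuclear_ideal (c : ℕ) (p : ℝ≥0∞) [Fact (1 ≤ p)]
    {X : Type*} [NormedAddCommGroup X] [NormedSpace ℂ X] [CompleteSpace X]
    (g : (Fin c → ℤ) → ℝ)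
    (hgpos : ∀ n, 0 < g n) (hg0 : g 0 = 1)
    (hsub : ∀ m n, g (m + n) ≤ g m * g n) (hsymm : ∀ n, g (-n) = g n)
    (hge : ∀ n, 1 ≤ g n)
    (hGRS : ∀ t : Fin c → ℤ,
      Filter.Tendsto (fun n : ℕ => (g ((n : ℤ) • t)) ^ ((n : ℝ)⁻¹))
        Filter.atTop (𝓝 1))
    (K T : lp (fun _ : Fin c → ℤ => X) p →L[ℂ] lp (fun _ : Fin c → ℤ => X) p)
    (a b : (Fin c → ℤ) → (Fin c → ℤ) → (X →L[ℂ] X)) (α β : (Fin c → ℤ) → ℝ)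
    (hα0 : ∀ m, 0 ≤ α m) (hβ0 : ∀ m, 0 ≤ β m)
    (hαsum : Summable fun m => g m * α m) (hβsum : Summable fun m => g m * β m)
    (haN : ∀ k m, IsNuclear (a k m)) (haB : ∀ k m, nuclearNorm (a k m) ≤ α m)
    (hbB : ∀ k m, ‖b k m‖ ≤ β m)
    (hK : ∀ x k, HasSum (fun m => a k m (x (k - m))) (K x k))
    (hT : ∀ x k, HasSum (fun m => b k m (x (k - m))) (T x k)) :
    (Summable fun r => g r * ∑' m, α m * β (r - m)) ∧
    (∃ cc : (Fin c → ℤ) → (Fin c → ℤ) → (X →L[ℂ] X),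
      (∀ k r, Summable fun m => nuclearNorm ((a k m).comp (b (k - m) (r - m)))) ∧
      (∀ k r, HasSum (fun m => (a k m).comp (b (k - m) (r - m))) (cc k r)) ∧
      (∀ k r, IsNuclear (cc k r)) ∧
      (∀ k r, nuclearNorm (cc k r) ≤ ∑' m, α m * β (r - m)) ∧
      (∀ x k, HasSum (fun r => cc k r (x (k - r))) ((K * T) x k))) ∧
    (∃ dd : (Fin c → ℤ) → (Fin c → ℤ) → (X →L[ℂ] X),
      (∀ k r, Summable fun m => nuclearNorm ((b k m).comp (a (k - m) (r - m)))) ∧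
      (∀ k r, HasSum (fun m => (b k m).comp (a (k - m) (r - m))) (dd k r)) ∧
      (∀ k r, IsNuclear (dd k r)) ∧
      (∀ k r, nuclearNorm (dd k r) ≤ ∑' m, β m * α (r - m)) ∧
      (∀ x k, HasSum (fun r => dd k r (x (k - r))) ((T * K) x k))) := by
  have hα : Summable α := Summable.of_nonneg_of_le hα0
    (fun m => le_mul_of_one_le_left (hα0 m) (hge m)) hαsum
  have hβ : Summable β := Summable.of_nonneg_of_le hβ0
    (fun m => le_mul_of_one_le_left (hβ0 m) (hge m)) hβsum
  have haB' : ∀ k m, ‖a k m‖ ≤ α m := fun k m => (norm_le_nuc (haN k m)).trans (haB k m)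
  refine ⟨?_, ?_, ?_⟩
  · have h1 := conv_shear hαsum hβsum (fun m => mul_nonneg (hgpos m).le (hα0 m))
      (fun m => mul_nonneg (hgpos m).le (hβ0 m))
    have h2 : Summable fun q : (Fin c → ℤ) × (Fin c → ℤ) =>
        g q.1 * (α q.2 * β (q.1 - q.2)) := by
      refine Summable.of_nonneg_of_le
        (fun q => mul_nonneg (hgpos _).le (mul_nonneg (hα0 _) (hβ0 _))) (fun q => ?_) h1
      have h3 := hsub q.2 (q.1 - q.2)
      rw [add_sub_cancel] at h3
      calc _ ≤ (g q.2 * g (q.1 - q.2)) * (α q.2 * β (q.1 - q.2)) :=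
            mul_le_mul_of_nonneg_right h3 (mul_nonneg (hα0 _) (hβ0 _))
        _ = _ := by ring
    simpa only [tsum_mul_left] using h2.prod
  · refine half K T a b α β hα0 hβ0 hα hβ haB' hbB (fun k m j n => (nuc_comp_right (haN k m) _).1)
      (fun k m j n => (nuc_comp_right (haN k m) _).2.trans ?_) hK hT
    exact mul_le_mul (haB k m) (hbB j n) (norm_nonneg _) (hα0 m)
  · refine half T K b a β α hβ0 hα0 hβ hα hbB haB' (fun k m j n => (nuc_comp_left (haN j n) _).1)
      (fun k m j n => (nuc_comp_left (haN j n) _).2.trans ?_) hT hK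
    exact mul_le_mul (hbB k m) (haB j n) (nuc_nonneg _) (hβ0 m)
end

section
/- Let 1 ≤ p < ∞ and let g be a weight on ℤ^c satisfying assumptions (a)–(e). Then for each locally nuclear operator A ∈ S_{1,g}(ℝ^c,𝔖₁) acting on L_p(ℝ^c,ℂ) there exists a measurable function n : ℝ^c × ℝ^c → ℂ such that for every x ∈ L_p(ℝ^c,ℂ), for almost all t ∈ ℝ^c the integral ∫_{ℝ^c} n(t,s)x(s)ds exists and (Ax)(t) = ∫_{ℝ^c} n(t,s)x(s)ds. -/
open MeasureTheory
open scoped ENNReal Topology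

/-- `T` is a locally nuclear operator on `l_p(ℤ^c, X)`. -/
def IsLocallyNuclear (c : ℕ) (p : ℝ≥0∞) [Fact (1 ≤ p)] {X : Type*}
    [NormedAddCommGroup X] [NormedSpace ℂ X] (g : (Fin c → ℤ) → ℝ)
    (T : lp (fun _ : Fin c → ℤ => X) p →L[ℂ] lp (fun _ : Fin c → ℤ => X) p) : Prop :=
  ∃ (b : (Fin c → ℤ) → (Fin c → ℤ) → (X →L[ℂ] X)) (β : (Fin c → ℤ) → ℝ),
    (∀ m, 0 ≤ β m) ∧ (Summable fun m => g m * β m) ∧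
    (∀ k m, IsNuclear (b k m)) ∧ (∀ k m, nuclearNorm (b k m) ≤ β m) ∧
    (∀ x k, HasSum (fun m => b k m (x (k - m))) (T x k))

/-- The unit cube `[0,1)^c` in `ℝ^c`. -/
def unitCube (c : ℕ) : Set (Fin c → ℝ) := Set.univ.pi fun _ => Set.Ico (0 : ℝ) 1


lemma aux_hasSum_indicator {α : Type*} [MeasurableSpace α] {μ : Measure α} [IsFiniteMeasure μ]
    {p : ℝ≥0∞} [Fact (1 ≤ p)] (hp : p ≠ ∞) {f : ℕ → Set α} (hf : ∀ i, MeasurableSet (f i))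
    (hd : Pairwise (Function.onFun Disjoint f)) :
    HasSum (fun i => indicatorConstLp p (hf i) (measure_ne_top μ _) (1 : ℂ))
      (indicatorConstLp p (MeasurableSet.iUnion hf) (measure_ne_top μ _) (1 : ℂ)) := by
  have hb : ∀ s : Finset ℕ, MeasurableSet (⋃ i ∈ s, f i) := fun s =>
    s.measurableSet_biUnion fun i _ => hf i
  have key : ∀ s : Finset ℕ, ∑ i ∈ s, indicatorConstLp p (hf i) (measure_ne_top μ _) (1 : ℂ)
      = indicatorConstLp p (hb s) (measure_ne_top μ _) (1 : ℂ) := by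
    intro s
    apply Lp.ext
    have h1 : ∀ᵐ x ∂μ, ∀ i, indicatorConstLp p (hf i) (measure_ne_top μ _) (1 : ℂ) x
        = (f i).indicator (fun _ => (1 : ℂ)) x := ae_all_iff.2 fun i => indicatorConstLp_coeFn
    filter_upwards [h1, Lp.coeFn_fun_finsetSum s
      (fun i => indicatorConstLp p (hf i) (measure_ne_top μ _) (1 : ℂ)),
      indicatorConstLp_coeFn (p := p) (hs := hb s) (hμs := measure_ne_top μ _) (c := (1 : ℂ))]
      with x h1 h2 h3
    rw [h2, h3, Finset.indicator_biUnion_apply]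
    · exact Finset.sum_congr rfl fun i _ => h1 i
    · intro i _ j _ hij
      exact hd hij
  unfold HasSum
  simp_rw [key]
  apply tendsto_indicatorConstLp_set hp
  have e : ∀ s : Finset ℕ, μ (symmDiff (⋃ i ∈ s, f i) (⋃ i, f i))
      = μ (⋃ i, f i) - ∑ i ∈ s, μ (f i) := by
    intro s
    have hsub : (⋃ i ∈ s, f i) ⊆ ⋃ i, f i := Set.iUnion₂_subset_iUnion _ _
    rw [symmDiff_of_le hsub, measure_sdiff hsub (hb s).nullMeasurableSet (measure_ne_top _ _),
      measure_biUnion_finset (fun i _ j _ hij => hd hij) (fun i _ => hf i)]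
  simp_rw [e]
  have h2 : HasSum (fun i => μ (f i)) (μ (⋃ i, f i)) := by
    rw [measure_iUnion hd hf]; exact ENNReal.summable.hasSum
  have h3 := ENNReal.Tendsto.sub (tendsto_const_nhds (x := μ (⋃ i, f i))
    (f := (SummationFilter.unconditional ℕ).filter)) h2 (Or.inl (measure_ne_top _ _))
  simpa using h3

lemma aux_density {α : Type*} [MeasurableSpace α] {μ : Measure α} [IsFiniteMeasure μ]
    {p : ℝ≥0∞} [Fact (1 ≤ p)] (hp : p ≠ ∞) (l : Lp ℂ p μ →L[ℝ] ℝ) :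
    ∃ f : α → ℝ, Integrable f μ ∧ ∀ E, ∀ hE : MeasurableSet E,
      l (indicatorConstLp p hE (measure_ne_top μ _) (1 : ℂ)) = ∫ x in E, f x ∂μ := by
  classical
  let ν : SignedMeasure α :=
    { measureOf' := fun E => if hE : MeasurableSet E then
        l (indicatorConstLp p hE (measure_ne_top μ _) (1 : ℂ)) else 0
      empty' := by simp
      not_measurable' := fun E hE => by simp [hE]
      m_iUnion' := fun f hf hd => by
        have := (aux_hasSum_indicator (μ := μ) hp hf hd).mapL l
        simpa [hf, MeasurableSet.iUnion hf] using this }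
  have hν : ∀ E, ∀ hE : MeasurableSet E,
      ν E = l (indicatorConstLp p hE (measure_ne_top μ _) (1 : ℂ)) := by
    intro E hE
    change (if hE : MeasurableSet E then
        l (indicatorConstLp p hE (measure_ne_top μ _) (1 : ℂ)) else 0) = _
    simp [hE]
  have hac : ν ≪ᵥ μ.toENNRealVectorMeasure := by
    apply VectorMeasure.AbsolutelyContinuous.mk
    intro E hE h0
    rw [Measure.toENNRealVectorMeasure_apply_measurable hE] at h0
    rw [hν E hE]
    have : indicatorConstLp p hE (measure_ne_top μ _) (1 : ℂ) = 0 := by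
      rw [← norm_eq_zero, norm_indicatorConstLp (one_pos.trans_le Fact.out).ne' hp]
      have : p.toReal ≠ 0 := (ENNReal.toReal_pos (one_pos.trans_le Fact.out).ne' hp).ne'
      simp [Measure.real, h0, this]
    rw [this, map_zero]
  refine ⟨ν.rnDeriv μ, SignedMeasure.integrable_rnDeriv _ _, fun E hE => ?_⟩
  rw [← hν E hE, ← withDensityᵥ_apply (SignedMeasure.integrable_rnDeriv _ _) hE,
    SignedMeasure.withDensityᵥ_rnDeriv_eq ν μ hac]

lemma aux_ext {α : Type*} [MeasurableSpace α] {μ : Measure α} [IsFiniteMeasure μ]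
    {p : ℝ≥0∞} [Fact (1 ≤ p)] (hp : p ≠ ∞) (l k : Lp ℂ p μ →L[ℂ] ℂ)
    (h : ∀ E, ∀ hE : MeasurableSet E,
      l (indicatorConstLp p hE (measure_ne_top μ _) (1 : ℂ)) =
      k (indicatorConstLp p hE (measure_ne_top μ _) (1 : ℂ))) : l = k := by
  ext x
  induction x using Lp.induction hp with
  | @indicatorConst c E hs hμs =>
    rw [Lp.simpleFunc.coe_indicatorConst]
    have : indicatorConstLp p hs hμs.ne c = c • indicatorConstLp p hs hμs.ne (1 : ℂ) := by
      apply Lp.ext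
      filter_upwards [indicatorConstLp_coeFn (p := p) (hs := hs) (hμs := hμs.ne) (c := c),
        indicatorConstLp_coeFn (p := p) (hs := hs) (hμs := hμs.ne) (c := (1 : ℂ)),
        Lp.coeFn_smul c (indicatorConstLp p hs hμs.ne (1 : ℂ))] with x h1 h2 h3
      rw [h1, h3, Pi.smul_apply, h2]
      by_cases hx : x ∈ E <;> simp [Set.indicator, hx]
    rw [this, map_smul, map_smul, h]
  | add hf hg hd h1 h2 => rw [map_add, map_add, h1, h2]
  | isClosed => exact isClosed_eq l.continuous k.continuous

lemma aux_density_c {α : Type*} [MeasurableSpace α] {μ : Measure α} [IsFiniteMeasure μ]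
    {p : ℝ≥0∞} [Fact (1 ≤ p)] (hp : p ≠ ∞) (l : Lp ℂ p μ →L[ℂ] ℂ) :
    ∃ f : α → ℂ, Measurable f ∧ Integrable f μ ∧ ∀ E, ∀ hE : MeasurableSet E,
      l (indicatorConstLp p hE (measure_ne_top μ _) (1 : ℂ)) = ∫ x in E, f x ∂μ := by
  obtain ⟨f, hf, hf'⟩ := aux_density hp (Complex.reCLM.comp (l.restrictScalars ℝ))
  obtain ⟨g, hg, hg'⟩ := aux_density hp (Complex.imCLM.comp (l.restrictScalars ℝ))
  have hi : Integrable (fun x => (f x : ℂ) + (g x : ℂ) * Complex.I) μ :=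
    hf.ofReal.add (hg.ofReal.mul_const _)
  refine ⟨hi.1.mk _, hi.1.stronglyMeasurable_mk.measurable, hi.congr hi.1.ae_eq_mk, ?_⟩
  intro E hE
  rw [← setIntegral_congr_ae hE (hi.1.ae_eq_mk.mono fun x hx _ => hx)]
  have i1 : Integrable (fun x => (f x : ℂ)) (μ.restrict E) := hf.ofReal.integrableOn
  have i2 : Integrable (fun x => (g x : ℂ) * Complex.I) (μ.restrict E) :=
    (hg.ofReal.mul_const _).integrableOn
  rw [integral_add i1 i2,
    integral_mul_const, integral_complex_ofReal, integral_complex_ofReal, ← hf' E hE, ← hg' E hE]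
  simp

lemma aux_dual {α : Type*} [MeasurableSpace α] {μ : Measure α} [IsFiniteMeasure μ]
    {p : ℝ≥0∞} [Fact (1 ≤ p)] (hp : p ≠ ∞) (a : Lp ℂ p μ →L[ℂ] ℂ) :
    ∃ h : α → ℂ, Measurable h ∧ ∀ x : Lp ℂ p μ, Integrable (fun s => h s * x s) μ ∧
      a x = ∫ s, h s * x s ∂μ ∧ ∫ s, ‖h s * x s‖ ∂μ ≤ ‖a‖ * ‖x‖ := by
  obtain ⟨h, hm, hi, hE⟩ := aux_density_c hp a
  let S : ℕ → Set α := fun n => {s | ‖h s‖ ≤ n}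
  have hS : ∀ n, MeasurableSet (S n) := fun n => measurableSet_le hm.norm measurable_const
  let q := p.conjExponent
  have : Fact (1 ≤ q) := ⟨le_self_add⟩
  let hn : ℕ → α → ℂ := fun n => (S n).indicator h
  have hnb : ∀ n s, ‖hn n s‖ ≤ n := by
    intro n s
    by_cases hs : s ∈ S n
    · have h1 : ‖h s‖ ≤ n := hs
      simpa [hn, hs] using h1
    · simp [hn, hs]
  have hnm : ∀ n, Measurable (hn n) := fun n => hm.indicator (hS n)
  have hnL : ∀ n, MemLp (hn n) q μ := fun n =>
    MemLp.of_bound (hnm n).aestronglyMeasurable n (.of_forall (hnb n))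
  have hoL : ∀ n, MemLp ((S n).indicator (fun _ => (1 : ℂ))) ∞ μ := fun n =>
    (memLp_const (1 : ℂ)).indicator (hS n)
  let M : ℕ → Lp ℂ p μ →L[ℂ] Lp ℂ p μ := fun n =>
    (ContinuousLinearMap.mul ℂ ℂ).holderL μ ∞ p p (hoL n).toLp
  have hM : ∀ n x, M n x =ᵐ[μ] (S n).indicator x := by
    intro n x
    have h1 : M n x =ᵐ[μ] fun s => (MemLp.toLp _ (hoL n) : Lp ℂ ∞ μ) s * x s :=
      (ContinuousLinearMap.mul ℂ ℂ).coeFn_holder (r := p) (hoL n).toLp x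
    filter_upwards [h1, (hoL n).coeFn_toLp] with s h1 h2
    rw [h1, h2]
    by_cases hs : s ∈ S n <;> simp [hs]
  let F : ℕ → Lp ℂ p μ →L[ℂ] ℂ := fun n =>
    (ContinuousLinearMap.mul ℂ ℂ).lpPairing μ q p (hnL n).toLp
  have hF : ∀ n x, F n x = ∫ s, hn n s * x s ∂μ := by
    intro n x
    have := (ContinuousLinearMap.mul ℂ ℂ).lpPairing_eq_integral (hnL n).toLp x
    change F n x = _ at this
    rw [this]
    apply integral_congr_ae
    filter_upwards [(hnL n).coeFn_toLp] with s h2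
    simp [h2]
  have hFM : ∀ n, a.comp (M n) = F n := by
    intro n
    apply aux_ext hp
    intro E mE
    have e1 : M n (indicatorConstLp p mE (measure_ne_top μ _) (1 : ℂ)) =
        indicatorConstLp p ((hS n).inter mE) (measure_ne_top μ _) (1 : ℂ) := by
      apply Lp.ext
      filter_upwards [hM n (indicatorConstLp p mE (measure_ne_top μ _) (1 : ℂ)),
        indicatorConstLp_coeFn (p := p) (hs := mE) (hμs := measure_ne_top μ _) (c := (1 : ℂ)),
        indicatorConstLp_coeFn (p := p) (hs := (hS n).inter mE) (hμs := measure_ne_top μ _)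
          (c := (1 : ℂ))] with s h1 h2 h3
      rw [h1, h3]
      by_cases h4 : s ∈ S n <;> by_cases h5 : s ∈ E <;> simp [h2, h4, h5]
    rw [ContinuousLinearMap.comp_apply, e1, hE, hF, Set.inter_comm,
      ← integral_indicator (mE.inter (hS n))]
    apply integral_congr_ae
    filter_upwards [indicatorConstLp_coeFn (p := p) (hs := mE) (hμs := measure_ne_top μ _)
      (c := (1 : ℂ))] with s h2
    rw [h2]
    by_cases h3 : s ∈ S n <;> by_cases h4 : s ∈ E <;> simp [hn, h3, h4]
  -- bound
  have hb : ∀ x : Lp ℂ p μ, ∫⁻ s, ‖h s * x s‖ₑ ∂μ ≤ ENNReal.ofReal (‖a‖ * ‖x‖) := by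
    intro x
    have hU : (⋃ n, S n) = Set.univ := by
      ext s
      simpa [S] using exists_nat_ge ‖h s‖
    have hdir : Directed (· ⊆ ·) S := by
      apply Monotone.directed_le
      intro m n hmn s hs
      exact le_trans (show ‖h s‖ ≤ m from hs) (by exact_mod_cast hmn)
    rw [← setLIntegral_univ, ← hU, setLIntegral_iUnion_of_directed _ hdir]
    apply iSup_le
    intro n
    let xm : α → ℂ := (Lp.aestronglyMeasurable x).mk x
    have hxm : Measurable xm := (Lp.aestronglyMeasurable x).stronglyMeasurable_mk.measurable
    have hxe : x =ᵐ[μ] xm := (Lp.aestronglyMeasurable x).ae_eq_mk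
    let u : α → ℂ := fun s => (starRingEnd ℂ) (h s * xm s) / (‖h s * xm s‖ : ℂ)
    have hum : Measurable u := by
      have : Measurable (fun s => h s * xm s) := hm.mul hxm
      exact (Complex.continuous_conj.measurable.comp this).div
        (Complex.measurable_ofReal.comp this.norm)
    have hub : ∀ s, ‖u s‖ ≤ 1 := by
      intro s
      simp only [u, norm_div, RCLike.norm_conj, Complex.norm_real, norm_norm]
      exact div_self_le_one _
    have huh : ∀ s, h s * xm s * u s = (‖h s * xm s‖ : ℂ) := by
      intro s
      simp only [u]
      rw [← mul_div_assoc, Complex.mul_conj']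
      by_cases h0 : (‖h s * xm s‖ : ℂ) = 0
      · rw [h0]; simp
      · field_simp
    have hyL : MemLp (fun s => u s * x s) p μ := by
      refine (Lp.memLp x).of_le (hum.aestronglyMeasurable.mul (Lp.aestronglyMeasurable x)) ?_
      refine .of_forall fun s => ?_
      rw [norm_mul]
      exact mul_le_of_le_one_left (norm_nonneg _) (hub s)
    let y : Lp ℂ p μ := hyL.toLp
    have hy : ‖y‖ ≤ ‖x‖ := by
      apply Lp.norm_le_norm_of_ae_le
      filter_upwards [hyL.coeFn_toLp] with s hs
      rw [hs, norm_mul]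
      exact mul_le_of_le_one_left (norm_nonneg _) (hub s)
    have hMy : ‖M n y‖ ≤ ‖y‖ := by
      apply Lp.norm_le_norm_of_ae_le
      filter_upwards [hM n y] with s hs
      rw [hs]
      exact norm_indicator_le_norm_self _ _
    have e2 : F n y = ((∫ s in S n, ‖h s * x s‖ ∂μ : ℝ) : ℂ) := by
      rw [hF, ← integral_complex_ofReal, ← integral_indicator (hS n)]
      apply integral_congr_ae
      filter_upwards [hyL.coeFn_toLp, hxe] with s h1 h2
      rw [h1]
      by_cases h3 : s ∈ S n
      · simp only [hn, h3, Set.indicator_of_mem]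
        rw [h2, ← huh]; ring
      · simp [hn, h3]
    have i1 : Integrable (fun s => ‖h s * x s‖) (μ.restrict (S n)) := by
      have : Integrable (fun s => hn n s * x s) μ :=
        ((Lp.memLp x).integrable Fact.out).bdd_mul (hnm n).aestronglyMeasurable
          (.of_forall (hnb n))
      refine ((this.norm.integrableOn (s := S n)).congr ?_)
      filter_upwards [ae_restrict_mem (hS n)] with s hs
      simp [hn, hs]
    have e3 : ∫⁻ s in S n, ‖h s * x s‖ₑ ∂μ = ENNReal.ofReal (∫ s in S n, ‖h s * x s‖ ∂μ) := by
      rw [ofReal_integral_eq_lintegral_ofReal i1 (.of_forall fun s => norm_nonneg _)]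
      simp [ofReal_norm]
    rw [e3]
    apply ENNReal.ofReal_le_ofReal
    calc ∫ s in S n, ‖h s * x s‖ ∂μ = ‖F n y‖ := by
          rw [e2, Complex.norm_real, Real.norm_of_nonneg]
          exact integral_nonneg fun s => norm_nonneg _
      _ = ‖a (M n y)‖ := by rw [← hFM]; rfl
      _ ≤ ‖a‖ * ‖M n y‖ := a.le_opNorm _
      _ ≤ ‖a‖ * ‖x‖ := by gcongr; exact hMy.trans hy
  have hint : ∀ x : Lp ℂ p μ, Integrable (fun s => h s * x s) μ := fun x =>
    ⟨hm.aestronglyMeasurable.mul (Lp.aestronglyMeasurable x),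
      (hb x).trans_lt ENNReal.ofReal_lt_top⟩
  have hb' : ∀ x : Lp ℂ p μ, ∫ s, ‖h s * x s‖ ∂μ ≤ ‖a‖ * ‖x‖ := by
    intro x
    rw [integral_norm_eq_lintegral_enorm (hint x).1]
    exact ENNReal.toReal_le_of_le_ofReal (by positivity) (hb x)
  let G : Lp ℂ p μ →L[ℂ] ℂ := LinearMap.mkContinuous
    { toFun := fun x => ∫ s, h s * x s ∂μ
      map_add' := fun x y => by
        rw [← integral_add (hint x) (hint y)]
        apply integral_congr_ae
        filter_upwards [Lp.coeFn_add x y] with s hs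
        rw [hs, Pi.add_apply, mul_add]
      map_smul' := fun c x => by
        rw [RingHom.id_apply, smul_eq_mul, ← integral_const_mul]
        apply integral_congr_ae
        filter_upwards [Lp.coeFn_smul c x] with s hs
        rw [hs, Pi.smul_apply, smul_eq_mul]; ring } ‖a‖
    (fun x => (norm_integral_le_integral_norm _).trans (hb' x))
  have hG : ∀ x, G x = ∫ s, h s * x s ∂μ := fun x => rfl
  have haG : a = G := by
    apply aux_ext hp
    intro E mE
    rw [hE, hG, ← integral_indicator mE]
    apply integral_congr_ae
    filter_upwards [indicatorConstLp_coeFn (p := p) (hs := mE) (hμs := measure_ne_top μ _)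
      (c := (1 : ℂ))] with s h2
    rw [h2]
    by_cases h4 : s ∈ E <;> simp [h4]
  exact ⟨h, hm, fun x => ⟨hint x, by rw [← hG, ← haG], hb' x⟩⟩

lemma aux_cube_meas (c : ℕ) : MeasurableSet (unitCube c) :=
  MeasurableSet.univ_pi fun _ => measurableSet_Ico

lemma aux_cube_fin (c : ℕ) :
    IsFiniteMeasure ((volume : Measure (Fin c → ℝ)).restrict (unitCube c)) := by
  constructor
  rw [Measure.restrict_apply_univ, unitCube, Real.volume_pi_Ico]
  simp

lemma aux_cube_mem (c : ℕ) (t : Fin c → ℝ) :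
    (t - fun i => ((⌊t i⌋ : ℤ) : ℝ)) ∈ unitCube c := by
  intro i _
  exact ⟨by simp, by
    have := Int.lt_floor_add_one (t i)
    simp only [Pi.sub_apply]; linarith⟩

lemma aux_cube_uniq (c : ℕ) (t : Fin c → ℝ) (k : Fin c → ℤ)
    (h : (t - fun i => (k i : ℝ)) ∈ unitCube c) : k = fun i => ⌊t i⌋ := by
  funext i
  have := h i (Set.mem_univ i)
  symm
  rw [Int.floor_eq_iff]
  simp only [Pi.sub_apply, Set.mem_Ico] at this
  constructor <;> linarith [this.1, this.2]

/-- Shifting integrals from a translated cube to the unit cube. -/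
lemma aux_shift {c : ℕ} (Q : Set (Fin c → ℝ)) (hQ : MeasurableSet Q) (v : Fin c → ℝ)
    (h x : (Fin c → ℝ) → ℂ)
    (hi : Integrable (fun s => h s * x (s + v)) (volume.restrict Q)) :
    Integrable (fun s => Q.indicator h (s - v) * x s) ∧
    ∫ s, Q.indicator h (s - v) * x s = ∫ s in Q, h s * x (s + v) ∧
    ∫ s, ‖Q.indicator h (s - v) * x s‖ = ∫ s in Q, ‖h s * x (s + v)‖ := by
  have e : (fun s => Q.indicator h (s - v) * x s) =
      fun s => Q.indicator (fun s => h s * x (s + v)) (s - v) := by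
    funext s
    by_cases hs : s - v ∈ Q <;> simp [hs]
  have e' : (fun s => ‖Q.indicator h (s - v) * x s‖) =
      fun s => Q.indicator (fun s => ‖h s * x (s + v)‖) (s - v) := by
    funext s
    by_cases hs : s - v ∈ Q <;> simp [hs]
  refine ⟨?_, ?_, ?_⟩
  · rw [e]
    exact ((integrable_indicator_iff hQ).2 hi).comp_sub_right v
  · rw [e, integral_sub_right_eq_self (fun s => Q.indicator (fun s => h s * x (s + v)) s) v,
      integral_indicator hQ]
  · rw [e', integral_sub_right_eq_self (fun s => Q.indicator (fun s => ‖h s * x (s + v)‖) s) v,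
      integral_indicator hQ]

/-- Interchange of sum and integral. -/
lemma aux_swap {α J : Type*} [MeasurableSpace α] {μ : Measure α} [Countable J]
    (F : J → α → ℂ) (hi : ∀ j, Integrable (F j) μ) (hs : Summable fun j => ∫ s, ‖F j s‖ ∂μ) :
    Integrable (fun s => ∑' j, F j s) μ := by
  refine ⟨(AEMeasurable.tsum fun j => (hi j).1.aemeasurable).aestronglyMeasurable, ?_⟩
  have h1 : ∫⁻ s, ‖∑' j, F j s‖ₑ ∂μ ≤ ∑' j, ∫⁻ s, ‖F j s‖ₑ ∂μ := by
    rw [← lintegral_tsum fun j => (hi j).1.enorm]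
    exact lintegral_mono fun s => enorm_tsum_le_tsum_enorm
  refine h1.trans_lt (lt_top_iff_ne_top.2 ?_)
  have h2 := hs.tsum_ofReal_ne_top
  convert h2 using 3 with j
  rw [ofReal_integral_eq_lintegral_ofReal (hi j).norm (.of_forall fun s => norm_nonneg _)]
  simp [ofReal_norm]

/-- Choice of uniformly controlled nuclear representations. -/
lemma aux_choose (c : ℕ) (p : ℝ≥0∞) [Fact (1 ≤ p)] {X : Type*}
    [NormedAddCommGroup X] [NormedSpace ℂ X] [CompleteSpace X] (g : (Fin c → ℤ) → ℝ)
    (hge : ∀ n, 1 ≤ g n)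
    (T : lp (fun _ : Fin c → ℤ => X) p →L[ℂ] lp (fun _ : Fin c → ℤ => X) p)
    (hT : IsLocallyNuclear c p g T) :
    ∃ (a : (Fin c → ℤ) → (Fin c → ℤ) × ℕ → (X →L[ℂ] ℂ)) (y : (Fin c → ℤ) → (Fin c → ℤ) × ℕ → X),
      (∀ k, Summable fun j => ‖a k j‖ * ‖y k j‖) ∧
      (∀ x k, ∑' j : (Fin c → ℤ) × ℕ, a k j (x (k - j.1)) • y k j = T x k) := by
  obtain ⟨b, β, hβ0, hβ, hn, hle, hsum⟩ := hT
  have hβs : Summable β := Summable.of_nonneg_of_le hβ0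
    (fun m => le_mul_of_one_le_left (hβ0 m) (hge m)) hβ
  obtain ⟨ε, hε, C, hC, -⟩ := posSumOfEncodable one_pos (Fin c → ℤ)
  have hex : ∀ k m, ∃ a y, NuclearRep (b k m) a y ∧ ∑' i, ‖a i‖ * ‖y i‖ < β m + ε m := by
    intro k m
    have h1 : nuclearNorm (b k m) < β m + ε m :=
      (hle k m).trans_lt (lt_add_of_pos_right _ (hε m))
    obtain ⟨a0, y0, h0⟩ := hn k m
    obtain ⟨r, ⟨a, y, hr, rfl⟩, hlt⟩ := exists_lt_of_csInf_lt
      (show {r | ∃ a y, NuclearRep (b k m) a y ∧ r = ∑' i, ‖a i‖ * ‖y i‖}.Nonempty from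
        ⟨_, a0, y0, h0, rfl⟩) h1
    exact ⟨a, y, hr, hlt⟩
  choose a y hr hlt using hex
  have hS : ∀ k, Summable fun j : (Fin c → ℤ) × ℕ => ‖a k j.1 j.2‖ * ‖y k j.1 j.2‖ := by
    intro k
    rw [summable_prod_of_nonneg (fun j => by positivity)]
    refine ⟨fun m => (hr k m).1, ?_⟩
    exact Summable.of_nonneg_of_le (fun m => tsum_nonneg fun i => by positivity)
      (fun m => (hlt k m).le) (hβs.add hC.summable)
  refine ⟨fun k j => a k j.1 j.2, fun k j => y k j.1 j.2, hS, fun x k => ?_⟩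
  have hsm : Summable fun j : (Fin c → ℤ) × ℕ => a k j.1 j.2 (x (k - j.1)) • y k j.1 j.2 := by
    refine Summable.of_norm_bounded ((hS k).mul_left ‖x‖) fun j => ?_
    rw [norm_smul]
    calc _ ≤ (‖a k j.1 j.2‖ * ‖x (k - j.1)‖) * ‖y k j.1 j.2‖ := by
          gcongr; exact (a k j.1 j.2).le_opNorm _
      _ ≤ (‖a k j.1 j.2‖ * ‖x‖) * ‖y k j.1 j.2‖ := by
          gcongr; exact lp.norm_apply_le_norm (one_pos.trans_le (Fact.out : 1 ≤ p)).ne' x _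
      _ = _ := by ring
  exact (hsm.hasSum.prod_fiberwise fun m => (hr k m).2 (x (k - m))).unique (hsum x k)

/-- A locally nuclear operator `A ∈ S_{1,g}(ℝ^c, 𝔖₁)` on `L_p(ℝ^c, ℂ)`, `1 ≤ p < ∞`,
is an integral operator: there is a measurable kernel `n : ℝ^c × ℝ^c → ℂ` with
`(Ax)(t) = ∫ n(t,s) x(s) ds` for a.e. `t`, for every `x ∈ L_p`. -/
theorem locally_nuclear_Lp_integral_rep (c : ℕ) (p : ℝ≥0∞) [Fact (1 ≤ p)]
    (hp : p ≠ ∞) (g : (Fin c → ℤ) → ℝ)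
    (hgpos : ∀ n, 0 < g n) (hg0 : g 0 = 1)
    (hsub : ∀ m n, g (m + n) ≤ g m * g n) (hsymm : ∀ n, g (-n) = g n)
    (hge : ∀ n, 1 ≤ g n)
    (hGRS : ∀ t : Fin c → ℤ,
      Filter.Tendsto (fun n : ℕ => (g ((n : ℤ) • t)) ^ ((n : ℝ)⁻¹))
        Filter.atTop (𝓝 1))
    (φ : Lp ℂ p (volume : Measure (Fin c → ℝ)) ≃ₗᵢ[ℂ]
        lp (fun _ : Fin c → ℤ =>
          Lp ℂ p ((volume : Measure (Fin c → ℝ)).restrict (unitCube c))) p)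
    (hφ : ∀ (x : Lp ℂ p (volume : Measure (Fin c → ℝ))) (m : Fin c → ℤ),
      (φ x m : (Fin c → ℝ) → ℂ)
        =ᵐ[(volume : Measure (Fin c → ℝ)).restrict (unitCube c)]
        fun t => x (t + fun i => (m i : ℝ)))
    (A : Lp ℂ p (volume : Measure (Fin c → ℝ)) →L[ℂ]
      Lp ℂ p (volume : Measure (Fin c → ℝ)))
    (T : lp (fun _ : Fin c → ℤ =>
        Lp ℂ p ((volume : Measure (Fin c → ℝ)).restrict (unitCube c))) p →L[ℂ]
      lp (fun _ : Fin c → ℤ =>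
        Lp ℂ p ((volume : Measure (Fin c → ℝ)).restrict (unitCube c))) p)
    (hAT : ∀ x, T (φ x) = φ (A x))
    (hT : IsLocallyNuclear c p g T) :
    ∃ n : (Fin c → ℝ) × (Fin c → ℝ) → ℂ, Measurable n ∧
      ∀ x : Lp ℂ p (volume : Measure (Fin c → ℝ)),
        ∀ᵐ t ∂(volume : Measure (Fin c → ℝ)),
          Integrable (fun s => n (t, s) * x s) (volume : Measure (Fin c → ℝ)) ∧
          (A x : (Fin c → ℝ) → ℂ) t = ∫ s, n (t, s) * x s := by
  have hQ := aux_cube_meas c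
  have hfin := aux_cube_fin c
  have hp0 : p ≠ 0 := (one_pos.trans_le (Fact.out : 1 ≤ p)).ne'
  obtain ⟨a, y, hS, hTs⟩ := aux_choose c p g hge T hT
  choose h hm hh using fun k j => aux_dual hp (a k j)
  let v : (Fin c → ℤ) → (Fin c → ℝ) := fun k i => (k i : ℝ)
  let ym : (Fin c → ℤ) → (Fin c → ℤ) × ℕ → (Fin c → ℝ) → ℂ :=
    fun k j => (Lp.aestronglyMeasurable (y k j)).mk _
  have hymm : ∀ k j, Measurable (ym k j) := fun k j =>
    (Lp.aestronglyMeasurable (y k j)).stronglyMeasurable_mk.measurable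
  have hyme : ∀ k j, y k j =ᵐ[(volume.restrict (unitCube c))] ym k j := fun k j =>
    (Lp.aestronglyMeasurable (y k j)).ae_eq_mk
  let Y : (Fin c → ℤ) × ((Fin c → ℤ) × ℕ) → (Fin c → ℝ) → ℂ :=
    fun j t => (unitCube c).indicator (ym j.1 j.2) (t - v j.1)
  let H : (Fin c → ℤ) × ((Fin c → ℤ) × ℕ) → (Fin c → ℝ) → ℂ :=
    fun j s => (unitCube c).indicator (h j.1 j.2) (s - v (j.1 - j.2.1))
  have hYm : ∀ j, Measurable (Y j) := fun j =>
    ((hymm _ _).indicator hQ).comp (measurable_id.sub_const _)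
  have hHm : ∀ j, Measurable (H j) := fun j =>
    ((hm _ _).indicator hQ).comp (measurable_id.sub_const _)
  refine ⟨fun q => ∑' j, Y j q.1 * H j q.2,
    Measurable.tsum fun j => ((hYm j).comp measurable_fst).mul ((hHm j).comp measurable_snd), ?_⟩
  intro x
  -- integrals against `H`
  have hHx : ∀ j, Integrable (fun s => H j s * x s) ∧
      ∫ s, H j s * x s = a j.1 j.2 (φ x (j.1 - j.2.1)) ∧
      ∫ s, ‖H j s * x s‖ ≤ ‖a j.1 j.2‖ * ‖φ x‖ := by
    rintro ⟨k, j⟩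
    obtain ⟨i1, i2, i3⟩ := hh k j (φ x (k - j.1))
    have he := hφ x (k - j.1)
    have he' : (fun s => h k j s * φ x (k - j.1) s) =ᵐ[(volume.restrict (unitCube c))]
        fun s => h k j s * x (s + v (k - j.1)) := by
      filter_upwards [he] with s hs
      rw [hs]
    have sh := aux_shift (unitCube c) hQ (v (k - j.1)) (h k j) x (i1.congr he')
    refine ⟨sh.1, ?_, ?_⟩
    · exact sh.2.1.trans ((integral_congr_ae he').symm.trans i2.symm)
    · have e3 : ∫ s, ‖h k j s * φ x (k - j.1) s‖ ∂(volume.restrict (unitCube c)) = ∫ s, ‖h k j s * x (s + v (k - j.1))‖ ∂(volume.restrict (unitCube c)) :=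
        integral_congr_ae (he'.mono fun s hs => by simp only [hs])
      calc _ = ∫ s, ‖h k j s * x (s + v (k - j.1))‖ ∂(volume.restrict (unitCube c)) := sh.2.2
        _ ≤ ‖a k j‖ * ‖φ x (k - j.1)‖ := e3 ▸ i3
        _ ≤ _ := by gcongr; exact lp.norm_apply_le_norm hp0 _ _
  -- almost everywhere statements on the cube
  have hae : ∀ k, ∀ᵐ t ∂(volume.restrict (unitCube c)), (Summable fun j => ‖ym k j t‖ * (‖a k j‖ * ‖φ x‖)) ∧
      HasSum (fun j => ym k j t * a k j (φ x (k - j.1))) (A x (t + v k)) := by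
    intro k
    have s1 : Summable fun j => ‖((‖a k j‖ * ‖φ x‖ : ℝ) : ℂ) • y k j‖ := by
      refine ((hS k).mul_right ‖φ x‖).congr fun j => ?_
      rw [norm_smul, Complex.norm_real, Real.norm_of_nonneg (by positivity)]; ring
    have s2 : Summable fun j => ‖a k j (φ x (k - j.1)) • y k j‖ := by
      refine Summable.of_nonneg_of_le (fun _ => norm_nonneg _) (fun j => ?_)
        ((hS k).mul_right ‖φ x‖)
      rw [norm_smul]
      calc _ ≤ (‖a k j‖ * ‖φ x (k - j.1)‖) * ‖y k j‖ := by
            gcongr; exact (a k j).le_opNorm _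
        _ ≤ (‖a k j‖ * ‖φ x‖) * ‖y k j‖ := by
            gcongr; exact lp.norm_apply_le_norm hp0 _ _
        _ = _ := by ring
    have q1 := Lp.hasSum_coeFn_tsum (tsum_enorm_ne_top_iff_summable_norm.2 s1)
    have q2 := Lp.hasSum_coeFn_tsum (tsum_enorm_ne_top_iff_summable_norm.2 s2)
    rw [hTs (φ x) k, hAT] at q2
    have q3 : ∀ᵐ t ∂(volume.restrict (unitCube c)), ∀ j, y k j t = ym k j t := ae_all_iff.2 fun j => hyme k j
    have q4 : ∀ᵐ t ∂(volume.restrict (unitCube c)), ∀ j, (((‖a k j‖ * ‖φ x‖ : ℝ) : ℂ) • y k j) t =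
        ((‖a k j‖ * ‖φ x‖ : ℝ) : ℂ) * y k j t := ae_all_iff.2 fun j => by
      filter_upwards [Lp.coeFn_smul ((‖a k j‖ * ‖φ x‖ : ℝ) : ℂ) (y k j)] with t ht
      rw [ht]; rfl
    have q5 : ∀ᵐ t ∂(volume.restrict (unitCube c)), ∀ j, (a k j (φ x (k - j.1)) • y k j) t =
        a k j (φ x (k - j.1)) * y k j t := ae_all_iff.2 fun j => by
      filter_upwards [Lp.coeFn_smul (a k j (φ x (k - j.1))) (y k j)] with t ht
      rw [ht]; rfl
    filter_upwards [q1, q2, q3, q4, q5, hφ (A x) k] with t q1 q2 q3 q4 q5 q6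
    constructor
    · refine q1.summable.norm.congr fun j => ?_
      rw [q4, q3, norm_mul, Complex.norm_real, Real.norm_of_nonneg (by positivity)]; ring
    · rw [q6] at q2
      refine q2.congr_fun fun j => ?_
      rw [q5, q3, mul_comm]
  have hae' : ∀ᵐ t ∂(volume : Measure (Fin c → ℝ)), ∀ k, t - v k ∈ (unitCube c) →
      (Summable fun j => ‖ym k j (t - v k)‖ * (‖a k j‖ * ‖φ x‖)) ∧
      HasSum (fun j => ym k j (t - v k) * a k j (φ x (k - j.1))) (A x (t - v k + v k)) := by
    refine ae_all_iff.2 fun k => ?_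
    have := (ae_restrict_iff' hQ).1 (hae k)
    exact (measurePreserving_sub_right volume (v k)).quasiMeasurePreserving.ae this
  filter_upwards [hae'] with t ht
  let k : Fin c → ℤ := fun i => ⌊t i⌋
  have hk : t - v k ∈ (unitCube c) := aux_cube_mem c t
  obtain ⟨h1, h2⟩ := ht k hk
  rw [sub_add_cancel] at h2
  have hYk : ∀ j, Y (k, j) t = ym k j (t - v k) := fun j => by simp [Y, hk]
  have hY0 : ∀ j, j ∉ Set.range (fun j : (Fin c → ℤ) × ℕ => (k, j)) → Y j t = 0 := by
    rintro ⟨k', j⟩ hj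
    have : t - v k' ∉ (unitCube c) := fun hk' => hj ⟨j, by rw [aux_cube_uniq c t k' hk']⟩
    simp [Y, this]
  have hinj : Function.Injective (fun j : (Fin c → ℤ) × ℕ => (k, j)) := fun _ _ e =>
    (Prod.mk.inj e).2
  have fi : ∀ j, Integrable (fun s => Y j t * H j s * x s) := fun j => by
    simpa only [mul_assoc] using (hHx j).1.const_mul (Y j t)
  have fI : ∀ j, ∫ s, Y j t * H j s * x s = Y j t * a j.1 j.2 (φ x (j.1 - j.2.1)) := fun j => by
    simp only [mul_assoc]
    rw [integral_const_mul, (hHx j).2.1]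
  have fN : ∀ j, ∫ s, ‖Y j t * H j s * x s‖ = ‖Y j t‖ * ∫ s, ‖H j s * x s‖ := fun j => by
    rw [← integral_const_mul]
    simp only [norm_mul, mul_assoc]
  have fS : Summable fun j => ∫ s, ‖Y j t * H j s * x s‖ := by
    rw [← hinj.summable_iff]
    · refine Summable.of_nonneg_of_le (fun j => integral_nonneg fun s => norm_nonneg _)
        (fun j => ?_) h1
      simp only [Function.comp]
      rw [fN, hYk]
      gcongr
      exact (hHx (k, j)).2.2
    · intro j hj
      simp [hY0 j hj]
  have e : (fun s => (∑' j, Y j t * H j s) * x s) = fun s => ∑' j, Y j t * H j s * x s := by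
    funext s
    rw [tsum_mul_right]
  change Integrable (fun s => (∑' j, Y j t * H j s) * x s) ∧
    A x t = ∫ s, (∑' j, Y j t * H j s) * x s
  rw [e]
  refine ⟨aux_swap _ fi fS, ?_⟩
  have r1 := hasSum_integral_of_summable_integral_norm fi fS
  simp only [fI] at r1
  rw [← hinj.hasSum_iff (fun j hj => by simp [hY0 j hj])] at r1
  refine h2.unique (r1.congr_fun fun j => ?_)
  simp [Function.comp, hYk]
end
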